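/- Assume the standing hypotheses (H1)–(H6). Let U : ℝ × ℝ² → ℝ be a smooth compactly supported function and define the propagator C(k₀, k) = U(k₀, k)/(i k₀ − e(k)) wherever i k₀ − e(k) ≠ 0. Let V : (ℝ × ℝ²)⁴ → ℂ be a C¹ function. Then for every q = (q₀, q⃗) ∈ ℝ × ℝ² the integral F(q) = ∫_{ℝ×ℝ²} ∫_{ℝ×ℝ²} V(k, p, k + p − q, q) C(k) C(p) C(k + p − q) dk dp converges absolutely, and for each fixed q₀ ∈ ℝ the function q⃗ ↦ F(q₀, q⃗) is continuously differentiable on ℝ². -/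

import Mathlib

open MeasureTheory Polynomial

/-- The nonflatness condition (H5). -/
def NonFlatCond (e : ℝ × ℝ → ℝ) (r n₀ : ℕ) : Prop :=
  ∀ kt : ℝ × ℝ, e kt = 0 →
    (∀ U ∈ nhds (0 : ℝ), ∀ f : ℝ → ℝ, ContDiffOn ℝ (r - 2 : ℕ) f U → f 0 = 0 →
      (∀ t ∈ U, e (kt.1 + t, kt.2 + f t) = 0) →
      ∃ m : ℕ, 2 ≤ m ∧ m ≤ n₀ - 1 ∧ iteratedDerivWithin m f U 0 ≠ 0) ∧
    (∀ U ∈ nhds (0 : ℝ), ∀ f : ℝ → ℝ, ContDiffOn ℝ (r - 2 : ℕ) f U → f 0 = 0 →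
      (∀ t ∈ U, e (kt.1 + f t, kt.2 + t) = 0) →
      ∃ m : ℕ, 2 ≤ m ∧ m ≤ n₀ - 1 ∧ iteratedDerivWithin m f U 0 ≠ 0)

/-- Auxiliary to the no-nesting condition (H6): for curves `f` through `kt` lying in the
zero set of `e₁` and curves `g` through `pt` lying in the zero set of `e₂`, some derivative
of `f - g` at `0` of order at most `n₀ - 1` is nonzero (in both coordinate orientations). -/
def NestPairCond (e₁ e₂ : ℝ × ℝ → ℝ) (r n₀ : ℕ) (kt pt : ℝ × ℝ) : Prop :=
  (∀ U ∈ nhds (0 : ℝ), ∀ f g : ℝ → ℝ,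
    ContDiffOn ℝ (r - 2 : ℕ) f U → ContDiffOn ℝ (r - 2 : ℕ) g U → f 0 = 0 → g 0 = 0 →
    (∀ t ∈ U, e₁ (kt.1 + t, kt.2 + f t) = 0) →
    (∀ t ∈ U, e₂ (pt.1 + t, pt.2 + g t) = 0) →
    ∃ m : ℕ, m ≤ n₀ - 1 ∧ iteratedDerivWithin m (fun t => f t - g t) U 0 ≠ 0) ∧
  (∀ U ∈ nhds (0 : ℝ), ∀ f g : ℝ → ℝ,
    ContDiffOn ℝ (r - 2 : ℕ) f U → ContDiffOn ℝ (r - 2 : ℕ) g U → f 0 = 0 → g 0 = 0 →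
    (∀ t ∈ U, e₁ (kt.1 + f t, kt.2 + t) = 0) →
    (∀ t ∈ U, e₂ (pt.1 + g t, pt.2 + t) = 0) →
    ∃ m : ℕ, m ≤ n₀ - 1 ∧ iteratedDerivWithin m (fun t => f t - g t) U 0 ≠ 0)

/-- The no-nesting condition (H6), including the reflected condition (curves in `-F`)
when `e` is not an even function. -/
def NoNestingCond (e : ℝ × ℝ → ℝ) (r n₀ : ℕ) : Prop :=
  (∀ kt pt : ℝ × ℝ, e kt = 0 → e pt = 0 → kt ≠ pt → NestPairCond e e r n₀ kt pt) ∧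
  ((¬ ∀ k : ℝ × ℝ, e (-k) = e k) →
    ∀ kt pt : ℝ × ℝ, e kt = 0 → e (-pt) = 0 →
      NestPairCond e (fun k => e (-k)) r n₀ kt pt)

/-- The second derivative (Hessian) of `e : ℝ² → ℝ` at `p` in directions `u`, `v`. -/
noncomputable def hess2 (e : ℝ × ℝ → ℝ) (p u v : ℝ × ℝ) : ℝ :=
  fderiv ℝ (fun q => fderiv ℝ e q u) p v

/-- (H4): the Hessian matrix of `e` at `p` is nonsingular, with one positive and one
negative eigenvalue. -/
def HessCond (e : ℝ × ℝ → ℝ) (p : ℝ × ℝ) : Prop :=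
  ∃ μ₁ μ₂ : ℝ, 0 < μ₁ ∧ μ₂ < 0 ∧
    (!![hess2 e p (1, 0) (1, 0), hess2 e p (1, 0) (0, 1);
        hess2 e p (0, 1) (1, 0), hess2 e p (0, 1) (0, 1)]).charpoly
      = (X - Polynomial.C μ₁) * (X - Polynomial.C μ₂)

/-- The propagator `C (k₀, k) = U (k₀, k) / (i k₀ - e k)`. -/
noncomputable def Cprop (e : ℝ × ℝ → ℝ) (U : ℝ × (ℝ × ℝ) → ℝ) (k : ℝ × (ℝ × ℝ)) : ℂ :=
  (U k : ℂ) / (Complex.I * (k.1 : ℂ) - (e k.2 : ℂ))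

/-- The two-loop value
`F q = ∫∫ V (k, p, k + p - q, q) C k C p C (k + p - q) dk dp`. -/
noncomputable def Fval (e : ℝ × ℝ → ℝ) (U : ℝ × (ℝ × ℝ) → ℝ)
    (V : (ℝ × (ℝ × ℝ)) × (ℝ × (ℝ × ℝ)) × (ℝ × (ℝ × ℝ)) × (ℝ × (ℝ × ℝ)) → ℂ)
    (q : ℝ × (ℝ × ℝ)) : ℂ :=
  ∫ kp : (ℝ × (ℝ × ℝ)) × (ℝ × (ℝ × ℝ)),
    V (kp.1, kp.2, kp.1 + kp.2 - q, q) * Cprop e U kp.1 * Cprop e U kp.2 *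
      Cprop e U (kp.1 + kp.2 - q)

section aux
open Set Filter Topology
open scoped ENNReal

/-- negative power, with value `∞` at `0`. -/
noncomputable def np (s x : ℝ) : ℝ≥0∞ := (ENNReal.ofReal |x|) ^ (-s)

lemma np_measurable (s : ℝ) : Measurable (np s) := by
  unfold np
  fun_prop

lemma sublevel_one (I : Set ℝ) (hI : Convex ℝ I) (H : ℝ → ℝ) (c ε : ℝ) (hc : 0 < c)
    (hH : Differentiable ℝ H) (hd : ∀ t ∈ I, c ≤ |deriv H t|) :
    volume {t ∈ I | |H t| ≤ ε} ≤ ENNReal.ofReal (2 * (ε / c)) := by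
  refine (Real.volume_le_diam _).trans ?_
  refine Metric.ediam_le fun x hx y hy => ?_
  rw [edist_dist]
  apply ENNReal.ofReal_le_ofReal
  wlog hxy : x < y generalizing x y
  · rcases lt_or_eq_of_le (not_lt.1 hxy) with h | h
    · rw [dist_comm]; exact this y hy x hx h
    · subst h
      have : 0 ≤ ε := (abs_nonneg _).trans hx.2
      simp; positivity
  obtain ⟨ξ, hξ, h⟩ := exists_deriv_eq_slope H hxy hH.continuous.continuousOn hH.differentiableOn
  have hξI : ξ ∈ I := hI.ordConnected.out hx.1 hy.1 ⟨hξ.1.le, hξ.2.le⟩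
  have h1 := hd ξ hξI
  have hpos : 0 < y - x := sub_pos.2 hxy
  rw [h, abs_div, abs_of_pos hpos, le_div_iff₀ hpos] at h1
  have h2 : |H y - H x| ≤ 2 * ε := by
    have := abs_sub (H y) (H x)
    linarith [hx.2, hy.2]
  rw [dist_comm, Real.dist_eq, abs_of_pos hpos]
  have : (y - x) ≤ 2 * ε / c := by
    rw [le_div_iff₀ hc]; linarith
  linarith [show 2 * ε / c = 2 * (ε / c) by ring]

lemma sublevel (m : ℕ) : ∃ C : ℝ, 0 < C ∧ ∀ (I : Set ℝ), Convex ℝ I → ∀ (H : ℝ → ℝ) (c ε : ℝ),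
    0 < c → 0 < ε → ContDiff ℝ (m + 1 : ℕ) H → (∀ t ∈ I, c ≤ |iteratedDeriv (m + 1) H t|) →
    volume {t ∈ I | |H t| ≤ ε} ≤ ENNReal.ofReal (C * (ε / c) ^ (1 / ((m : ℝ) + 1))) := by
  induction m with
  | zero =>
    refine ⟨2, by norm_num, fun I hI H c ε hc hε hH hd => ?_⟩
    have := sublevel_one I hI H c ε hc (hH.differentiable (by norm_num)) (by simpa using hd)
    simpa using this
  | succ m ih =>
    obtain ⟨C, hC, ih⟩ := ih
    refine ⟨2 * C + 2, by positivity, fun I hI H c ε hc hε hH hd => ?_⟩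
    set g := iteratedDeriv (m + 1) H with hg
    have hgd : Differentiable ℝ g := hH.differentiable_iteratedDeriv (m + 1) (by exact_mod_cast Nat.lt_succ_self _)
    have hgd' : ∀ t, deriv g t = iteratedDeriv (m + 1 + 1) H t := fun t => by
      rw [iteratedDeriv_succ]
    set δ := c * (ε / c) ^ (1 / ((m : ℝ) + 1 + 1)) with hδ
    have hδ0 : 0 < δ := by positivity
    have hH' : ContDiff ℝ (m + 1 : ℕ) H := hH.of_le (by exact_mod_cast Nat.le_succ _)
    -- two intervals
    have key : Convex ℝ {t ∈ I | δ ≤ g t} ∧ Convex ℝ {t ∈ I | g t ≤ -δ} := by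
      have hne : ∀ t ∈ I, deriv g t ≠ 0 := fun t ht h0 => by
        have := hd t ht
        rw [← hgd', h0, abs_zero] at this
        linarith
      rcases hasDerivWithinAt_forall_lt_or_forall_gt_of_forall_ne hI
        (fun x hx => (hgd x).hasDerivAt.hasDerivWithinAt) hne with h | h
      · have : AntitoneOn g I := antitoneOn_of_deriv_nonpos hI hgd.continuous.continuousOn
          hgd.differentiableOn (fun x hx => (h x (interior_subset hx)).le)
        exact ⟨this.convex_ge hI _, this.convex_le hI _⟩
      · have : MonotoneOn g I := monotoneOn_of_deriv_nonneg hI hgd.continuous.continuousOn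
          hgd.differentiableOn (fun x hx => (h x (interior_subset hx)).le)
        exact ⟨this.convex_ge hI _, this.convex_le hI _⟩
    have b1 := ih _ key.1 H δ ε hδ0 hε hH' (fun t ht => ht.2.trans (le_abs_self _))
    have b2 := ih _ key.2 H δ ε hδ0 hε hH' (fun t ht => by
      have := neg_le_abs (g t); have := ht.2; linarith)
    have b3 := sublevel_one I hI g c δ hc hgd (fun t ht => by rw [hgd']; exact hd t ht)
    have hsub : {t ∈ I | |H t| ≤ ε} ⊆ ({t ∈ {t ∈ I | δ ≤ g t} | |H t| ≤ ε} ∪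
        {t ∈ {t ∈ I | g t ≤ -δ} | |H t| ≤ ε}) ∪ {t ∈ I | |g t| ≤ δ} := by
      intro t ht
      by_cases h1 : |g t| ≤ δ
      · right; exact ⟨ht.1, h1⟩
      · left
        push Not at h1
        rcases lt_abs.1 h1 with h | h
        · left; exact ⟨⟨ht.1, h.le⟩, ht.2⟩
        · right; exact ⟨⟨ht.1, by linarith⟩, ht.2⟩
    have hexp : (ε / δ) ^ (1 / ((m : ℝ) + 1)) = (ε / c) ^ (1 / ((m : ℝ) + 1 + 1)) := by
      have hx : 0 < ε / c := by positivity
      have : ε / δ = (ε / c) ^ (((m : ℝ) + 1) / ((m : ℝ) + 1 + 1)) := by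
        have h1 : ((m : ℝ) + 1) / ((m : ℝ) + 1 + 1) = 1 - 1 / ((m : ℝ) + 1 + 1) := by
          field_simp; ring
        rw [h1, Real.rpow_sub hx, Real.rpow_one, hδ]
        field_simp
      rw [this, ← Real.rpow_mul hx.le]
      congr 1
      field_simp
    rw [hexp] at b1 b2
    have hd2 : δ / c = (ε / c) ^ (1 / ((m : ℝ) + 1 + 1)) := by rw [hδ]; field_simp
    rw [hd2] at b3
    set X := (ε / c) ^ (1 / ((m : ℝ) + 1 + 1)) with hX
    have hX0 : 0 < X := by positivity
    calc volume {t ∈ I | |H t| ≤ ε} ≤ _ := measure_mono hsub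
      _ ≤ _ := measure_union_le _ _
      _ ≤ _ := add_le_add (measure_union_le _ _) le_rfl
      _ ≤ _ := add_le_add (add_le_add b1 b2) b3
      _ = ENNReal.ofReal ((2 * C + 2) * (ε / c) ^ (1 / (((m + 1 : ℕ) : ℝ) + 1))) := by
        push_cast
        rw [← hX, ← ENNReal.ofReal_add (by positivity) (by positivity),
          ← ENNReal.ofReal_add (by positivity) (by positivity)]
        congr 1; ring

/-- sublevel bounds give integral bounds -/
lemma lint_of_sublevel (L C s β : ℝ) (hβ : 0 < β) (hs : β < s) :
    ∃ B : ℝ≥0∞, B < ∞ ∧ ∀ {α : Type} [MeasurableSpace α] (μ : Measure α) (g : α → ℝ), Measurable g →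
      μ univ ≤ ENNReal.ofReal L → (∀ ε > 0, μ {x | |g x| ≤ ε} ≤ ENNReal.ofReal (C * ε ^ s)) →
      ∫⁻ x, np β (g x) ∂μ ≤ B := by
  refine ⟨ENNReal.ofReal L + ∫⁻ t in Ioi (1:ℝ), ENNReal.ofReal (C * t ^ (-(s / β))), ?_, ?_⟩
  · refine ENNReal.add_lt_top.2 ⟨ENNReal.ofReal_lt_top, ?_⟩
    have h1 : IntegrableOn (fun t : ℝ => C * t ^ (-(s / β))) (Ioi 1) :=
      (integrableOn_Ioi_rpow_of_lt (by
        have : 1 < s / β := by rw [lt_div_iff₀ hβ]; linarith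
        linarith) one_pos).const_mul C
    exact h1.lintegral_lt_top
  · intro α _ μ g hg hL hsub
    have hz : μ {x | g x = 0} = 0 := by
      have hlim : Tendsto (fun ε : ℝ => ENNReal.ofReal (C * ε ^ s)) (𝓝[>] 0) (𝓝 0) := by
        have h1 : Tendsto (fun ε : ℝ => C * ε ^ s) (𝓝[>] 0) (𝓝 (C * 0 ^ s)) :=
          ((Real.continuousAt_rpow_const 0 s (Or.inr (by linarith))).tendsto.mono_left
            nhdsWithin_le_nhds).const_mul C
        rw [Real.zero_rpow (by linarith), mul_zero] at h1
        simpa using ENNReal.tendsto_ofReal h1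
      have hle : μ {x | g x = 0} ≤ 0 := by
        refine ge_of_tendsto hlim ?_
        filter_upwards [self_mem_nhdsWithin] with ε hε
        refine (measure_mono ?_).trans (hsub ε hε)
        intro x (hx : g x = 0)
        show |g x| ≤ ε
        rw [hx, abs_zero]
        exact le_of_lt hε
      simpa using hle
    have hae : ∀ᵐ x ∂μ, g x ≠ 0 := by
      rw [ae_iff]; simpa using hz
    have e1 : ∫⁻ x, np β (g x) ∂μ = ∫⁻ x, ENNReal.ofReal (|g x| ^ (-β)) ∂μ := by
      refine lintegral_congr_ae ?_
      filter_upwards [hae] with x hx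
      simp only [np]
      rw [ENNReal.ofReal_rpow_of_pos (abs_pos.2 hx)]
    have hmeas : Measurable fun x => |g x| ^ (-β) := by
      have : Measurable fun x => |g x| := by
        exact hg.norm
      exact this.pow_const _
    rw [e1, lintegral_eq_lintegral_meas_lt μ (Eventually.of_forall fun x => by positivity)
      hmeas.aemeasurable]
    rw [← Ioc_union_Ioi_eq_Ioi (zero_le_one (α := ℝ))]
    refine (lintegral_union_le _ _ _).trans ?_
    refine add_le_add ?_ ?_
    · calc _ ≤ ∫⁻ t in Ioc (0:ℝ) 1, ENNReal.ofReal L := by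
            refine lintegral_mono fun t => (measure_mono (subset_univ _)).trans hL
        _ = ENNReal.ofReal L := by simp
    · refine setLIntegral_mono' measurableSet_Ioi fun t (ht : 1 < t) => ?_
      have ht0 : 0 < t := by linarith
      have h2 := hsub (t ^ (-(1/β))) (by positivity)
      rw [← Real.rpow_mul ht0.le, show -(1/β) * s = -(s/β) by ring] at h2
      refine (measure_mono ?_).trans h2
      intro x (hx : t < |g x| ^ (-β))
      have hgx : 0 < |g x| := by
        rcases (abs_nonneg (g x)).lt_or_eq with h | h
        · exact h
        · rw [← h, Real.zero_rpow (by linarith)] at hx; linarith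
      have h3 : (|g x| ^ (-β)) ^ (-(1/β)) ≤ t ^ (-(1/β)) :=
        Real.rpow_le_rpow_of_nonpos ht0 hx.le (by
          have : 0 < 1/β := by positivity
          linarith)
      rw [← Real.rpow_mul hgx.le, show -β * -(1/β) = 1 by field_simp, Real.rpow_one] at h3
      exact h3

lemma vdc_lint (m : ℕ) (c L β : ℝ) (hc : 0 < c) (hβ : 0 < β) (hm : β * m < 1) :
    ∃ B : ℝ≥0∞, B < ∞ ∧ ∀ (I : Set ℝ), Convex ℝ I → MeasurableSet I →
      volume I ≤ ENNReal.ofReal L → ∀ (H : ℝ → ℝ), ContDiff ℝ m H →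
      (∀ t ∈ I, c ≤ |iteratedDeriv m H t|) → ∫⁻ t in I, np β (H t) ≤ B := by
  rcases m with _ | m
  · refine ⟨ENNReal.ofReal (c ^ (-β)) * ENNReal.ofReal L,
      ENNReal.mul_lt_top ENNReal.ofReal_lt_top ENNReal.ofReal_lt_top, ?_⟩
    intro I hI hIm hL H hH hd
    calc _ ≤ ∫⁻ t in I, ENNReal.ofReal (c ^ (-β)) := by
          refine setLIntegral_mono' hIm fun t ht => ?_
          have := hd t ht
          simp only [iteratedDeriv_zero] at this
          unfold np
          rw [← ENNReal.ofReal_rpow_of_pos hc, ENNReal.rpow_neg, ENNReal.rpow_neg]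
          gcongr
      _ ≤ _ := by
          rw [lintegral_const, Measure.restrict_apply_univ]
          gcongr
  · obtain ⟨C, hC, hsub⟩ := sublevel m
    have h0 : (0:ℝ) < (m:ℝ) + 1 := by positivity
    obtain ⟨B, hB, h⟩ := lint_of_sublevel L (C * (1 / c) ^ (1 / ((m:ℝ)+1))) (1 / ((m:ℝ)+1)) β
      hβ (by rw [lt_div_iff₀ h0]; push_cast at hm; exact hm)
    refine ⟨B, hB, fun I hI hIm hL H hH hd => ?_⟩
    refine h _ H hH.continuous.measurable (by simpa using hL) fun ε hε => ?_
    rw [Measure.restrict_apply (show MeasurableSet {x | |H x| ≤ ε} from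
      measurableSet_le hH.continuous.measurable.norm measurable_const)]
    have := hsub I hI H c ε hc hε hH hd
    rw [show {x | |H x| ≤ ε} ∩ I = {t ∈ I | |H t| ≤ ε} by ext; simp [and_comm]]
    refine this.trans (le_of_eq ?_)
    rw [div_eq_mul_inv ε c, Real.mul_rpow hε.le (by positivity), one_div c]
    congr 1; ring

/-- flat functions -/
lemma isLittleO_of_iteratedDeriv (n : ℕ) (f : ℝ → ℝ) (hf : ContDiff ℝ n f)
    (h : ∀ m ≤ n, iteratedDeriv m f 0 = 0) : f =o[𝓝 0] fun t => t ^ n := by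
  have := taylor_isLittleO_univ (x₀ := 0) hf
  refine this.congr (fun x => ?_) (fun x => by simp)
  rw [taylor_within_apply, Finset.sum_eq_zero, sub_zero]
  intro k hk
  rw [iteratedDerivWithin_univ, h k (by simpa [Nat.lt_succ_iff] using hk)]
  simp

lemma iteratedDeriv_of_isLittleO (n : ℕ) (f : ℝ → ℝ) (hf : ContDiff ℝ n f)
    (h : f =o[𝓝 0] fun t => t ^ n) : ∀ m ≤ n, iteratedDeriv m f 0 = 0 := by
  intro m
  induction m using Nat.strong_induction_on with
  | _ m ih =>
    intro hm
    have h1 := taylor_isLittleO_univ (x₀ := 0) (hf.of_le (m := (m : WithTop ℕ∞)) (by exact_mod_cast hm))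
    have h2 : f =o[𝓝 0] fun t => t ^ m := by
      refine h.trans_isBigO ?_
      refine Asymptotics.IsBigO.of_bound 1 ?_
      filter_upwards [Metric.ball_mem_nhds (0:ℝ) one_pos] with t ht
      rw [one_mul, norm_pow, norm_pow]
      exact pow_le_pow_of_le_one (norm_nonneg _) (by simpa using (mem_ball_zero_iff.1 ht).le) hm
    have h3 : (fun t : ℝ => t ^ m * ((m.factorial : ℝ)⁻¹ * iteratedDeriv m f 0)) =o[𝓝 0] fun t : ℝ => t ^ m := by
      have h4 := h2.sub (h1.congr_right (g₂ := fun t : ℝ => t ^ m) (fun x => by simp))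
      refine h4.congr_left fun x => ?_
      rw [sub_sub_cancel, taylor_within_apply, Finset.sum_range_succ, Finset.sum_eq_zero]
      · rw [iteratedDerivWithin_univ]; simp; ring
      · intro k hk
        have hk' := Finset.mem_range.1 hk
        rw [iteratedDerivWithin_univ, ih k hk' (hk'.le.trans hm)]
        simp
    by_contra hne
    have h5 := h3.bound (c := |(m.factorial : ℝ)⁻¹ * iteratedDeriv m f 0| / 2) (by
      have : (m.factorial : ℝ)⁻¹ * iteratedDeriv m f 0 ≠ 0 :=
        mul_ne_zero (inv_ne_zero (by exact_mod_cast m.factorial_ne_zero)) hne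
      positivity)
    have h6 : ∀ᶠ t in 𝓝[>] (0:ℝ), False := by
      filter_upwards [nhdsWithin_le_nhds h5, self_mem_nhdsWithin] with t ht (ht0 : 0 < t)
      have hpos : 0 < |(m.factorial : ℝ)⁻¹ * iteratedDeriv m f 0| := abs_pos.2
        (mul_ne_zero (inv_ne_zero (by exact_mod_cast m.factorial_ne_zero)) hne)
      rw [norm_mul, norm_pow, Real.norm_eq_abs, Real.norm_eq_abs, abs_of_pos ht0] at ht
      have : 0 < t ^ m := by positivity
      nlinarith
    exact (h6.exists).choose_spec

lemma deriv_curry {P : Type} [NormedAddCommGroup P] [NormedSpace ℝ P] {G : ℝ × P → ℝ}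
    (hG : Differentiable ℝ G) (p : P) :
    deriv (fun t => G (t, p)) = fun t => fderiv ℝ G (t, p) (1, 0) := by
  funext t
  have h1 : HasDerivAt (fun t : ℝ => (t, p)) ((1:ℝ), (0:P)) t :=
    (hasDerivAt_id t).prodMk (hasDerivAt_const t p)
  exact ((hG (t, p)).hasFDerivAt.comp_hasDerivAt t h1).deriv

lemma continuous_iteratedDeriv_param (m : ℕ) {P : Type} [NormedAddCommGroup P] [NormedSpace ℝ P]
    (G : ℝ × P → ℝ) (hG : ContDiff ℝ m G) :
    Continuous fun q : ℝ × P => iteratedDeriv m (fun t => G (t, q.2)) q.1 := by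
  induction m generalizing G with
  | zero => simpa using hG.continuous
  | succ m ih =>
    have hd : Differentiable ℝ G := hG.differentiable (by simp)
    have := ih (fun q => fderiv ℝ G q (1, 0)) (by
      have := hG.fderiv_right (m := (m : WithTop ℕ∞)) (by norm_cast)
      exact this.clm_apply contDiff_const)
    convert this using 2 with q
    rw [iteratedDeriv_succ', deriv_curry hd]

/-- parametric integrals over `[0,1]` are smooth. -/
lemma contDiff_param_integral (n : ℕ) {P F : Type} [NormedAddCommGroup P] [NormedSpace ℝ P]
    [FiniteDimensional ℝ P]
    [NormedAddCommGroup F] [NormedSpace ℝ F] [CompleteSpace F] (G : P × ℝ → F)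
    (hG : ContDiff ℝ n G) : ContDiff ℝ n fun p => ∫ u in (0:ℝ)..1, G (p, u) := by
  induction n generalizing F with
  | zero =>
    have hc := hG.continuous
    simp only [Nat.cast_zero, contDiff_zero]
    exact intervalIntegral.continuous_parametric_intervalIntegral_of_continuous' (f := fun p u => G (p, u)) hc 0 1
  | succ n ih =>
    have hGd : Differentiable ℝ G := hG.differentiable (by simp)
    set G' : P × ℝ → (P →L[ℝ] F) := fun q => (fderiv ℝ G q).comp (ContinuousLinearMap.inl ℝ P ℝ) with hG'
    have hG'c : ContDiff ℝ n G' := by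
      have := hG.fderiv_right (m := (n : WithTop ℕ∞)) (by norm_cast)
      exact this.clm_comp contDiff_const
    have hder : ∀ p, HasFDerivAt (fun p => ∫ u in (0:ℝ)..1, G (p, u))
        (∫ u in (0:ℝ)..1, G' (p, u)) p := by
      intro p
      obtain ⟨M, hM⟩ := ((ProperSpace.isCompact_closedBall p 1).prod (isCompact_Icc (a := (0:ℝ)) (b := 1))).exists_bound_of_continuousOn
        hG'c.continuous.continuousOn
      have hc1 : ∀ p, Continuous fun u : ℝ => G (p, u) := fun p => hG.continuous.comp (by fun_prop)
      have hc2 : ∀ p, Continuous fun u : ℝ => G' (p, u) := fun p => hG'c.continuous.comp (by fun_prop)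
      refine intervalIntegral.hasFDerivAt_integral_of_dominated_of_fderiv_le (F := fun p u => G (p, u))
        (F' := fun p u => G' (p, u)) (bound := fun _ => M)
        (Metric.closedBall_mem_nhds p one_pos) ?_ ?_ ?_ ?_ ?_ ?_
      · exact Eventually.of_forall fun p => (hc1 p).aestronglyMeasurable
      · exact (hc1 p).intervalIntegrable _ _
      · exact (hc2 p).aestronglyMeasurable
      · refine Eventually.of_forall fun u hu x hx => hM (x, u) ⟨hx, ?_⟩
        rw [uIoc_of_le zero_le_one] at hu
        exact ⟨hu.1.le, hu.2⟩
      · simp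
      · refine Eventually.of_forall fun u hu x hx => ?_
        exact (hGd (x, u)).hasFDerivAt.comp x (hasFDerivAt_prodMk_left x u)
    have : ContDiff ℝ ((n : WithTop ℕ∞) + 1) fun p => ∫ u in (0:ℝ)..1, G (p, u) := by
      rw [contDiff_succ_iff_hasFDerivAt]
      refine ⟨_, ?_, hder⟩
      exact ih G' hG'c
    exact_mod_cast this

lemma ift_aux (n : ℕ) (hn : 1 ≤ n) (Φ : ℝ × ℝ → ℝ) (hΦ : ContDiff ℝ n Φ) (y0 : ℝ)
    (h0 : Φ (0, y0) = 0) (hd : fderiv ℝ Φ (0, y0) (0, 1) ≠ 0) :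
    ∃ Y : ℝ → ℝ, ContDiff ℝ n Y ∧ Y 0 = y0 ∧ ∀ᶠ t in 𝓝 (0:ℝ), Φ (t, Y t) = 0 := by
  have hn0 : (n : WithTop ℕ∞) ≠ 0 := by
    have : n ≠ 0 := by omega
    exact_mod_cast this
  have cdf : ContDiffAt ℝ n Φ (0, y0) := hΦ.contDiffAt
  have inv : (fderiv ℝ Φ (0, y0) ∘L .inr ℝ ℝ ℝ).IsInvertible := by
    set a := fderiv ℝ Φ (0, y0) (0, 1) with ha
    refine ⟨ContinuousLinearEquiv.smulLeft (Units.mk0 a hd), ?_⟩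
    ext
    simp [ha]
  set Y1 := cdf.implicitFunction hn0 inv
  have hY1 : ContDiffAt ℝ n Y1 0 := cdf.contDiffAt_implicitFunction hn0 inv
  have hY10 : Y1 0 = y0 := cdf.implicitFunction_apply_self hn0 inv
  have hY1e : ∀ᶠ t in 𝓝 (0:ℝ), Φ (t, Y1 t) = 0 := by
    have := cdf.eventually_apply_implicitFunction hn0 inv
    simpa [h0] using this
  have hev := hY1.eventually (by simp)
  obtain ⟨ρ, hρ, hball⟩ := Metric.eventually_nhds_iff_ball.1 hev
  let χ : ContDiffBump (0:ℝ) := ⟨ρ/4, ρ/2, by positivity, by linarith⟩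
  refine ⟨fun t => χ t * Y1 t, ?_, ?_, ?_⟩
  · rw [contDiff_iff_contDiffAt]
    intro x
    by_cases hx : x ∈ tsupport (fun t => χ t * Y1 t)
    swap
    · exact contDiffAt_const (c := (0:ℝ)).congr_of_eventuallyEq (notMem_tsupport_iff_eventuallyEq.1 hx)
    have hx' : x ∈ tsupport χ := closure_mono (Function.support_mul_subset_left _ _) hx
    rw [χ.tsupport_eq] at hx'
    refine (χ.contDiffAt).mul (hball x ?_)
    have : dist x 0 ≤ ρ/2 := hx'
    exact lt_of_le_of_lt this (by linarith)
  · have : χ 0 = 1 := χ.eventuallyEq_one.self_of_nhds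
    simp [this, hY10]
  · filter_upwards [hY1e, χ.eventuallyEq_one] with t h1 h2
    simp only [Pi.one_apply] at h2
    rw [h2, one_mul]; exact h1

lemma hasDerivAt_snd {Φ : ℝ × ℝ → ℝ} (h : Differentiable ℝ Φ) (t y : ℝ) :
    HasDerivAt (fun y => Φ (t, y)) (fderiv ℝ Φ (t, y) (0, 1)) y := by
  have h1 : HasDerivAt (fun y : ℝ => (t, y)) ((0:ℝ), (1:ℝ)) y :=
    (hasDerivAt_const y t).prodMk (hasDerivAt_id y)
  exact (h (t, y)).hasFDerivAt.comp_hasDerivAt y h1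

lemma ift (n : ℕ) (hn : 1 ≤ n) (Φ : ℝ × ℝ → ℝ) (hΦ : ContDiff ℝ n Φ) (y0 : ℝ)
    (h0 : Φ (0, y0) = 0) (hd : fderiv ℝ Φ (0, y0) (0, 1) ≠ 0) :
    ∃ Y : ℝ → ℝ, ContDiff ℝ n Y ∧ Y 0 = y0 ∧ ∃ δ > 0, ∃ c > 0,
      (∀ t, |t| < δ → Φ (t, Y t) = 0) ∧
      ∀ t y, |t| < δ → |y - y0| < δ → c * |y - Y t| ≤ |Φ (t, y)| := by
  obtain ⟨Y, hY, hY0, hYe⟩ := ift_aux n hn Φ hΦ y0 h0 hd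
  have hdiff : Differentiable ℝ Φ := hΦ.differentiable (by
    have : n ≠ 0 := by omega
    exact_mod_cast this)
  refine ⟨Y, hY, hY0, ?_⟩
  set c := |fderiv ℝ Φ (0, y0) (0, 1)| / 2 with hc
  have hc0 : 0 < c := by positivity
  have hcont : Continuous fun q => |fderiv ℝ Φ q (0, 1)| :=
    ((hΦ.continuous_fderiv (by
      have : n ≠ 0 := by omega
      exact_mod_cast this)).clm_apply continuous_const).abs
  have hev : ∀ᶠ q in 𝓝 ((0:ℝ), y0), c < |fderiv ℝ Φ q (0, 1)| :=
    hcont.continuousAt.eventually (lt_mem_nhds (by rw [hc]; linarith [abs_pos.2 hd]))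
  obtain ⟨ρ, hρ, hball⟩ := Metric.eventually_nhds_iff_ball.1 hev
  have hYc : ∀ᶠ t in 𝓝 (0:ℝ), |Y t - y0| < ρ := by
    have := hY.continuous.continuousAt (x := 0)
    have := Metric.tendsto_nhds.1 this ρ hρ
    simpa [hY0, Real.dist_eq] using this
  obtain ⟨δ1, hδ1, h1⟩ := Metric.eventually_nhds_iff_ball.1 (hYe.and hYc)
  have h1' : ∀ t, |t| < δ1 → Φ (t, Y t) = 0 ∧ |Y t - y0| < ρ := fun t ht => h1 t (by simpa using ht)
  refine ⟨min δ1 ρ, lt_min hδ1 hρ, c, hc0, fun t ht => (h1' t (ht.trans_le (min_le_left _ _))).1, ?_⟩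
  intro t y ht hy
  have ⟨e1, e2⟩ := h1' t (ht.trans_le (min_le_left _ _))
  have hyρ := hy.trans_le (min_le_right _ _)
  have htρ := ht.trans_le (min_le_right _ _)
  have key : ∀ a b, |a - y0| < ρ → |b - y0| < ρ → a < b → c * |b - a| ≤ |Φ (t, b) - Φ (t, a)| := by
    intro a b ha hb hab
    obtain ⟨ξ, hξ, hs⟩ := exists_hasDerivAt_eq_slope (fun y => Φ (t, y))
      (fun y => fderiv ℝ Φ (t, y) (0, 1)) hab
      (fun y _ => (hasDerivAt_snd hdiff t y).continuousAt.continuousWithinAt)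
      (fun y _ => hasDerivAt_snd hdiff t y)
    have hm : (t, ξ) ∈ Metric.ball ((0:ℝ), y0) ρ := by
      rw [Metric.mem_ball, Prod.dist_eq, max_lt_iff]
      refine ⟨by simpa using htρ, ?_⟩
      rw [Real.dist_eq]
      rw [abs_lt] at ha hb ⊢
      constructor <;> linarith [hξ.1, hξ.2, ha.1, hb.2]
    have h3 := hball _ hm
    have hpos : 0 < b - a := sub_pos.2 hab
    rw [hs, abs_div, lt_div_iff₀ (abs_pos.2 hpos.ne')] at h3
    exact h3.le
  rcases lt_trichotomy (Y t) y with h | h | h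
  · have := key (Y t) y e2 hyρ h
    rwa [e1, sub_zero] at this
  · simp [h]
  · have := key y (Y t) hyρ e2 h
    rwa [e1, zero_sub, abs_neg, abs_sub_comm] at this

/-- first-order blow-up -/
lemma blow1 (r : ℕ) (hr : 1 ≤ r) (e : ℝ × ℝ → ℝ) (he : ContDiff ℝ r e) (s : ℝ × ℝ) :
    ∃ E : ℝ × ℝ → ℝ, Continuous E ∧ (∀ y, E (0, y) = fderiv ℝ e s (1, y)) ∧
      ∀ t y, e (s.1 + t, s.2 + t * y) = e s + t * E (t, y) := by
  have hr0 : (r : WithTop ℕ∞) ≠ 0 := by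
    have : r ≠ 0 := by omega
    exact_mod_cast this
  have hd : Differentiable ℝ e := he.differentiable hr0
  have hc := he.continuous_fderiv hr0
  set G : (ℝ × ℝ) × ℝ → ℝ := fun q => fderiv ℝ e (s + (q.2 * q.1.1) • ((1:ℝ), q.1.2)) (1, q.1.2)
  have hG : Continuous G := by
    refine Continuous.clm_apply (hc.comp ?_) (by fun_prop)
    fun_prop
  refine ⟨fun p => ∫ u in (0:ℝ)..1, G (p, u), ?_, ?_, ?_⟩
  · exact intervalIntegral.continuous_parametric_intervalIntegral_of_continuous' (f := fun p u => G (p, u)) hG 0 1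
  · intro y
    simp only [G, mul_zero, zero_smul, add_zero]
    simp
  · intro t y
    have hder : ∀ u ∈ uIcc (0:ℝ) 1, HasDerivAt (fun u : ℝ => e (s + (u * t) • ((1:ℝ), y)))
        (t * G ((t, y), u)) u := by
      intro u _
      have h1 : HasDerivAt (fun u : ℝ => s + (u * t) • ((1:ℝ), y)) (t • ((1:ℝ), y)) u := by
        have := ((hasDerivAt_id u).mul_const t).smul_const ((1:ℝ), y)
        simpa using this.const_add s
      have h2 := (hd (s + (u * t) • ((1:ℝ), y))).hasFDerivAt.comp_hasDerivAt u h1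
      refine h2.congr_deriv ?_
      rw [map_smul, smul_eq_mul]
    have h3 := intervalIntegral.integral_eq_sub_of_hasDerivAt hder
      (Continuous.intervalIntegrable (by fun_prop) _ _)
    rw [intervalIntegral.integral_const_mul] at h3
    simp only [zero_mul, zero_smul, add_zero, one_mul] at h3
    rw [h3]
    have : s + t • ((1:ℝ), y) = (s.1 + t, s.2 + t * y) := by
      ext <;> simp
    rw [this]; ring

/-- second-order blow-up -/
lemma blow2 (r : ℕ) (hr : 2 ≤ r) (e : ℝ × ℝ → ℝ) (he : ContDiff ℝ r e) (s : ℝ × ℝ) :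
    ∃ E : ℝ × ℝ → ℝ, ContDiff ℝ (r - 2 : ℕ) E ∧
      (∀ y, E (0, y) = fderiv ℝ (fderiv ℝ e) s (1, y) (1, y) / 2) ∧
      ∀ t y, e (s.1 + t, s.2 + t * y) = e s + t * fderiv ℝ e s (1, y) + t ^ 2 * E (t, y) := by
  have hr0 : (r : WithTop ℕ∞) ≠ 0 := by
    have : r ≠ 0 := by omega
    exact_mod_cast this
  have hd : Differentiable ℝ e := he.differentiable hr0
  have hc1 : ContDiff ℝ (r - 1 : ℕ) (fderiv ℝ e) := he.fderiv_right (by norm_cast; omega)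
  have hd1 : Differentiable ℝ (fderiv ℝ e) := hc1.differentiable (by
    have : r - 1 ≠ 0 := by omega
    exact_mod_cast this)
  have hc2 : ContDiff ℝ (r - 2 : ℕ) (fderiv ℝ (fderiv ℝ e)) := hc1.fderiv_right (by norm_cast; omega)
  set G : (ℝ × ℝ) × ℝ → ℝ := fun q => (1 - q.2) * fderiv ℝ (fderiv ℝ e) (s + (q.2 * q.1.1) • ((1:ℝ), q.1.2)) (1, q.1.2) (1, q.1.2)
  have hG : ContDiff ℝ (r - 2 : ℕ) G := by
    refine ContDiff.mul (by fun_prop) ?_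
    refine ContDiff.clm_apply (ContDiff.clm_apply (hc2.comp ?_) (by fun_prop)) (by fun_prop)
    fun_prop
  refine ⟨fun p => ∫ u in (0:ℝ)..1, G (p, u), ?_, ?_, ?_⟩
  · exact contDiff_param_integral _ G hG
  · intro y
    simp only [G, mul_zero, zero_smul, add_zero]
    rw [intervalIntegral.integral_mul_const]
    have : ∫ u in (0:ℝ)..1, (1 - u) = 1/2 := by
      rw [intervalIntegral.integral_sub (by simp) (by simp)]
      simp; norm_num
    rw [this]; ring
  · intro t y
    have hder : ∀ u ∈ uIcc (0:ℝ) 1, HasDerivAt (fun u : ℝ => e (s + (u * t) • ((1:ℝ), y)) +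
        (1 - u) * (t * fderiv ℝ e (s + (u * t) • ((1:ℝ), y)) (1, y)))
        (t ^ 2 * G ((t, y), u)) u := by
      intro u _
      have h1 : HasDerivAt (fun u : ℝ => s + (u * t) • ((1:ℝ), y)) (t • ((1:ℝ), y)) u := by
        have := ((hasDerivAt_id u).mul_const t).smul_const ((1:ℝ), y)
        simpa using this.const_add s
      have h2 := (hd (s + (u * t) • ((1:ℝ), y))).hasFDerivAt.comp_hasDerivAt u h1
      have h3 := (hd1 (s + (u * t) • ((1:ℝ), y))).hasFDerivAt.comp_hasDerivAt u h1
      have h4 := (h3.clm_apply (hasDerivAt_const u ((1:ℝ), y))).const_mul t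
      have h5 := h2.add (((hasDerivAt_id u).const_sub 1).mul h4)
      refine h5.congr_deriv ?_
      simp only [G, map_smul, smul_eq_mul, Function.comp, id, map_zero, add_zero,
        smul_apply]
      ring
    have h3 := intervalIntegral.integral_eq_sub_of_hasDerivAt hder
      (Continuous.intervalIntegrable (by
        have := hG.continuous
        fun_prop) _ _)
    rw [intervalIntegral.integral_const_mul] at h3
    simp only [zero_mul, zero_smul, add_zero, one_mul, sub_self, sub_zero] at h3
    rw [h3]
    have : s + t • ((1:ℝ), y) = (s.1 + t, s.2 + t * y) := by
      ext <;> simp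
    rw [this]; ring

/-- local structure in a cone -/
def Lcone (r : ℕ) (e : ℝ × ℝ → ℝ) (s : ℝ × ℝ) (y0 δ c : ℝ) : Prop :=
  (∀ t y, |t| < δ → |y - y0 * t| ≤ δ * |t| → c * t ^ 2 ≤ |e (s.1 + t, s.2 + y)| ∧
    c * |t| * ‖fderiv ℝ e (s.1 + t, s.2 + y)‖ ≤ |e (s.1 + t, s.2 + y)|) ∨
  ∃ f : ℝ → ℝ, ContDiff ℝ (r - 2 : ℕ) f ∧ f 0 = 0 ∧ deriv f 0 = y0 ∧
    (∀ t, |t| < δ → e (s.1 + t, s.2 + f t) = 0) ∧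
    ∀ t y, |t| < δ → |y - y0 * t| ≤ δ * |t| →
      c * |t| * |y - f t| ≤ |e (s.1 + t, s.2 + y)| ∧
      c * ‖fderiv ℝ e (s.1 + t, s.2 + y)‖ * |y - f t| ≤ |e (s.1 + t, s.2 + y)|

lemma Lcone_fin (r : ℕ) (e : ℝ × ℝ → ℝ) (s : ℝ × ℝ) (y0 δ a K : ℝ) (G : ℝ → ℝ) (ha : 0 < a)
    (hK : 0 < K)
    (hG : ∀ t y, |t| < δ → |y - y0 * t| ≤ δ * |t| → |t| ≤ K * G t ∧
      ‖fderiv ℝ e (s.1 + t, s.2 + y)‖ ≤ K * G t)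
    (h : (∀ t y, |t| < δ → |y - y0 * t| ≤ δ * |t| → a * |t| * G t ≤ |e (s.1 + t, s.2 + y)|) ∨
      ∃ f : ℝ → ℝ, ContDiff ℝ (r - 2 : ℕ) f ∧ f 0 = 0 ∧ deriv f 0 = y0 ∧
        (∀ t, |t| < δ → e (s.1 + t, s.2 + f t) = 0) ∧
        ∀ t y, |t| < δ → |y - y0 * t| ≤ δ * |t| →
          a * G t * |y - f t| ≤ |e (s.1 + t, s.2 + y)|) : Lcone r e s y0 δ (a / K) := by
  rcases h with h | ⟨f, hf, h0, h1, hz, h⟩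
  · left
    intro t y ht hy
    obtain ⟨g1, g2⟩ := hG t y ht hy
    have h3 := h t y ht hy
    constructor
    · calc a / K * t ^ 2 = a / K * |t| * |t| := by rw [← sq_abs]; ring
        _ ≤ a / K * |t| * (K * G t) := by gcongr
        _ = a * |t| * G t := by field_simp
        _ ≤ _ := h3
    · calc a / K * |t| * ‖fderiv ℝ e (s.1 + t, s.2 + y)‖ ≤ a / K * |t| * (K * G t) := by gcongr
        _ = a * |t| * G t := by field_simp
        _ ≤ _ := h3
  · right
    refine ⟨f, hf, h0, h1, hz, ?_⟩
    intro t y ht hy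
    obtain ⟨g1, g2⟩ := hG t y ht hy
    have h3 := h t y ht hy
    constructor
    · calc a / K * |t| * |y - f t| ≤ a / K * (K * G t) * |y - f t| := by gcongr
        _ = a * G t * |y - f t| := by field_simp
        _ ≤ _ := h3
    · calc a / K * ‖fderiv ℝ e (s.1 + t, s.2 + y)‖ * |y - f t| ≤ a / K * (K * G t) * |y - f t| := by gcongr
        _ = a * G t * |y - f t| := by field_simp
        _ ≤ _ := h3

lemma cone_near (s : ℝ × ℝ) (y0 δ t y : ℝ) (h1 : δ ≤ 1)
    (hy : |y - y0 * t| ≤ δ * |t|) : ‖((s.1 + t, s.2 + y) : ℝ × ℝ) - s‖ ≤ (|y0| + 1) * |t| := by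
  have e1 : ((s.1 + t, s.2 + y) : ℝ × ℝ) - s = (t, y) := by ext <;> simp
  rw [e1, Prod.norm_def]
  simp only [Real.norm_eq_abs]
  refine max_le ?_ ?_
  · nlinarith [abs_nonneg y0, abs_nonneg t]
  · have : |y| ≤ |y - y0 * t| + |y0 * t| := by
      calc |y| = |(y - y0 * t) + y0 * t| := by ring_nf
        _ ≤ _ := abs_add_le _ _
    rw [abs_mul] at this
    nlinarith [abs_nonneg t]

lemma cone_div (y0 δ t y : ℝ) (ht : t ≠ 0)
    (hy : |y - y0 * t| ≤ δ * |t|) : ∃ η, y = t * η ∧ |η - y0| ≤ δ := by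
  refine ⟨y / t, by field_simp, ?_⟩
  have : y - y0 * t = (y / t - y0) * t := by field_simp
  rw [this, abs_mul] at hy
  exact le_of_mul_le_mul_right hy (abs_pos.2 ht)

lemma Lcone_regular (r : ℕ) (hr : 3 ≤ r) (e : ℝ × ℝ → ℝ) (he : ContDiff ℝ r e) (s : ℝ × ℝ)
    (hs : e s = 0) (hreg : fderiv ℝ e s ≠ 0) (y0 : ℝ) : ∃ δ > 0, ∃ c > 0, Lcone r e s y0 δ c := by
  have hr0 : (r : WithTop ℕ∞) ≠ 0 := by
    have : r ≠ 0 := by omega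
    exact_mod_cast this
  have hd : Differentiable ℝ e := he.differentiable hr0
  have hc := he.continuous_fderiv hr0
  -- bound on derivative near s
  have hev : ∀ᶠ z in 𝓝 s, ‖fderiv ℝ e z‖ < ‖fderiv ℝ e s‖ + 1 :=
    hc.norm.continuousAt.eventually (gt_mem_nhds (by linarith))
  obtain ⟨ρ0, hρ0, hball⟩ := Metric.eventually_nhds_iff_ball.1 hev
  set K := ‖fderiv ℝ e s‖ + 1 with hK
  have hK1 : 1 ≤ K := by rw [hK]; linarith [norm_nonneg (fderiv ℝ e s)]
  have hG : ∀ δ, δ ≤ 1 → δ ≤ ρ0 / (|y0| + 1) → ∀ t y, |t| < δ → |y - y0 * t| ≤ δ * |t| → |t| ≤ K * 1 ∧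
      ‖fderiv ℝ e (s.1 + t, s.2 + y)‖ ≤ K * 1 := by
    intro δ h1 h2 t y ht hy
    refine ⟨by linarith, ?_⟩
    have h3 := cone_near s y0 δ t y h1 hy
    have : ‖((s.1 + t, s.2 + y) : ℝ × ℝ) - s‖ < ρ0 := by
      refine lt_of_le_of_lt h3 ?_
      have := ht.trans_le h2
      rw [lt_div_iff₀ (by positivity)] at this
      linarith
    rw [mul_one]
    exact (hball _ (by rwa [Metric.mem_ball, dist_eq_norm])).le
  by_cases hQ : fderiv ℝ e s (1, y0) = 0
  · -- tangent direction
    have hdy : fderiv ℝ e s (0, 1) ≠ 0 := by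
      intro h
      apply hreg
      have h10 : fderiv ℝ e s (1, 0) = 0 := by
        have : ((1:ℝ), (0:ℝ)) = (1, y0) - y0 • (0, 1) := by ext <;> simp
        rw [this, map_sub, map_smul, hQ, h]; simp
      ext
      · simpa using h10
      · simpa using h
    set Φ : ℝ × ℝ → ℝ := fun p => e (s + p) with hΦ
    have hΦc : ContDiff ℝ r Φ := he.comp (contDiff_const.add contDiff_id)
    have hΦd : fderiv ℝ Φ (0, 0) = fderiv ℝ e s := by
      rw [hΦ, fderiv_comp_add_left]
      have : s + (0, 0) = s := by ext <;> simp
      rw [this]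
    obtain ⟨Y, hY, hY0, δ, hδ, c, hc0, hz, hlow⟩ := ift r (by omega) Φ hΦc 0 (by
      have : s + (0, 0) = s := by ext <;> simp
      simp only [hΦ, this, hs]) (by rw [hΦd]; exact hdy)
    have hYd : Differentiable ℝ Y := hY.differentiable hr0
    have hder : deriv Y 0 = y0 := by
      have h1 : HasDerivAt (fun t : ℝ => s + (t, Y t)) (1, deriv Y 0) 0 :=
        ((hasDerivAt_id (0:ℝ)).prodMk (hYd 0).hasDerivAt).const_add s
      have h2 : HasDerivAt (fun t : ℝ => e (s + (t, Y t))) (fderiv ℝ e (s + (0, Y 0)) (1, deriv Y 0)) 0 :=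
        (hd _).hasFDerivAt.comp_hasDerivAt (0:ℝ) h1
      have h3 : (fun t : ℝ => e (s + (t, Y t))) =ᶠ[𝓝 0] fun _ => (0:ℝ) := by
        filter_upwards [Metric.ball_mem_nhds (0:ℝ) hδ] with t ht
        exact hz t (by simpa using ht)
      have h4 := (h3.hasDerivAt_iff.1 h2).unique (hasDerivAt_const _ _)
      have : s + (0, Y 0) = s := by ext <;> simp [hY0]
      rw [this] at h4
      have h5 : fderiv ℝ e s ((deriv Y 0 - y0) • (0, 1)) = 0 := by
        have : (deriv Y 0 - y0) • ((0:ℝ), (1:ℝ)) = (1, deriv Y 0) - (1, y0) := by ext <;> simp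
        rw [this, map_sub, h4, hQ]; simp
      rw [map_smul, smul_eq_mul] at h5
      rcases mul_eq_zero.1 h5 with h | h
      · linarith
      · exact absurd h hdy
    set δ' := min (min 1 (ρ0 / (|y0| + 1))) (δ / (|y0| + 2)) with hδ'
    have hpos : 0 < δ' := by positivity
    have hδ'1 : δ' ≤ 1 := (min_le_left _ _).trans (min_le_left _ _)
    have hδ'2 : δ' * (|y0| + 2) ≤ δ := by
      have := min_le_right (min 1 (ρ0 / (|y0| + 1))) (δ / (|y0| + 2))
      rwa [← hδ', le_div_iff₀ (by positivity)] at this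
    have hδδ : δ' ≤ δ := by nlinarith [abs_nonneg y0]
    refine ⟨δ', hpos, c / K, by positivity, Lcone_fin r e s y0 δ' c K (fun _ => 1) hc0 (by linarith)
      (hG δ' hδ'1 ((min_le_left _ _).trans (min_le_right _ _))) (Or.inr ⟨Y, hY.of_le (by norm_cast; omega), hY0, hder, ?_, ?_⟩)⟩
    · intro t ht
      exact hz t (ht.trans_le hδδ)
    · intro t y ht hy
      have h3 := cone_near s y0 δ' t y hδ'1 hy
      have e1 : ((s.1 + t, s.2 + y) : ℝ × ℝ) - s = (t, y) := by ext <;> simp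
      rw [e1, Prod.norm_def] at h3
      have h4 : |y| < δ := by
        have := (le_max_right _ _).trans h3
        simp only [Real.norm_eq_abs] at this
        nlinarith [abs_nonneg y0]
      have := hlow t y (ht.trans_le hδδ) (by simpa using h4)
      show c * 1 * |y - Y t| ≤ _
      rw [mul_one]; exact this
  · obtain ⟨E, hE, hE0, hEe⟩ := blow1 r (by omega) e he s
    have hEv : ∀ᶠ q in 𝓝 ((0:ℝ), y0), |fderiv ℝ e s (1, y0)| / 2 < |E q| :=
      hE.abs.continuousAt.eventually (lt_mem_nhds (by simp only [hE0]; linarith [abs_pos.2 hQ]))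
    obtain ⟨ρ, hρ, hEb⟩ := Metric.eventually_nhds_iff_ball.1 hEv
    set a := |fderiv ℝ e s (1, y0)| / 2
    have ha : 0 < a := by positivity
    set δ' := min (min 1 (ρ0 / (|y0| + 1))) (ρ / 2) with hδ'
    have hpos : 0 < δ' := by positivity
    have hδ'1 : δ' ≤ 1 := (min_le_left _ _).trans (min_le_left _ _)
    have hδ'2 : δ' ≤ ρ / 2 := min_le_right _ _
    refine ⟨δ', hpos, a / K, by positivity, Lcone_fin r e s y0 δ' a K (fun _ => 1) ha (by linarith)
      (hG δ' hδ'1 ((min_le_left _ _).trans (min_le_right _ _))) (Or.inl ?_)⟩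
    intro t y ht hy
    by_cases ht0 : t = 0
    · simp [ht0]
    obtain ⟨η, rfl, hη⟩ := cone_div y0 δ' t y ht0 hy
    rw [hEe, hs, zero_add, abs_mul, mul_one, mul_comm]
    have := hEb (t, η) (by
      rw [Metric.mem_ball, Prod.dist_eq, max_lt_iff]
      refine ⟨?_, ?_⟩
      · simp; linarith
      · rw [Real.dist_eq]; linarith)
    gcongr

lemma hess_nondeg (r : ℕ) (hr : 3 ≤ r) (e : ℝ × ℝ → ℝ) (he : ContDiff ℝ r e) (s : ℝ × ℝ)
    (hH : HessCond e s) (y0 : ℝ)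
    (h0 : fderiv ℝ (fderiv ℝ e) s (1, y0) (1, y0) = 0)
    (h1 : fderiv ℝ (fderiv ℝ e) s (1, y0) (0, 1) = 0) : False := by
  have hr0 : (r : WithTop ℕ∞) ≠ 0 := by
    have : r ≠ 0 := by omega
    exact_mod_cast this
  have hc1 : ContDiff ℝ (r - 1 : ℕ) (fderiv ℝ e) := he.fderiv_right (by norm_cast; omega)
  have hd1 : Differentiable ℝ (fderiv ℝ e) := hc1.differentiable (by
    have : r - 1 ≠ 0 := by omega
    exact_mod_cast this)
  have hh : ∀ u v, hess2 e s u v = fderiv ℝ (fderiv ℝ e) s v u := by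
    intro u v
    unfold hess2
    have := ((hd1 s).hasFDerivAt.clm_apply (hasFDerivAt_const u s)).fderiv
    rw [this]; simp
  have hsym : ∀ u v, fderiv ℝ (fderiv ℝ e) s u v = fderiv ℝ (fderiv ℝ e) s v u := by
    have : IsSymmSndFDerivAt ℝ e s := he.contDiffAt.isSymmSndFDerivAt (by
      simp only [minSmoothness_of_isRCLikeNormedField]
      norm_cast; omega)
    exact fun u v => this u v
  obtain ⟨μ1, μ2, hμ1, hμ2, hch⟩ := hH
  have hdet := congrArg (fun p => Polynomial.eval 0 p) hch
  simp only [Matrix.charpoly_fin_two, Matrix.det_fin_two_of, Matrix.trace_fin_two_of, hh] at hdet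
  simp only [eval_add, eval_sub, eval_mul, eval_pow, eval_X, eval_C] at hdet
  set B := fderiv ℝ (fderiv ℝ e) s
  have hB01 := hsym (0, 1) (1, 0)
  have e1 : ((1:ℝ), y0) = (1, 0) + y0 • (0, 1) := by ext <;> simp
  rw [e1] at h0 h1
  simp only [map_add, map_smul, add_apply, smul_apply, smul_eq_mul] at h0 h1
  have hneg : μ1 * μ2 < 0 := mul_neg_of_pos_of_neg hμ1 hμ2
  rw [hB01] at h0 hdet
  set b11 := B (1, 0) (1, 0)
  set b12 := B (1, 0) (0, 1)
  set b22 := B (0, 1) (0, 1)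
  have hb12 : b12 = - y0 * b22 := by linarith
  have hb11 : b11 = y0 ^ 2 * b22 := by rw [hb12] at h0; linarith
  rw [hb12, hb11] at hdet
  nlinarith

lemma Lcone_singular (r : ℕ) (hr : 3 ≤ r) (e : ℝ × ℝ → ℝ) (he : ContDiff ℝ r e) (s : ℝ × ℝ)
    (hs : e s = 0) (hsing : fderiv ℝ e s = 0) (hH : HessCond e s) (y0 : ℝ) :
    ∃ δ > 0, ∃ c > 0, Lcone r e s y0 δ c := by
  have hr0 : (r : WithTop ℕ∞) ≠ 0 := by
    have : r ≠ 0 := by omega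
    exact_mod_cast this
  have hd : Differentiable ℝ e := he.differentiable hr0
  have hc1 : ContDiff ℝ (r - 1 : ℕ) (fderiv ℝ e) := he.fderiv_right (by norm_cast; omega)
  have hd1 : Differentiable ℝ (fderiv ℝ e) := hc1.differentiable (by
    have : r - 1 ≠ 0 := by omega
    exact_mod_cast this)
  obtain ⟨K0, hK0, hbig⟩ := ((hd1 s).hasFDerivAt.isBigO_sub).exists_pos
  rw [Asymptotics.isBigOWith_iff] at hbig
  obtain ⟨ρ0, hρ0, hball⟩ := Metric.eventually_nhds_iff_ball.1 hbig
  set K := K0 * (|y0| + 1) + 1 with hK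
  have hKp : 0 < K := by positivity
  have hG : ∀ δ, δ ≤ 1 → δ ≤ ρ0 / (|y0| + 1) → ∀ t y, |t| < δ → |y - y0 * t| ≤ δ * |t| → |t| ≤ K * |t| ∧
      ‖fderiv ℝ e (s.1 + t, s.2 + y)‖ ≤ K * |t| := by
    intro δ h1 h2 t y ht hy
    refine ⟨?_, ?_⟩
    · have : 0 ≤ K0 * (|y0| + 1) := by positivity
      nlinarith [abs_nonneg t]
    have h3 := cone_near s y0 δ t y h1 hy
    have : ‖((s.1 + t, s.2 + y) : ℝ × ℝ) - s‖ < ρ0 := by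
      refine lt_of_le_of_lt h3 ?_
      have := ht.trans_le h2
      rw [lt_div_iff₀ (by positivity)] at this
      linarith
    have h4 := hball _ (by rwa [Metric.mem_ball, dist_eq_norm])
    rw [hsing, sub_zero] at h4
    calc _ ≤ _ := h4
      _ ≤ K0 * ((|y0| + 1) * |t|) := by gcongr
      _ ≤ K * |t| := by rw [hK]; nlinarith [abs_nonneg t]
  obtain ⟨E, hE, hE0, hEe⟩ := blow2 r (by omega) e he s
  have hEe' : ∀ t y, e (s.1 + t, s.2 + t * y) = t ^ 2 * E (t, y) := by
    intro t y; rw [hEe, hs, hsing]; simp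
  by_cases hQ : E (0, y0) = 0
  · have hB : fderiv ℝ (fderiv ℝ e) s (1, y0) (1, y0) = 0 := by
      have := hE0 y0; rw [hQ] at this; linarith
    have hsym : ∀ u v, fderiv ℝ (fderiv ℝ e) s u v = fderiv ℝ (fderiv ℝ e) s v u := by
      have : IsSymmSndFDerivAt ℝ e s := he.contDiffAt.isSymmSndFDerivAt (by
        simp only [minSmoothness_of_isRCLikeNormedField]
        norm_cast; omega)
      exact fun u v => this u v
    have hEdiff : Differentiable ℝ E := hE.differentiable (by
      have : r - 2 ≠ 0 := by omega
      exact_mod_cast this)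
    have hdE : fderiv ℝ E (0, y0) (0, 1) = fderiv ℝ (fderiv ℝ e) s (1, y0) (0, 1) := by
      have h1 := hasDerivAt_snd hEdiff 0 y0
      have h2 : HasDerivAt (fun y => E (0, y)) (fderiv ℝ (fderiv ℝ e) s (1, y0) (0, 1)) y0 := by
        have h3 : (fun y => E (0, y)) = fun y => fderiv ℝ (fderiv ℝ e) s (1, y) (1, y) / 2 := by
          funext y; exact hE0 y
        rw [h3]
        have h4 : HasDerivAt (fun y : ℝ => ((1:ℝ), y)) ((0:ℝ), (1:ℝ)) y0 :=
          (hasDerivAt_const y0 1).prodMk (hasDerivAt_id y0)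
        have h5 := (fderiv ℝ (fderiv ℝ e) s).hasFDerivAt.comp_hasDerivAt y0 h4
        have h6 := (h5.clm_apply h4).div_const 2
        refine h6.congr_deriv ?_
        rw [hsym (0, 1)]
        simp
      exact h1.unique h2
    have hdE0 : fderiv ℝ E (0, y0) (0, 1) ≠ 0 := by
      intro h
      exact hess_nondeg r hr e he s hH y0 hB (by rw [← hdE, h])
    obtain ⟨Y, hY, hY0, δ, hδ, c, hc0, hz, hlow⟩ := ift (r - 2) (by omega) E hE y0 hQ hdE0
    set δ' := min (min 1 (ρ0 / (|y0| + 1))) (δ / 2) with hδ'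
    have hpos : 0 < δ' := by positivity
    have hδ'1 : δ' ≤ 1 := (min_le_left _ _).trans (min_le_left _ _)
    have hδ'2 : δ' ≤ δ / 2 := min_le_right _ _
    refine ⟨δ', hpos, c / K, by positivity, Lcone_fin r e s y0 δ' c K (fun t => |t|) hc0 hKp
      (hG δ' hδ'1 ((min_le_left _ _).trans (min_le_right _ _)))
      (Or.inr ⟨fun t => t * Y t, contDiff_id.mul hY, by simp, ?_, ?_, ?_⟩)⟩
    · have hYd : Differentiable ℝ Y := hY.differentiable (by
        have : r - 2 ≠ 0 := by omega
        exact_mod_cast this)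
      have := ((hasDerivAt_id (0:ℝ)).mul (hYd 0).hasDerivAt).deriv
      simp only [id, zero_mul, one_mul, add_zero, hY0] at this
      exact this
    · intro t ht
      rw [hEe', hz t (by linarith)]; simp
    · intro t y ht hy
      by_cases ht0 : t = 0
      · simp [ht0]
      obtain ⟨η, rfl, hη⟩ := cone_div y0 δ' t y ht0 hy
      have h3 := hlow t η (by linarith) (by linarith)
      rw [hEe', abs_mul, abs_pow, ← mul_sub, abs_mul]
      calc c * |t| * (|t| * |η - Y t|) = |t| ^ 2 * (c * |η - Y t|) := by ring
        _ ≤ _ := by gcongr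
  · have hEv : ∀ᶠ q in 𝓝 ((0:ℝ), y0), |E (0, y0)| / 2 < |E q| :=
      hE.continuous.abs.continuousAt.eventually (lt_mem_nhds (by linarith [abs_pos.2 hQ]))
    obtain ⟨ρ, hρ, hEb⟩ := Metric.eventually_nhds_iff_ball.1 hEv
    set a := |E (0, y0)| / 2
    have ha : 0 < a := by positivity
    set δ' := min (min 1 (ρ0 / (|y0| + 1))) (ρ / 2) with hδ'
    have hpos : 0 < δ' := by positivity
    have hδ'1 : δ' ≤ 1 := (min_le_left _ _).trans (min_le_left _ _)
    have hδ'2 : δ' ≤ ρ / 2 := min_le_right _ _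
    refine ⟨δ', hpos, a / K, by positivity, Lcone_fin r e s y0 δ' a K (fun t => |t|) ha hKp
      (hG δ' hδ'1 ((min_le_left _ _).trans (min_le_right _ _))) (Or.inl ?_)⟩
    intro t y ht hy
    by_cases ht0 : t = 0
    · simp [ht0]
    obtain ⟨η, rfl, hη⟩ := cone_div y0 δ' t y ht0 hy
    rw [hEe', abs_mul, abs_pow]
    have := hEb (t, η) (by
      rw [Metric.mem_ball, Prod.dist_eq, max_lt_iff]
      refine ⟨?_, ?_⟩
      · simp; linarith
      · rw [Real.dist_eq]; linarith)
    calc a * |t| * |t| = |t| ^ 2 * a := by ring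
      _ ≤ _ := by gcongr

lemma Lcone_exists (r : ℕ) (hr : 3 ≤ r) (e : ℝ × ℝ → ℝ) (he : ContDiff ℝ r e) (s : ℝ × ℝ)
    (hs : e s = 0) (hH : fderiv ℝ e s = 0 → HessCond e s) (y0 : ℝ) :
    ∃ δ > 0, ∃ c > 0, Lcone r e s y0 δ c := by
  by_cases h : fderiv ℝ e s = 0
  · exact Lcone_singular r hr e he s hs h (hH h) y0
  · exact Lcone_regular r hr e he s hs h y0

/-- divided difference -/
noncomputable def dd (e : ℝ × ℝ → ℝ) (z : ℝ × ℝ) (l : ℝ) (ω : ℝ × ℝ) : ℝ :=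
  ∫ u in (0:ℝ)..1, fderiv ℝ e (z - (u * l) • ω) ω

lemma dd_contDiff (r : ℕ) (hr : 1 ≤ r) (e : ℝ × ℝ → ℝ) (he : ContDiff ℝ r e) :
    ContDiff ℝ (r - 1 : ℕ) fun p : (ℝ × ℝ) × ℝ × (ℝ × ℝ) => dd e p.1 p.2.1 p.2.2 := by
  have hc1 : ContDiff ℝ (r - 1 : ℕ) (fderiv ℝ e) := he.fderiv_right (by norm_cast; omega)
  refine contDiff_param_integral (r - 1)
    (fun q : ((ℝ × ℝ) × ℝ × (ℝ × ℝ)) × ℝ => fderiv ℝ e (q.1.1 - (q.2 * q.1.2.1) • q.1.2.2) q.1.2.2) ?_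
  refine ContDiff.clm_apply (hc1.comp ?_) (by fun_prop)
  fun_prop

lemma dd_zero (e : ℝ × ℝ → ℝ) (z ω : ℝ × ℝ) : dd e z 0 ω = fderiv ℝ e z ω := by
  simp only [dd, mul_zero, zero_smul, sub_zero]
  simp

lemma dd_eq (r : ℕ) (hr : 1 ≤ r) (e : ℝ × ℝ → ℝ) (he : ContDiff ℝ r e) (z : ℝ × ℝ) (l : ℝ) (ω : ℝ × ℝ) :
    e z - e (z - l • ω) = l * dd e z l ω := by
  have hr0 : (r : WithTop ℕ∞) ≠ 0 := by
    have : r ≠ 0 := by omega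
    exact_mod_cast this
  have hd : Differentiable ℝ e := he.differentiable hr0
  have hc := he.continuous_fderiv hr0
  have hder : ∀ u ∈ uIcc (0:ℝ) 1, HasDerivAt (fun u : ℝ => e (z - (u * l) • ω))
        (-l * fderiv ℝ e (z - (u * l) • ω) ω) u := by
    intro u _
    have h1 : HasDerivAt (fun u : ℝ => z - (u * l) • ω) (-(l • ω)) u := by
      have := ((hasDerivAt_id u).mul_const l).smul_const ω
      simpa using this.const_sub z
    have h2 := (hd (z - (u * l) • ω)).hasFDerivAt.comp_hasDerivAt u h1
    refine h2.congr_deriv ?_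
    rw [map_neg, map_smul, smul_eq_mul]; ring
  have h3 := intervalIntegral.integral_eq_sub_of_hasDerivAt hder
      (Continuous.intervalIntegrable (by
        refine continuous_const.mul (Continuous.clm_apply (hc.comp ?_) (by fun_prop))
        fun_prop) _ _)
  rw [intervalIntegral.integral_const_mul] at h3
  simp only [zero_mul, zero_smul, sub_zero, one_mul] at h3
  unfold dd
  linarith

/-- first orientation of (H5) -/
def NF1 (e : ℝ × ℝ → ℝ) (r n : ℕ) : Prop :=
  ∀ (kt : ℝ × ℝ) (f : ℝ → ℝ), ContDiff ℝ (r - 2 : ℕ) f → f 0 = 0 →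
    (∀ᶠ t in 𝓝 0, e (kt.1 + t, kt.2 + f t) = 0) →
    ∃ m : ℕ, 2 ≤ m ∧ m ≤ n - 1 ∧ iteratedDeriv m f 0 ≠ 0

/-- first orientation of (H6) -/
def NN1 (e : ℝ × ℝ → ℝ) (r n : ℕ) : Prop :=
  ∀ (kt pt : ℝ × ℝ) (f g : ℝ → ℝ), kt ≠ pt → ContDiff ℝ (r - 2 : ℕ) f → ContDiff ℝ (r - 2 : ℕ) g →
    f 0 = 0 → g 0 = 0 →
    (∀ᶠ t in 𝓝 0, e (kt.1 + t, kt.2 + f t) = 0) →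
    (∀ᶠ t in 𝓝 0, e (pt.1 + t, pt.2 + g t) = 0) →
    ∃ m : ℕ, m ≤ n - 1 ∧ iteratedDeriv m (fun t => f t - g t) 0 ≠ 0

lemma NF1_of (e : ℝ × ℝ → ℝ) (r n : ℕ) (h : NonFlatCond e r n) : NF1 e r n := by
  intro kt f hf h0 hz
  obtain ⟨U, hU, hUo, h0U⟩ := eventually_nhds_iff.1 hz
  have hk : e kt = 0 := by
    have := hU 0 h0U; simpa [h0] using this
  obtain ⟨m, h2, hm, hne⟩ := (h kt hk).1 U (hUo.mem_nhds h0U) f hf.contDiffOn h0 hU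
  refine ⟨m, h2, hm, ?_⟩
  rwa [iteratedDerivWithin_of_isOpen hUo h0U] at hne

lemma NF1_swap_of (e : ℝ × ℝ → ℝ) (r n : ℕ) (h : NonFlatCond e r n) : NF1 (fun z => e (z.2, z.1)) r n := by
  intro kt f hf h0 hz
  obtain ⟨U, hU, hUo, h0U⟩ := eventually_nhds_iff.1 hz
  have hk : e (kt.2, kt.1) = 0 := by
    have := hU 0 h0U; simpa [h0] using this
  obtain ⟨m, h2, hm, hne⟩ := (h _ hk).2 U (hUo.mem_nhds h0U) f hf.contDiffOn h0 hU
  refine ⟨m, h2, hm, ?_⟩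
  rwa [iteratedDerivWithin_of_isOpen hUo h0U] at hne

lemma NN1_of (e : ℝ × ℝ → ℝ) (r n : ℕ) (h : NoNestingCond e r n) : NN1 e r n := by
  intro kt pt f g hne hf hg h0 h0' hz hz'
  obtain ⟨U, hU, hUo, h0U⟩ := eventually_nhds_iff.1 (hz.and hz')
  have hk : e kt = 0 := by
    have := (hU 0 h0U).1; simpa [h0] using this
  have hp : e pt = 0 := by
    have := (hU 0 h0U).2; simpa [h0'] using this
  obtain ⟨m, hm, hne⟩ := (h.1 kt pt hk hp hne).1 U (hUo.mem_nhds h0U) f g hf.contDiffOn hg.contDiffOn h0 h0'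
    (fun t ht => (hU t ht).1) (fun t ht => (hU t ht).2)
  refine ⟨m, hm, ?_⟩
  rwa [iteratedDerivWithin_of_isOpen hUo h0U] at hne

lemma NN1_swap_of (e : ℝ × ℝ → ℝ) (r n : ℕ) (h : NoNestingCond e r n) : NN1 (fun z => e (z.2, z.1)) r n := by
  intro kt pt f g hne hf hg h0 h0' hz hz'
  obtain ⟨U, hU, hUo, h0U⟩ := eventually_nhds_iff.1 (hz.and hz')
  have hk : e (kt.2, kt.1) = 0 := by
    have := (hU 0 h0U).1; simpa [h0] using this
  have hp : e (pt.2, pt.1) = 0 := by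
    have := (hU 0 h0U).2; simpa [h0'] using this
  have hne' : ((kt.2, kt.1) : ℝ × ℝ) ≠ (pt.2, pt.1) := by
    intro hh
    apply hne
    rw [Prod.mk.injEq] at hh
    exact Prod.ext hh.2 hh.1
  obtain ⟨m, hm, hne⟩ := (h.1 _ _ hk hp hne').2 U (hUo.mem_nhds h0U) f g hf.contDiffOn hg.contDiffOn h0 h0'
    (fun t ht => (hU t ht).1) (fun t ht => (hU t ht).2)
  refine ⟨m, hm, ?_⟩
  rwa [iteratedDerivWithin_of_isOpen hUo h0U] at hne

lemma lo_div (n : ℕ) (hn : 1 ≤ n) (a b : ℝ → ℝ) (c : ℝ) (hc : 0 < c) (ha : ContinuousAt a 0)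
    (hb : b =o[𝓝 0] fun t => t ^ (n + 1)) (h : ∀ᶠ t in 𝓝 0, c * |t| * |a t| ≤ |b t|) :
    a =o[𝓝 0] fun t => t ^ n := by
  have key : ∀ ε > 0, ∀ᶠ t in 𝓝[≠] (0:ℝ), |a t| ≤ ε * |t ^ n| := by
    intro ε hε
    have h1 := (Asymptotics.isLittleO_iff.1 hb) (show 0 < ε * c by positivity)
    have h2 := h.and h1
    filter_upwards [h2.filter_mono nhdsWithin_le_nhds, self_mem_nhdsWithin] with t ht ht0
    obtain ⟨h3, h4⟩ := ht
    have ht0 : 0 < |t| := abs_pos.2 ht0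
    simp only [Real.norm_eq_abs, pow_succ, abs_mul] at h4
    have h5 : (c * |t|) * |a t| ≤ (c * |t|) * (ε * |t ^ n|) := by
      calc _ ≤ _ := h3.trans h4
        _ = _ := by ring
    exact le_of_mul_le_mul_left h5 (by positivity)
  have ha0 : a 0 = 0 := by
    have h1 : Tendsto (fun t => |a t|) (𝓝[≠] 0) (𝓝 |a 0|) := (ha.abs.tendsto).mono_left nhdsWithin_le_nhds
    have h2 : Tendsto (fun t : ℝ => 1 * |t ^ n|) (𝓝[≠] 0) (𝓝 0) := by
      have : Continuous fun t : ℝ => 1 * |t ^ n| := by fun_prop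
      have := (this.tendsto 0).mono_left (nhdsWithin_le_nhds (s := {0}ᶜ))
      simpa [show n ≠ 0 by omega] using this
    have := le_of_tendsto_of_tendsto h1 h2 (key 1 one_pos)
    exact abs_nonpos_iff.1 this
  rw [Asymptotics.isLittleO_iff]
  intro ε hε
  have := key ε hε
  rw [eventually_nhdsWithin_iff] at this
  filter_upwards [this] with t ht
  by_cases h0 : t = 0
  · rw [h0, ha0]; simp; positivity
  · exact ht h0

lemma deriv_lower (g : ℝ → ℝ) (d x C : ℝ) (hg : HasDerivAt g d x)
    (h : ∀ᶠ y in 𝓝 x, C * |y - x| ≤ |g y - g x|) : C ≤ |d| := by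
  have h1 := (hasDerivAt_iff_tendsto_slope.1 hg).abs
  refine ge_of_tendsto h1 ?_
  filter_upwards [h.filter_mono nhdsWithin_le_nhds, self_mem_nhdsWithin] with y hy hne
  have : 0 < |y - x| := abs_pos.2 (sub_ne_zero.2 hne)
  rw [slope_def_field, abs_div, le_div_iff₀ this]
  exact hy

lemma cone_ev (f : ℝ → ℝ) (y0 δ : ℝ) (hδ : 0 < δ) (hf : DifferentiableAt ℝ f 0) (h0 : f 0 = 0)
    (h1 : deriv f 0 = y0) : ∀ᶠ t in 𝓝 0, |t| < δ ∧ |f t - y0 * t| ≤ δ / 2 * |t| := by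
  have h2 : ∀ᶠ t in 𝓝 (0:ℝ), |t| < δ := by
    filter_upwards [Metric.ball_mem_nhds (0:ℝ) hδ] with t ht
    simpa using ht
  have h3 := hasDerivAt_iff_isLittleO.1 hf.hasDerivAt
  have h4 := Asymptotics.isLittleO_iff.1 h3 (show 0 < δ / 2 by positivity)
  filter_upwards [h2, h4] with t ht1 ht2
  refine ⟨ht1, ?_⟩
  simpa [h0, h1, mul_comm] using ht2

lemma nondeg (n₀ r : ℕ) (hn₀ : 3 ≤ n₀) (hr : 2 * n₀ + 1 ≤ r)
    (e : ℝ × ℝ → ℝ) (he : ContDiff ℝ r e)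
    (hH4 : ∀ k : ℝ × ℝ, e k = 0 → fderiv ℝ e k = 0 → HessCond e k)
    (hNF : NF1 e r n₀) (hNN : NN1 e r n₀) (z0 : ℝ × ℝ) (y0 δ c : ℝ) (hδ : 0 < δ) (hc : 0 < c)
    (f : ℝ → ℝ) (hf : ContDiff ℝ (r - 2 : ℕ) f) (f0 : f 0 = 0) (f1 : deriv f 0 = y0)
    (hz : ∀ t, |t| < δ → e (z0.1 + t, z0.2 + f t) = 0)
    (hlow : ∀ t y, |t| < δ → |y - y0 * t| ≤ δ * |t| → c * |t| * |y - f t| ≤ |e (z0.1 + t, z0.2 + y)|)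
    (l : ℝ) (ω : ℝ × ℝ) (hω : ω ≠ 0) :
    ∃ m ≤ n₀, iteratedDeriv m (fun t => dd e (z0.1 + t, z0.2 + f t) l ω) 0 ≠ 0 := by
  by_contra! hcon
  have hr0 : (r : WithTop ℕ∞) ≠ 0 := by
    have : r ≠ 0 := by omega
    exact_mod_cast this
  have hd : Differentiable ℝ e := he.differentiable hr0
  have hfd : Differentiable ℝ f := hf.differentiable (by
    have : r - 2 ≠ 0 := by omega
    exact_mod_cast this)
  set H : ℝ → ℝ := fun t => dd e (z0.1 + t, z0.2 + f t) l ω with hH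
  have hHc : ContDiff ℝ n₀ H := by
    have h1 := (dd_contDiff r (by omega) e he).of_le (m := (n₀ : WithTop ℕ∞)) (by norm_cast; omega)
    have h2 : ContDiff ℝ n₀ f := hf.of_le (by norm_cast; omega)
    exact h1.comp (f := fun t : ℝ => (((z0.1 + t, z0.2 + f t) : ℝ × ℝ), l, ω)) (by fun_prop)
  have hHo : H =o[𝓝 0] fun t => t ^ n₀ := isLittleO_of_iteratedDeriv n₀ H hHc hcon
  have hzev : ∀ᶠ t in 𝓝 (0:ℝ), e (z0.1 + t, z0.2 + f t) = 0 := by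
    filter_upwards [Metric.ball_mem_nhds (0:ℝ) hδ] with t ht
    exact hz t (by simpa using ht)
  have hn1 : n₀ - 1 + 1 = n₀ := by omega
  by_cases hl : l = 0
  · subst hl
    have hH' : ∀ t, H t = fderiv ℝ e (z0.1 + t, z0.2 + f t) ω := fun t => dd_zero _ _ _
    set a : ℝ → ℝ := fun t => ω.2 - ω.1 * deriv f t with ha
    have hder : ∀ᶠ t in 𝓝 (0:ℝ), fderiv ℝ e (z0.1 + t, z0.2 + f t) (1, deriv f t) = 0 := by
      filter_upwards [hzev.eventually_nhds] with t ht
      have h1 : HasDerivAt (fun t : ℝ => (z0.1 + t, z0.2 + f t)) (1, deriv f t) t :=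
        ((hasDerivAt_id t).const_add _).prodMk ((hfd t).hasDerivAt.const_add _)
      have h2 : HasDerivAt (fun t : ℝ => e (z0.1 + t, z0.2 + f t)) _ t :=
        (hd _).hasFDerivAt.comp_hasDerivAt t h1
      have h3 : (fun t : ℝ => e (z0.1 + t, z0.2 + f t)) =ᶠ[𝓝 t] fun _ => (0:ℝ) := ht
      exact (h3.hasDerivAt_iff.1 h2).unique (hasDerivAt_const _ _)
    have hHa : ∀ᶠ t in 𝓝 (0:ℝ), c * |t| * |a t| ≤ |H t| := by
      filter_upwards [hder, cone_ev f y0 δ hδ (hfd 0) f0 f1] with t h1 h2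
      have h3 : H t = a t * fderiv ℝ e (z0.1 + t, z0.2 + f t) (0, 1) := by
        rw [hH' t]
        have : ω = ω.1 • (1, deriv f t) + a t • ((0:ℝ), (1:ℝ)) := by
          ext <;> simp [ha]
        conv_lhs => rw [this]
        rw [map_add, map_smul, map_smul, h1]; simp
      by_cases ht0 : t = 0
      · simp [ht0]
      have h4 : c * |t| ≤ |fderiv ℝ e (z0.1 + t, z0.2 + f t) (0, 1)| := by
        refine deriv_lower (fun y => e (z0.1 + t, z0.2 + y)) _ (f t) _ ?_ ?_
        · have h5 : HasDerivAt (fun y : ℝ => (z0.1 + t, z0.2 + y)) ((0:ℝ), (1:ℝ)) (f t) :=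
            (hasDerivAt_const _ _).prodMk ((hasDerivAt_id _).const_add _)
          exact (hd _).hasFDerivAt.comp_hasDerivAt (f t) h5
        · have hpos : 0 < δ / 2 * |t| := by positivity
          filter_upwards [Metric.ball_mem_nhds (f t) hpos] with y hy
          rw [Metric.mem_ball, Real.dist_eq] at hy
          rw [hz t h2.1, sub_zero]
          refine hlow t y h2.1 ?_
          calc |y - y0 * t| = |(y - f t) + (f t - y0 * t)| := by ring_nf
            _ ≤ |y - f t| + |f t - y0 * t| := abs_add_le _ _
            _ ≤ δ / 2 * |t| + δ / 2 * |t| := by linarith [h2.2]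
            _ = δ * |t| := by ring
      rw [h3, abs_mul, mul_comm]
      gcongr
    have hfd1 : ContDiff ℝ (r - 3 : ℕ) (deriv f) := by
      have : ContDiff ℝ ((r - 3 : ℕ) + 1) f := hf.of_le (by norm_cast; omega)
      exact ((contDiff_succ_iff_deriv).1 this).2.2
    have hac : ContDiff ℝ (n₀ - 1 : ℕ) a := by
      have : ContDiff ℝ (n₀ - 1 : ℕ) (deriv f) := hfd1.of_le (by norm_cast; omega)
      exact contDiff_const.sub (contDiff_const.mul this)
    have hao := lo_div (n₀ - 1) (by omega) a H c hc hac.continuous.continuousAt (by rwa [hn1]) hHa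
    have hit := iteratedDeriv_of_isLittleO (n₀ - 1) a hac hao
    have ha0 := hit 0 (by omega)
    rw [iteratedDeriv_zero] at ha0
    by_cases hω1 : ω.1 = 0
    · apply hω
      refine Prod.ext hω1 ?_
      simpa [ha, hω1] using ha0
    · obtain ⟨m, h2, hm, hne⟩ := hNF z0 f hf f0 hzev
      apply hne
      have h3 := hit (m - 1) (by omega)
      have h4 : iteratedDeriv (m - 1) a 0 = - (ω.1 * iteratedDeriv m f 0) := by
        rw [ha, iteratedDeriv_const_sub (by omega), iteratedDeriv_neg, iteratedDeriv_const_mul_field,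
          ← iteratedDeriv_succ', show m - 1 + 1 = m by omega]
      rw [h4, neg_eq_zero, mul_eq_zero] at h3
      exact h3.resolve_left hω1
  · set s := z0 - l • ω with hs
    have hne : z0 ≠ s := by
      intro h
      have : l • ω = 0 := by rw [hs] at h; exact sub_eq_self.1 h.symm
      rcases smul_eq_zero.1 this with h | h
      · exact hl h
      · exact hω h
    have hrel : ∀ᶠ t in 𝓝 (0:ℝ), e (s.1 + t, s.2 + f t) = -l * H t := by
      filter_upwards [hzev] with t ht
      have h1 := dd_eq r (by omega) e he (z0.1 + t, z0.2 + f t) l ω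
      have h2 : ((z0.1 + t, z0.2 + f t) : ℝ × ℝ) - l • ω = (s.1 + t, s.2 + f t) := by
        ext <;> simp [hs] <;> ring
      rw [ht, h2] at h1
      rw [hH]; linarith
    have hes : e s = 0 := by
      have := hrel.self_of_nhds
      have h0 := hcon 0 (by omega)
      rw [iteratedDeriv_zero] at h0
      simpa [f0, h0] using this
    have heo : (fun t => e (s.1 + t, s.2 + f t)) =o[𝓝 0] fun t => t ^ n₀ :=
      (hHo.const_mul_left (-l)).congr' (hrel.mono fun t ht => ht.symm) EventuallyEq.rfl
    obtain ⟨δ', hδ', c', hc', hL⟩ := Lcone_exists r (by omega) e he s hes (hH4 s hes) y0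
    have hcone := cone_ev f y0 δ' hδ' (hfd 0) f0 f1
    rcases hL with hL | ⟨g, hg, g0, g1, gz, hL⟩
    · have h1 := (Asymptotics.isLittleO_iff.1 heo) (show 0 < c' / 2 by positivity)
      have h2 : ∀ᶠ t in 𝓝 (0:ℝ), |t| < 1 := by
        filter_upwards [Metric.ball_mem_nhds (0:ℝ) one_pos] with t ht
        simpa using ht
      have h3 : ∀ᶠ t in 𝓝[≠] (0:ℝ), False := by
        filter_upwards [(h1.and (h2.and hcone)).filter_mono nhdsWithin_le_nhds, self_mem_nhdsWithin] with t ⟨h1, h2, h3⟩ ht0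
        have ht : 0 < |t| := abs_pos.2 ht0
        have h4 := (hL t (f t) h3.1 (h3.2.trans (by nlinarith))).1
        simp only [Real.norm_eq_abs, abs_pow] at h1
        have h5 : |t| ^ n₀ ≤ |t| ^ 2 := pow_le_pow_of_le_one ht.le h2.le (by omega)
        rw [← sq_abs] at h4
        have h6 : 0 < |t| ^ 2 := by positivity
        nlinarith
      exact h3.exists.elim fun _ h => h
    · have h1 : ∀ᶠ t in 𝓝 (0:ℝ), c' * |t| * |f t - g t| ≤ |e (s.1 + t, s.2 + f t)| := by
        filter_upwards [hcone] with t ht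
        exact (hL t (f t) ht.1 (ht.2.trans (by nlinarith [abs_nonneg t]))).1
      have h2 := lo_div (n₀ - 1) (by omega) (fun t => f t - g t) _ c' hc'
        (hf.continuous.sub hg.continuous).continuousAt (by rwa [hn1]) h1
      have h3 := iteratedDeriv_of_isLittleO (n₀ - 1) _ ((hf.sub hg).of_le (by norm_cast; omega)) h2
      obtain ⟨m, hm, hne'⟩ := hNN z0 s f g hne hf hg f0 g0 hzev (by
        filter_upwards [Metric.ball_mem_nhds (0:ℝ) hδ'] with t ht
        exact gz t (by simpa using ht))
      exact hne' (h3 m hm)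

lemma np_le (s x y : ℝ) (hs : 0 ≤ s) (h : |x| ≤ |y|) : np s y ≤ np s x := by
  unfold np
  rw [ENNReal.rpow_neg, ENNReal.rpow_neg, ENNReal.inv_le_inv]
  exact ENNReal.rpow_le_rpow (ENNReal.ofReal_le_ofReal h) hs

lemma np_mul (s x y : ℝ) : np s (x * y) = np s x * np s y := by
  unfold np
  rw [abs_mul, ENNReal.ofReal_mul (abs_nonneg _), ENNReal.mul_rpow_of_ne_top (by simp) (by simp)]

lemma np_add (a b x : ℝ) (hx : x ≠ 0) : np (a + b) x = np a x * np b x := by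
  unfold np
  rw [neg_add, ENNReal.rpow_add _ _ (by simpa using hx) (by simp)]

lemma np_lt_top (s x : ℝ) (hx : x ≠ 0) : np s x < ∞ := by
  unfold np
  exact (ENNReal.rpow_ne_top_of_ne_zero (by simpa using hx) (by simp)).lt_top

lemma np_zero (s : ℝ) (hs : 0 < s) : np s 0 = ∞ := by
  unfold np
  simp [ENNReal.zero_rpow_of_neg (by linarith : -s < 0)]

lemma np_abs (s x : ℝ) : np s |x| = np s x := by simp [np]

/-- cone piece -/
def Pc (z0 : ℝ × ℝ) (y0 ρ : ℝ) : Set (ℝ × ℝ) :=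
  {z | |z.1 - z0.1| < ρ ∧ |(z.2 - z0.2) - y0 * (z.1 - z0.1)| ≤ ρ * |z.1 - z0.1|}

lemma Pc_mono (z0 : ℝ × ℝ) (y0 : ℝ) {ρ ρ' : ℝ} (h : ρ ≤ ρ') : Pc z0 y0 ρ ⊆ Pc z0 y0 ρ' := by
  rintro z ⟨h1, h2⟩
  exact ⟨h1.trans_le h, h2.trans (by gcongr)⟩

lemma Pc_meas (z0 : ℝ × ℝ) (y0 ρ : ℝ) : MeasurableSet (Pc z0 y0 ρ) := by
  have h1 : MeasurableSet {z : ℝ × ℝ | |z.1 - z0.1| < ρ} := measurableSet_lt (by fun_prop) (by fun_prop)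
  have h2 : MeasurableSet {z : ℝ × ℝ | |(z.2 - z0.2) - y0 * (z.1 - z0.1)| ≤ ρ * |z.1 - z0.1|} :=
    measurableSet_le (by fun_prop) (by fun_prop)
  exact h1.inter h2

lemma Pc_bound (z0 : ℝ × ℝ) (y0 ρ : ℝ) (h1 : ρ ≤ 1) (z : ℝ × ℝ) (hz : z ∈ Pc z0 y0 ρ) :
    dist z z0 ≤ (|y0| + 1) * |z.1 - z0.1| := by
  have := cone_near z0 y0 ρ (z.1 - z0.1) (z.2 - z0.2) h1 hz.2
  rw [dist_eq_norm]
  have e1 : ((z0.1 + (z.1 - z0.1), z0.2 + (z.2 - z0.2)) : ℝ × ℝ) = z := by ext <;> simp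
  rwa [e1] at this

lemma volume_cb (z0 : ℝ × ℝ) (a : ℝ) (ha : 0 ≤ a) : volume (Metric.closedBall z0 a) = ENNReal.ofReal (4 * a ^ 2) := by
  have : Metric.closedBall z0 a = Metric.closedBall z0.1 a ×ˢ Metric.closedBall z0.2 a := by
    rw [closedBall_prod_same]
  rw [this, Measure.volume_eq_prod, Measure.prod_prod, Real.volume_closedBall, Real.volume_closedBall,
    ← ENNReal.ofReal_mul (by positivity)]
  congr 1; ring

lemma coneint (z0 : ℝ × ℝ) (y0 ρ σ : ℝ) (hρ : 0 < ρ) (h1 : ρ ≤ 1) (h0 : 0 < σ) (hσ : σ < 2) :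
    ∫⁻ z in Pc z0 y0 ρ, np σ (z.1 - z0.1) < ∞ := by
  set A := |y0| + 1
  have hA : 0 < A := by positivity
  obtain ⟨B, hB, h⟩ := lint_of_sublevel (4 * A ^ 2) (4 * A ^ 2) 2 σ h0 hσ
  refine lt_of_le_of_lt (h (volume.restrict (Pc z0 y0 ρ)) (fun z => z.1 - z0.1) (by fun_prop) ?_ ?_) hB
  · rw [Measure.restrict_apply_univ, ← volume_cb z0 A (by positivity)]
    refine measure_mono fun z hz => ?_
    have h2 := Pc_bound z0 y0 ρ h1 z hz
    rw [Metric.mem_closedBall]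
    refine h2.trans ?_
    have := hz.1
    nlinarith
  · intro ε hε
    rw [Measure.restrict_apply' (Pc_meas _ _ _)]
    have : 4 * A ^ 2 * ε ^ (2:ℝ) = 4 * (A * ε) ^ 2 := by
      rw [Real.rpow_two]; ring
    rw [this, ← volume_cb z0 (A * ε) (by positivity)]
    refine measure_mono fun z hz => ?_
    have h2 := Pc_bound z0 y0 ρ h1 z hz.2
    rw [Metric.mem_closedBall]
    refine h2.trans ?_
    have : |z.1 - z0.1| ≤ ε := hz.1
    gcongr

lemma lint_1d (γ a : ℝ) (h0 : 0 < γ) (h1 : γ < 1) : ∫⁻ s in Ioo (-a) a, np γ s < ∞ := by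
  obtain ⟨B, hB, h⟩ := vdc_lint 1 1 (2 * a) γ one_pos h0 (by simpa using h1)
  refine lt_of_le_of_lt (h (Ioo (-a) a) (convex_Ioo _ _) measurableSet_Ioo (by
    rw [Real.volume_Ioo]; apply le_of_eq; congr 1; ring) id contDiff_id ?_) hB
  intro t _
  simp

lemma shear (z0 : ℝ × ℝ) (f : ℝ → ℝ) (hf : Continuous f) (G : ℝ × ℝ → ℝ≥0∞) (hG : Measurable G) :
    ∫⁻ z : ℝ × ℝ, G (z.1 - z0.1, z.2 - z0.2 - f (z.1 - z0.1)) = ∫⁻ s, ∫⁻ t, G (t, s) := by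
  have hfm := hf.measurable
  rw [Measure.volume_eq_prod, lintegral_prod _ (by fun_prop)]
  have h1 : ∀ t : ℝ, ∫⁻ y, G (t - z0.1, y - z0.2 - f (t - z0.1)) = ∫⁻ s, G (t - z0.1, s) := by
    intro t
    have := lintegral_sub_right_eq_self (μ := (volume : Measure ℝ)) (fun s => G (t - z0.1, s)) (z0.2 + f (t - z0.1))
    rw [← this]
    simp only [sub_sub]
  simp only [h1]
  rw [lintegral_sub_right_eq_self (μ := (volume : Measure ℝ)) (fun t => ∫⁻ s, G (t, s)) z0.1]
  exact lintegral_lintegral_swap (by fun_prop)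

/-- bounding an integral over a cone piece by an iterated integral -/
lemma shear_le (z0 : ℝ × ℝ) (y0 ρ η : ℝ) (f : ℝ → ℝ) (hf : Continuous f) (F : ℝ × ℝ → ℝ≥0∞)
    (a : ℝ → ℝ≥0∞) (b : ℝ → ℝ → ℝ≥0∞) (ha : Measurable a) (hb : Measurable (Function.uncurry b))
    (C : ℝ≥0∞)
    (hP : ∀ z ∈ Pc z0 y0 ρ, |z.2 - z0.2 - f (z.1 - z0.1)| < η)
    (hF : ∀ z ∈ Pc z0 y0 ρ, F z ≤ C * (a (z.2 - z0.2 - f (z.1 - z0.1)) *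
      b (z.2 - z0.2 - f (z.1 - z0.1)) (z.1 - z0.1)))
    (B : ℝ≥0∞) (hB : ∀ s ∈ Ioo (-η) η, ∫⁻ t in Ioo (-ρ) ρ, b s t ≤ B) :
    ∫⁻ z in Pc z0 y0 ρ, F z ≤ C * ((∫⁻ s in Ioo (-η) η, a s) * B) := by
  let G : ℝ × ℝ → ℝ≥0∞ := fun p => C * ((Ioo (-η) η).indicator a p.2 * (Ioo (-ρ) ρ).indicator (b p.2) p.1)
  have hGd : ∀ p, G p = C * ((Ioo (-η) η).indicator a p.2 * (Ioo (-ρ) ρ).indicator (b p.2) p.1) := fun p => rfl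
  clear_value G
  have hGm : Measurable G := by
    have h1 : Measurable fun p : ℝ × ℝ => (Ioo (-η) η).indicator a p.2 :=
      (ha.indicator measurableSet_Ioo).comp measurable_snd
    have h2 : Measurable fun p : ℝ × ℝ => (Ioo (-ρ) ρ).indicator (b p.2) p.1 := by
      have : (fun p : ℝ × ℝ => (Ioo (-ρ) ρ).indicator (b p.2) p.1) =
          (Prod.fst ⁻¹' (Ioo (-ρ) ρ)).indicator (fun p : ℝ × ℝ => Function.uncurry b (p.2, p.1)) := by
        funext p
        by_cases h : p.1 ∈ Ioo (-ρ) ρ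
        · rw [indicator_of_mem h, indicator_of_mem (by exact h)]; rfl
        · rw [indicator_of_notMem h, indicator_of_notMem (by exact h)]
      rw [this]
      exact (hb.comp (measurable_snd.prodMk measurable_fst)).indicator (measurable_fst measurableSet_Ioo)
    have h3 : G = fun p => C * ((Ioo (-η) η).indicator a p.2 * (Ioo (-ρ) ρ).indicator (b p.2) p.1) :=
      funext hGd
    rw [h3]
    exact (h1.mul h2).const_mul C
  calc ∫⁻ z in Pc z0 y0 ρ, F z
      ≤ ∫⁻ z in Pc z0 y0 ρ, G (z.1 - z0.1, z.2 - z0.2 - f (z.1 - z0.1)) := by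
        refine setLIntegral_mono' (Pc_meas _ _ _) fun z hz => ?_
        refine (hF z hz).trans (le_of_eq ?_)
        have m1 : z.2 - z0.2 - f (z.1 - z0.1) ∈ Ioo (-η) η := abs_lt.1 (hP z hz)
        have m2 : z.1 - z0.1 ∈ Ioo (-ρ) ρ := abs_lt.1 hz.1
        simp only [hGd, indicator_of_mem m1, indicator_of_mem m2]
    _ ≤ ∫⁻ z : ℝ × ℝ, G (z.1 - z0.1, z.2 - z0.2 - f (z.1 - z0.1)) := setLIntegral_le_lintegral _ _
    _ = ∫⁻ s, ∫⁻ t, G (t, s) := shear z0 f hf G hGm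
    _ = ∫⁻ s, C * ((Ioo (-η) η).indicator a s * ∫⁻ t in Ioo (-ρ) ρ, b s t) := by
        refine lintegral_congr fun s => ?_
        have hbs : Measurable (b s) := hb.comp (measurable_const.prodMk measurable_id)
        have hbi := hbs.indicator (measurableSet_Ioo (a := -ρ) (b := ρ))
        simp only [hGd]
        rw [lintegral_const_mul _ (hbi.const_mul _), lintegral_const_mul _ hbi,
          lintegral_indicator measurableSet_Ioo]
    _ ≤ ∫⁻ s, C * ((Ioo (-η) η).indicator a s * B) := by
        refine lintegral_mono fun s => ?_
        by_cases hs : s ∈ Ioo (-η) η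
        · gcongr; exact hB s hs
        · simp [indicator_of_notMem hs]
    _ = C * ((∫⁻ s in Ioo (-η) η, a s) * B) := by
        have hai := ha.indicator (measurableSet_Ioo (a := -η) (b := η))
        rw [lintegral_const_mul _ (hai.mul_const _), lintegral_mul_const _ hai,
          lintegral_indicator measurableSet_Ioo]

/-- the main spatial integrand -/
noncomputable def JI (e : ℝ × ℝ → ℝ) (γ β l : ℝ) (ω z : ℝ × ℝ) : ℝ≥0∞ :=
  ENNReal.ofReal ‖fderiv ℝ e z‖ * np γ (e z) * np β (max |e z| |e (z - l • ω)|)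

lemma recenter (z0 z : ℝ × ℝ) : ((z0.1 + (z.1 - z0.1), z0.2 + (z.2 - z0.2)) : ℝ × ℝ) = z := by
  ext <;> simp

lemma choose_rho (z0 : ℝ × ℝ) (y0 δ η : ℝ) (hδ : 0 < δ) (hη : 0 < η) (f : ℝ → ℝ) (hf : Continuous f)
    (f0 : f 0 = 0) : ∃ ρ > 0, ρ ≤ 1 ∧ ρ ≤ δ ∧ ρ ≤ η ∧
      ∀ z ∈ Pc z0 y0 ρ, |z.2 - z0.2 - f (z.1 - z0.1)| < η := by
  have h1 : ∀ᶠ t in 𝓝 (0:ℝ), |f t| < η / 2 := by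
    have := hf.abs.continuousAt (x := 0)
    refine this.eventually (gt_mem_nhds ?_)
    simp only [f0, abs_zero]; positivity
  obtain ⟨ρ1, hρ1, hb⟩ := Metric.eventually_nhds_iff_ball.1 h1
  set A := |y0| + 1
  have hA : 1 ≤ A := by simp only [A]; linarith [abs_nonneg y0]
  refine ⟨min (min 1 δ) (min ρ1 (η / (2 * A))), by positivity, (min_le_left _ _).trans (min_le_left _ _),
    (min_le_left _ _).trans (min_le_right _ _), ?_, ?_⟩
  · refine ((min_le_right _ _).trans (min_le_right _ _)).trans ?_
    rw [div_le_iff₀ (by positivity)]; nlinarith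
  intro z hz
  set ρ := min (min 1 δ) (min ρ1 (η / (2 * A))) with hρ
  have h2 := Pc_bound z0 y0 ρ ((min_le_left _ _).trans (min_le_left _ _)) z hz
  have h3 : |f (z.1 - z0.1)| < η / 2 := hb _ (by
    rw [Metric.mem_ball, Real.dist_eq, sub_zero]
    exact hz.1.trans_le ((min_le_right _ _).trans (min_le_left _ _)))
  have h4 : |z.2 - z0.2| ≤ dist z z0 := by
    rw [Prod.dist_eq, ← Real.dist_eq]; exact le_max_right _ _
  have h5 : |z.1 - z0.1| < η / (2 * A) := hz.1.trans_le ((min_le_right _ _).trans (min_le_right _ _))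
  rw [lt_div_iff₀ (by positivity)] at h5
  have : |z.2 - z0.2| ≤ A * |z.1 - z0.1| := h4.trans h2
  calc _ ≤ |z.2 - z0.2| + |f (z.1 - z0.1)| := abs_sub _ _
    _ < η := by nlinarith

lemma locA_cone (r : ℕ) (hr : 3 ≤ r) (e : ℝ × ℝ → ℝ) (he : ContDiff ℝ r e)
    (hH4 : ∀ k : ℝ × ℝ, e k = 0 → fderiv ℝ e k = 0 → HessCond e k) (α : ℝ) (h0 : 0 < α) (h1 : α < 1)
    (z0 : ℝ × ℝ) (hz0 : e z0 = 0) (y0 : ℝ) : ∃ ρ > 0, ∫⁻ z in Pc z0 y0 ρ, np α (e z) < ∞ := by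
  obtain ⟨δ, hδ, c, hc, hL⟩ := Lcone_exists r hr e he z0 hz0 (hH4 z0 hz0) y0
  rcases hL with hL | ⟨f, hf, f0, f1, fz, hL⟩
  · refine ⟨min δ 1, by positivity, ?_⟩
    have hfin := coneint z0 y0 (min δ 1) (2 * α) (by positivity) (min_le_right _ _) (by linarith) (by linarith)
    calc ∫⁻ z in Pc z0 y0 (min δ 1), np α (e z)
        ≤ ∫⁻ z in Pc z0 y0 (min δ 1), np α c * np (2 * α) (z.1 - z0.1) := by
          refine setLIntegral_mono' (Pc_meas _ _ _) fun z hz => ?_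
          have hz' := Pc_mono z0 y0 (min_le_left δ 1) hz
          have h3 := (hL (z.1 - z0.1) (z.2 - z0.2) hz'.1 hz'.2).1
          rw [recenter] at h3
          by_cases ht : z.1 - z0.1 = 0
          · rw [ht, np_zero (2 * α) (by linarith), ENNReal.mul_top]
            · exact le_top
            · simp [np, ENNReal.rpow_eq_zero_iff, hc.ne']
          · rw [two_mul, np_add _ _ _ ht, ← np_mul, ← np_mul]
            refine np_le _ _ _ h0.le ?_
            rw [abs_mul, abs_mul, abs_of_pos hc, abs_mul_abs_self]
            linarith
      _ = np α c * ∫⁻ z in Pc z0 y0 (min δ 1), np (2 * α) (z.1 - z0.1) := by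
          exact lintegral_const_mul _ ((np_measurable _).comp (by fun_prop : Measurable fun z : ℝ × ℝ => z.1 - z0.1))
      _ < ∞ := ENNReal.mul_lt_top (np_lt_top _ _ hc.ne') hfin
  · obtain ⟨ρ, hρ, hρ1, hρδ, -, hP⟩ := choose_rho z0 y0 δ 1 hδ one_pos f hf.continuous f0
    refine ⟨ρ, hρ, ?_⟩
    refine lt_of_le_of_lt (shear_le z0 y0 ρ 1 f hf.continuous (fun z => np α (e z)) (np α) (fun _ t => np α t)
      (np_measurable α) ((np_measurable α).comp measurable_snd) (np α c) hP ?_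
      (∫⁻ t in Ioo (-ρ) ρ, np α t) (fun _ _ => le_rfl)) ?_
    · intro z hz
      have hz' := Pc_mono z0 y0 hρδ hz
      have h3 := (hL (z.1 - z0.1) (z.2 - z0.2) hz'.1 hz'.2).1
      rw [recenter] at h3
      rw [← np_mul, ← np_mul]
      refine np_le _ _ _ h0.le ?_
      rw [abs_mul, abs_mul, abs_of_pos hc]
      linarith
    · exact ENNReal.mul_lt_top (np_lt_top _ _ hc.ne')
        (ENNReal.mul_lt_top (lint_1d α 1 h0 h1) (lint_1d α ρ h0 h1))

lemma ofReal_mul_np (γ x : ℝ) (hx : x ≠ 0) : ENNReal.ofReal |x| * np γ x = np (γ - 1) x := by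
  have : ENNReal.ofReal |x| = np (-1) x := by unfold np; simp
  rw [this, ← np_add _ _ _ hx]; congr 1; ring

lemma np_max_le (s a b h : ℝ) (l : ℝ) (hs : 0 ≤ s) (hab : a - b = l * h) :
    np s (max |a| |b|) ≤ np s (1/2) * (np s l * np s h) := by
  rw [← np_mul, ← np_mul]
  refine np_le _ _ _ hs ?_
  rw [← hab, abs_mul, abs_of_pos (by norm_num : (0:ℝ) < 1/2), abs_of_nonneg (le_max_of_le_left (abs_nonneg a))]
  have h1 := abs_sub a b
  have h2 := le_max_left |a| |b|
  have h3 := le_max_right |a| |b|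
  linarith

lemma locI_cone (n₀ r : ℕ) (hn₀ : 3 ≤ n₀) (hr : 2 * n₀ + 1 ≤ r)
    (e : ℝ × ℝ → ℝ) (he : ContDiff ℝ r e)
    (hH4 : ∀ k : ℝ × ℝ, e k = 0 → fderiv ℝ e k = 0 → HessCond e k)
    (hNF : NF1 e r n₀) (hNN : NN1 e r n₀) (γ β : ℝ) (hγ : 0 < γ) (hγ1 : γ < 1) (hβ : 0 < β)
    (hβn : β * n₀ < 1) (hs1 : 1 ≤ γ + β) (hs2 : γ + β < 3 / 2)
    (z0 : ℝ × ℝ) (hz0 : e z0 = 0) (l0 : ℝ) (ω0 : ℝ × ℝ) (hω0 : ω0 ≠ 0) (y0 : ℝ) :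
    ∃ ρ > 0, ∃ C < ∞, ∀ᶠ p : ℝ × (ℝ × ℝ) in 𝓝 (l0, ω0),
      ∫⁻ z in Pc z0 y0 ρ, JI e γ β p.1 p.2 z ≤ C * (1 + np β p.1) := by
  have hr0 : (r : WithTop ℕ∞) ≠ 0 := by
    have : r ≠ 0 := by omega
    exact_mod_cast this
  obtain ⟨δ, hδ, c, hc, hL⟩ := Lcone_exists r (by omega) e he z0 hz0 (hH4 z0 hz0) y0
  rcases hL with hL | ⟨f, hf, f0, f1, fz, hL⟩
  · set σ := 1 + (γ + β - 1) + (γ + β - 1) with hσ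
    set κ := γ + β - 1 with hκ
    have hfin := coneint z0 y0 (min δ 1) σ (by positivity) (min_le_right _ _) (by linarith) (by linarith)
    set I := ∫⁻ z in Pc z0 y0 (min δ 1), np σ (z.1 - z0.1)
    refine ⟨min δ 1, by positivity, np 1 c * np κ c * I, ENNReal.mul_lt_top
      (ENNReal.mul_lt_top (np_lt_top _ _ hc.ne') (np_lt_top _ _ hc.ne')) hfin, Eventually.of_forall fun p => ?_⟩
    calc ∫⁻ z in Pc z0 y0 (min δ 1), JI e γ β p.1 p.2 z
        ≤ ∫⁻ z in Pc z0 y0 (min δ 1), np 1 c * np κ c * np σ (z.1 - z0.1) := by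
          refine setLIntegral_mono' (Pc_meas _ _ _) fun z hz => ?_
          have hz' := Pc_mono z0 y0 (min_le_left δ 1) hz
          have h3 := (hL (z.1 - z0.1) (z.2 - z0.2) hz'.1 hz'.2)
          rw [recenter] at h3
          obtain ⟨h3, h4⟩ := h3
          by_cases ht : z.1 - z0.1 = 0
          · rw [ht, np_zero σ (by linarith), ENNReal.mul_top]
            · exact le_top
            · simp [np, ENNReal.rpow_eq_zero_iff, hc.ne']
          set t := z.1 - z0.1
          have ht' : 0 < |t| := abs_pos.2 ht
          have hez : e z ≠ 0 := by
            intro h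
            rw [h, abs_zero] at h3
            have : 0 < c * t ^ 2 := by positivity
            linarith
          calc JI e γ β p.1 p.2 z ≤ ENNReal.ofReal ‖fderiv ℝ e z‖ * np γ (e z) * np β (e z) := by
                unfold JI
                gcongr
                refine np_le _ _ _ hβ.le ?_
                exact (le_max_left _ _).trans (le_abs_self _)
            _ = ENNReal.ofReal ‖fderiv ℝ e z‖ * np (γ + β) (e z) := by
                rw [mul_assoc, np_add _ _ _ hez]
            _ ≤ (np 1 (c * t) * ENNReal.ofReal |e z|) * np (γ + β) (e z) := by
                gcongr
                have : np 1 (c * t) = ENNReal.ofReal (1 / (c * |t|)) := by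
                  unfold np
                  rw [abs_mul, abs_of_pos hc, ENNReal.rpow_neg_one, ← ENNReal.ofReal_inv_of_pos (by positivity), one_div]
                rw [this, ← ENNReal.ofReal_mul (by positivity)]
                refine ENNReal.ofReal_le_ofReal ?_
                rw [one_div, inv_mul_eq_div, le_div_iff₀ (by positivity)]
                linarith
            _ = np 1 (c * t) * np κ (e z) := by rw [mul_assoc, ofReal_mul_np _ _ hez]
            _ ≤ np 1 (c * t) * np κ (c * (t * t)) := by
                gcongr
                refine np_le _ _ _ (by linarith) ?_
                rw [abs_of_nonneg (mul_nonneg hc.le (mul_self_nonneg t))]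
                linarith
            _ = np 1 c * np κ c * np σ t := by
                rw [hσ, np_add _ _ _ ht, np_add _ _ _ ht, np_mul, np_mul, np_mul]; ring
      _ = np 1 c * np κ c * I := by
          exact lintegral_const_mul _ ((np_measurable _).comp (by fun_prop : Measurable fun z : ℝ × ℝ => z.1 - z0.1))
      _ ≤ np 1 c * np κ c * I * (1 + np β p.1) := by
          refine le_mul_of_one_le_right (zero_le) ?_
          exact le_self_add
  · have hfl : ∀ t y, |t| < δ → |y - y0 * t| ≤ δ * |t| → c * |t| * |y - f t| ≤ |e (z0.1 + t, z0.2 + y)| :=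
      fun t y h1 h2 => (hL t y h1 h2).1
    obtain ⟨m, hm, hne⟩ := nondeg n₀ r hn₀ hr e he hH4 hNF hNN z0 y0 δ c hδ hc f hf f0 f1 fz hfl l0 ω0 hω0
    set G : ℝ × (ℝ × ℝ × (ℝ × ℝ)) → ℝ := fun q => dd e (z0.1 + q.1, z0.2 + f q.1 + q.2.1) q.2.2.1 q.2.2.2 with hGdef
    have hG : ContDiff ℝ m G := by
      have h1 := (dd_contDiff r (by omega) e he).of_le (m := (m : WithTop ℕ∞)) (by norm_cast; omega)
      have h2 : ContDiff ℝ m f := hf.of_le (by norm_cast; omega)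
      exact h1.comp (f := fun q : ℝ × (ℝ × ℝ × (ℝ × ℝ)) =>
        (((z0.1 + q.1, z0.2 + f q.1 + q.2.1) : ℝ × ℝ), q.2.2.1, q.2.2.2)) (by fun_prop)
    have hcont := (continuous_iteratedDeriv_param m G hG).abs
    have hval : iteratedDeriv m (fun t => G (t, (0, l0, ω0))) 0 ≠ 0 := by
      simpa [hGdef] using hne
    set c1 := |iteratedDeriv m (fun t => G (t, (0, l0, ω0))) 0| / 2 with hc1
    have hc1p : 0 < c1 := by positivity
    have hev : ∀ᶠ q : ℝ × (ℝ × ℝ × (ℝ × ℝ)) in 𝓝 (0, (0, l0, ω0)),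
        c1 < |iteratedDeriv m (fun t => G (t, q.2)) q.1| :=
      hcont.continuousAt.eventually (lt_mem_nhds (by simp only [hc1]; linarith [abs_pos.2 hval]))
    obtain ⟨η0, hη0, hball⟩ := Metric.eventually_nhds_iff_ball.1 hev
    set η := min η0 1 with hηdef
    have hη : 0 < η := by positivity
    obtain ⟨ρ, hρ, hρ1, hρδ, hρη, hP⟩ := choose_rho z0 y0 δ η hδ hη f hf.continuous f0
    obtain ⟨B, hB, hvdc⟩ := vdc_lint m c1 (2 * ρ) β hc1p hβ (by
      have : (m:ℝ) ≤ n₀ := by exact_mod_cast hm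
      nlinarith)
    -- bound on the derivative
    have hfc : Continuous fun z => ‖fderiv ℝ e z‖ := (he.continuous_fderiv hr0).norm
    obtain ⟨K, hK⟩ := (isCompact_closedBall z0 (|y0| + 1)).bddAbove_image hfc.continuousOn
    have hK' : ∀ z ∈ Pc z0 y0 ρ, ‖fderiv ℝ e z‖ ≤ max K 1 := by
      intro z hz
      refine le_max_of_le_left (hK (mem_image_of_mem _ ?_))
      have h2 := Pc_bound z0 y0 ρ hρ1 z hz
      rw [Metric.mem_closedBall]
      refine h2.trans ?_
      have := hz.1
      nlinarith [abs_nonneg y0, abs_nonneg (z.1 - z0.1)]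
    have hK0 : (0:ℝ) < max K 1 := by positivity
    set C1 := np γ c * np (γ - 1) (max K 1) * np β (1/2) with hC1
    have hC1f : C1 < ∞ := ENNReal.mul_lt_top (ENNReal.mul_lt_top (np_lt_top _ _ hc.ne') (np_lt_top _ _ hK0.ne'))
      (np_lt_top _ _ (by norm_num))
    set I := ∫⁻ s in Ioo (-η) η, np γ s with hI
    have hIf : I < ∞ := lint_1d γ η hγ hγ1
    refine ⟨ρ, hρ, C1 * (I * B), ENNReal.mul_lt_top hC1f (ENNReal.mul_lt_top hIf hB), ?_⟩
    have hnear : ∀ᶠ p : ℝ × (ℝ × ℝ) in 𝓝 (l0, ω0), dist p (l0, ω0) < η0 := Metric.ball_mem_nhds _ hη0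
    filter_upwards [hnear] with p hp
    have hmain := shear_le z0 y0 ρ η f hf.continuous (JI e γ β p.1 p.2) (np γ)
      (fun s t => np β (G (t, (s, p.1, p.2)))) (np_measurable γ) ?_ (C1 * np β p.1) hP ?_ B ?_
    · calc _ ≤ _ := hmain
        _ = C1 * (I * B) * np β p.1 := by rw [← hI]; ring
        _ ≤ C1 * (I * B) * (1 + np β p.1) := by
          gcongr; exact le_add_self
    · refine (np_measurable β).comp ?_
      have hGc := hG.continuous
      exact (by fun_prop : Continuous fun q : ℝ × ℝ => G (q.2, (q.1, p.1, p.2))).measurable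
    · intro z hz
      have hz' := Pc_mono z0 y0 hρδ hz
      have h4 := (hL (z.1 - z0.1) (z.2 - z0.2) hz'.1 hz'.2).2
      rw [recenter] at h4
      set s := z.2 - z0.2 - f (z.1 - z0.1) with hs
      have h5 : np β (max |e z| |e (z - p.1 • p.2)|) ≤ np β (1/2) * (np β p.1 * np β (G (z.1 - z0.1, (s, p.1, p.2)))) := by
        refine np_max_le β _ _ _ _ hβ.le ?_
        rw [dd_eq r (by omega) e he z p.1 p.2]
        simp only [hGdef]
        congr 2
        ext
        · simp
        · simp [hs]
      by_cases hd0 : ‖fderiv ℝ e z‖ = 0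
      · simp [JI, hd0]
      have hd0' : 0 < ‖fderiv ℝ e z‖ := lt_of_le_of_ne (norm_nonneg _) (Ne.symm hd0)
      have h6 : ENNReal.ofReal ‖fderiv ℝ e z‖ * np γ (e z) ≤ np γ c * np (γ - 1) (max K 1) * np γ s := by
        calc ENNReal.ofReal ‖fderiv ℝ e z‖ * np γ (e z)
            ≤ ENNReal.ofReal |‖fderiv ℝ e z‖| * np γ (c * ‖fderiv ℝ e z‖ * s) := by
              rw [abs_of_pos hd0']
              gcongr
              refine np_le _ _ _ hγ.le ?_
              rw [abs_mul, abs_of_pos (by positivity)]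
              exact h4
          _ = np γ c * (ENNReal.ofReal |‖fderiv ℝ e z‖| * np γ ‖fderiv ℝ e z‖) * np γ s := by
              rw [np_mul, np_mul]; ring
          _ = np γ c * np (γ - 1) ‖fderiv ℝ e z‖ * np γ s := by rw [ofReal_mul_np _ _ hd0]
          _ ≤ _ := by
              gcongr
              unfold np
              rw [abs_of_pos hd0', abs_of_pos hK0]
              exact ENNReal.rpow_le_rpow (ENNReal.ofReal_le_ofReal (hK' z hz)) (by linarith)
      calc JI e γ β p.1 p.2 z ≤ (np γ c * np (γ - 1) (max K 1) * np γ s) *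
            (np β (1/2) * (np β p.1 * np β (G (z.1 - z0.1, (s, p.1, p.2))))) := by
            unfold JI; gcongr
        _ = _ := by rw [hC1]; ring
    · intro s hs
      refine hvdc (Ioo (-ρ) ρ) (convex_Ioo _ _) measurableSet_Ioo (by
        rw [Real.volume_Ioo]; apply le_of_eq; congr 1; ring) (fun t => G (t, (s, p.1, p.2))) ?_ ?_
      · exact hG.comp (contDiff_id.prodMk contDiff_const)
      · intro t ht
        refine (hball (t, (s, p.1, p.2)) ?_).le
        rw [Metric.mem_ball, Prod.dist_eq, Prod.dist_eq, max_lt_iff, max_lt_iff]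
        have hηη : η ≤ η0 := min_le_left _ _
        refine ⟨?_, ?_, hp⟩
        · rw [Real.dist_eq, sub_zero]
          exact (abs_lt.2 ht).trans_le (hρη.trans hηη)
        · rw [Real.dist_eq, sub_zero]
          exact (abs_lt.2 hs).trans_le hηη

lemma glue_cone {P : Type} (𝓕 : Filter P) (F : P → ℝ × ℝ → ℝ≥0∞) (b : P → ℝ≥0∞) (z0 : ℝ × ℝ)
    (h : ∀ y0 : ℝ, ∃ ρ > 0, ∃ C < ∞, ∀ᶠ p in 𝓕, ∫⁻ z in Pc z0 y0 ρ, F p z ≤ C * b p) :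
    ∃ ρ > 0, ∃ C < ∞, ∀ᶠ p in 𝓕,
      ∫⁻ z in {z : ℝ × ℝ | |z.1 - z0.1| < ρ ∧ |z.2 - z0.2| ≤ |z.1 - z0.1|}, F p z ≤ C * b p := by
  have key : ∃ ρ > 0, ∃ C < ∞, ∀ᶠ p in 𝓕,
      ∫⁻ z in {z : ℝ × ℝ | |z.1 - z0.1| < ρ ∧ ∃ η ∈ Icc (-1:ℝ) 1, z.2 - z0.2 = η * (z.1 - z0.1)}, F p z ≤ C * b p := by
    refine IsCompact.induction_on (isCompact_Icc (a := (-1:ℝ)) (b := 1)) (p := fun S => ∃ ρ > 0, ∃ C < ∞, ∀ᶠ p in 𝓕,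
      ∫⁻ z in {z : ℝ × ℝ | |z.1 - z0.1| < ρ ∧ ∃ η ∈ S, z.2 - z0.2 = η * (z.1 - z0.1)}, F p z ≤ C * b p) ?_ ?_ ?_ ?_
    · exact ⟨1, one_pos, 0, by simp, Eventually.of_forall fun p => by simp⟩
    · rintro s t hst ⟨ρ, hρ, C, hC, hh⟩
      refine ⟨ρ, hρ, C, hC, hh.mono fun p hp => le_trans (lintegral_mono_set ?_) hp⟩
      rintro z ⟨h1, η, hη, h2⟩
      exact ⟨h1, η, hst hη, h2⟩
    · rintro s t ⟨ρ, hρ, C, hC, hh⟩ ⟨ρ', hρ', C', hC', hh'⟩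
      refine ⟨min ρ ρ', lt_min hρ hρ', C + C', ENNReal.add_lt_top.2 ⟨hC, hC'⟩, ?_⟩
      filter_upwards [hh, hh'] with p h1 h2
      rw [add_mul]
      refine le_trans ?_ (add_le_add h1 h2)
      refine le_trans (lintegral_mono_set ?_) (lintegral_union_le _ _ _)
      rintro z ⟨h1, η, hη | hη, h2⟩
      · exact Or.inl ⟨h1.trans_le (min_le_left _ _), η, hη, h2⟩
      · exact Or.inr ⟨h1.trans_le (min_le_right _ _), η, hη, h2⟩
    · intro y0 _
      obtain ⟨ρ, hρ, C, hC, hh⟩ := h y0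
      refine ⟨Metric.ball y0 ρ, mem_nhdsWithin_of_mem_nhds (Metric.ball_mem_nhds _ hρ), ρ, hρ, C, hC,
        hh.mono fun p hp => le_trans (lintegral_mono_set ?_) hp⟩
      rintro z ⟨h1, η, hη, h2⟩
      refine ⟨h1, ?_⟩
      rw [h2, ← sub_mul, abs_mul]
      rw [Metric.mem_ball, Real.dist_eq] at hη
      gcongr
  obtain ⟨ρ, hρ, C, hC, hh⟩ := key
  refine ⟨ρ, hρ, C, hC, hh.mono fun p hp => le_trans (lintegral_mono_set ?_) hp⟩
  rintro z ⟨h1, h2⟩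
  refine ⟨h1, ?_⟩
  by_cases ht : z.1 - z0.1 = 0
  · refine ⟨0, by simp, ?_⟩
    rw [ht, abs_zero] at h2
    rw [zero_mul]
    exact abs_nonpos_iff.1 h2
  · refine ⟨(z.2 - z0.2) / (z.1 - z0.1), ?_, by field_simp⟩
    rw [mem_Icc, ← abs_le, abs_div]
    exact div_le_one_of_le₀ h2 (abs_nonneg _)

lemma glue_ball {P : Type} (𝓕 : Filter P) (F : P → ℝ × ℝ → ℝ≥0∞) (b : P → ℝ≥0∞) (z0 : ℝ × ℝ)
    (h : ∀ y0 : ℝ, ∃ ρ > 0, ∃ C < ∞, ∀ᶠ p in 𝓕, ∫⁻ z in Pc z0 y0 ρ, F p z ≤ C * b p)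
    (h' : ∀ y0 : ℝ, ∃ ρ > 0, ∃ C < ∞, ∀ᶠ p in 𝓕, ∫⁻ z in Pc z0.swap y0 ρ, F p z.swap ≤ C * b p) :
    ∃ s ∈ 𝓝 z0, ∃ C < ∞, ∀ᶠ p in 𝓕, ∫⁻ z in s, F p z ≤ C * b p := by
  obtain ⟨ρ, hρ, C, hC, hh⟩ := glue_cone 𝓕 F b z0 h
  obtain ⟨ρ', hρ', C', hC', hh'⟩ := glue_cone 𝓕 (fun p z => F p z.swap) b z0.swap h'
  refine ⟨Metric.ball z0 (min ρ ρ'), Metric.ball_mem_nhds _ (lt_min hρ hρ'), C + C', ENNReal.add_lt_top.2 ⟨hC, hC'⟩, ?_⟩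
  filter_upwards [hh, hh'] with p h1 h2
  set T' := {z : ℝ × ℝ | |z.1 - z0.swap.1| < ρ' ∧ |z.2 - z0.swap.2| ≤ |z.1 - z0.swap.1|}
  have hsw : ∫⁻ z in T', F p z.swap = ∫⁻ z in Prod.swap ⁻¹' T', F p z := by
    have := (Measure.measurePreserving_swap (μ := (volume : Measure ℝ)) (ν := (volume : Measure ℝ))).setLIntegral_comp_preimage_emb
      (MeasurableEquiv.prodComm (α := ℝ) (β := ℝ)).measurableEmbedding (F p) (Prod.swap ⁻¹' T')
    rw [← Measure.volume_eq_prod] at this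
    rw [← this]
    rfl
  rw [hsw] at h2
  rw [add_mul]
  refine le_trans ?_ (add_le_add h1 h2)
  refine le_trans (lintegral_mono_set ?_) (lintegral_union_le _ _ _)
  intro z hz
  rw [Metric.mem_ball, Prod.dist_eq, Real.dist_eq, Real.dist_eq, max_lt_iff, lt_min_iff, lt_min_iff] at hz
  rcases le_total |z.2 - z0.2| |z.1 - z0.1| with h | h
  · exact Or.inl ⟨hz.1.1, h⟩
  · exact Or.inr ⟨hz.2.2, h⟩

lemma glue_pt {P : Type} (𝓕 : Filter P) (F : P → ℝ × ℝ → ℝ≥0∞) (b : P → ℝ≥0∞) (K : Set (ℝ × ℝ)) (hK : IsCompact K)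
    (h : ∀ z0 ∈ K, ∃ s ∈ 𝓝 z0, ∃ C < ∞, ∀ᶠ p in 𝓕, ∫⁻ z in s, F p z ≤ C * b p) :
    ∃ C < ∞, ∀ᶠ p in 𝓕, ∫⁻ z in K, F p z ≤ C * b p := by
  refine hK.induction_on (p := fun S => ∃ C < ∞, ∀ᶠ p in 𝓕, ∫⁻ z in S, F p z ≤ C * b p) ?_ ?_ ?_ ?_
  · exact ⟨0, by simp, by simp⟩
  · rintro s t hst ⟨C, hC, hh⟩
    exact ⟨C, hC, hh.mono fun p hp => le_trans (lintegral_mono_set hst) hp⟩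
  · rintro s t ⟨C, hC, hh⟩ ⟨C', hC', hh'⟩
    refine ⟨C + C', ENNReal.add_lt_top.2 ⟨hC, hC'⟩, ?_⟩
    filter_upwards [hh, hh'] with p h1 h2
    rw [add_mul]
    exact le_trans (lintegral_union_le _ _ _) (add_le_add h1 h2)
  · intro z hz
    obtain ⟨s, hs, C, hC, hh⟩ := h z hz
    exact ⟨s, mem_nhdsWithin_of_mem_nhds hs, C, hC, hh⟩

lemma glue_param {P : Type} [TopologicalSpace P] (Q b : P → ℝ≥0∞) (K : Set P) (hK : IsCompact K)
    (h : ∀ p0 ∈ K, ∃ C < ∞, ∀ᶠ p in 𝓝 p0, Q p ≤ C * b p) :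
    ∃ C < ∞, ∀ p ∈ K, Q p ≤ C * b p := by
  refine hK.induction_on (p := fun S => ∃ C < ∞, ∀ p ∈ S, Q p ≤ C * b p) ?_ ?_ ?_ ?_
  · exact ⟨0, by simp, by simp⟩
  · rintro s t hst ⟨C, hC, hh⟩
    exact ⟨C, hC, fun p hp => hh p (hst hp)⟩
  · rintro s t ⟨C, hC, hh⟩ ⟨C', hC', hh'⟩
    refine ⟨C + C', ENNReal.add_lt_top.2 ⟨hC, hC'⟩, ?_⟩
    rintro p (hp | hp)
    · exact (hh p hp).trans (by gcongr; exact le_self_add)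
    · exact (hh' p hp).trans (by gcongr; exact le_add_self)
  · intro p0 hp0
    obtain ⟨C, hC, hh⟩ := h p0 hp0
    exact ⟨_, mem_nhdsWithin_of_mem_nhds hh, C, hC, fun p hp => hp⟩

lemma fderiv_swap {g : ℝ × ℝ → ℝ} (hg : Differentiable ℝ g) (p v : ℝ × ℝ) :
    fderiv ℝ (fun z => g (z.2, z.1)) p v = fderiv ℝ g (p.2, p.1) (v.2, v.1) := by
  have h2 : HasFDerivAt (fun z : ℝ × ℝ => (z.2, z.1))
      ((ContinuousLinearMap.snd ℝ ℝ ℝ).prod (ContinuousLinearMap.fst ℝ ℝ ℝ)) p :=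
    hasFDerivAt_snd.prodMk hasFDerivAt_fst
  have := ((hg (p.2, p.1)).hasFDerivAt.comp p h2).fderiv
  have h3 : (g ∘ fun z : ℝ × ℝ => (z.2, z.1)) = fun z => g (z.2, z.1) := rfl
  rw [h3] at this
  rw [this]; simp

lemma norm_fderiv_swap {g : ℝ × ℝ → ℝ} (hg : Differentiable ℝ g) (p : ℝ × ℝ) :
    ‖fderiv ℝ g p.swap‖ ≤ ‖fderiv ℝ (fun z => g (z.2, z.1)) p‖ := by
  refine ContinuousLinearMap.opNorm_le_bound _ (norm_nonneg _) fun v => ?_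
  have := fderiv_swap hg p (v.2, v.1)
  have h2 : fderiv ℝ g p.swap v = fderiv ℝ (fun z => g (z.2, z.1)) p (v.2, v.1) := by rw [this]; rfl
  rw [h2]
  refine (ContinuousLinearMap.le_opNorm _ _).trans (le_of_eq ?_)
  congr 1
  rw [Prod.norm_def, Prod.norm_def, max_comm]

lemma swap_H4 (r : ℕ) (hr : 2 ≤ r) (e : ℝ × ℝ → ℝ) (he : ContDiff ℝ r e)
    (hH4 : ∀ k : ℝ × ℝ, e k = 0 → fderiv ℝ e k = 0 → HessCond e k) (k : ℝ × ℝ)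
    (h0 : e (k.2, k.1) = 0) (h1 : fderiv ℝ (fun z : ℝ × ℝ => e (z.2, z.1)) k = 0) :
    HessCond (fun z : ℝ × ℝ => e (z.2, z.1)) k := by
  have he2 : ContDiff ℝ 2 e := he.of_le (by exact_mod_cast hr)
  have hd : Differentiable ℝ e := he2.differentiable (by norm_num)
  have hz : fderiv ℝ e (k.2, k.1) = 0 := by
    have := norm_fderiv_swap hd k
    rw [h1, norm_zero] at this
    exact norm_le_zero_iff.1 this
  obtain ⟨μ₁, μ₂, p1, p2, hc⟩ := hH4 _ h0 hz
  have hh : ∀ u v : ℝ × ℝ, hess2 (fun z : ℝ × ℝ => e (z.2, z.1)) k u v = hess2 e (k.2, k.1) (u.2, u.1) (v.2, v.1) := by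
    intro u v
    unfold hess2
    have h3 : Differentiable ℝ (fun q => fderiv ℝ e q (u.2, u.1)) := by
      have : ContDiff ℝ 1 (fderiv ℝ e) := he2.fderiv_right (by norm_num)
      exact (this.differentiable (by norm_num)).clm_apply (differentiable_const _)
    rw [← fderiv_swap h3]
    simp only [fderiv_swap hd]
  refine ⟨μ₁, μ₂, p1, p2, ?_⟩
  rw [← hc, Matrix.charpoly_fin_two, Matrix.charpoly_fin_two]
  simp only [hh, Matrix.trace_fin_two, Matrix.det_fin_two, Matrix.of_apply, Matrix.cons_val', Matrix.cons_val_zero,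
    Matrix.cons_val_one, Matrix.cons_val_fin_one]
  rw [add_comm (hess2 e (k.2, k.1) (0, 1) (0, 1))]
  congr 2
  ring

lemma intA (r : ℕ) (hr : 3 ≤ r) (e : ℝ × ℝ → ℝ) (he : ContDiff ℝ r e)
    (hH4 : ∀ k : ℝ × ℝ, e k = 0 → fderiv ℝ e k = 0 → HessCond e k) (α : ℝ) (h0 : 0 < α) (h1 : α < 1)
    (R : ℝ) : ∫⁻ z in Metric.closedBall (0 : ℝ × ℝ) R, np α (e z) < ∞ := by
  have he' : ContDiff ℝ r (fun z : ℝ × ℝ => e (z.2, z.1)) := he.comp (contDiff_snd.prodMk contDiff_fst)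
  have key : ∃ C < ∞, ∀ᶠ _p : Unit in pure (), ∫⁻ z in Metric.closedBall (0 : ℝ × ℝ) R, np α (e z) ≤ C * 1 := by
    refine glue_pt (pure ()) (fun _ z => np α (e z)) (fun _ => 1) _ (isCompact_closedBall _ _) fun z0 _ => ?_
    by_cases hz0 : e z0 = 0
    · refine glue_ball _ _ _ z0 (fun y0 => ?_) (fun y0 => ?_)
      · obtain ⟨ρ, hρ, h⟩ := locA_cone r hr e he hH4 α h0 h1 z0 hz0 y0
        exact ⟨ρ, hρ, _, h, by simp⟩
      · obtain ⟨ρ, hρ, h⟩ := locA_cone r hr (fun z : ℝ × ℝ => e (z.2, z.1)) he' (swap_H4 r (by omega) e he hH4) α h0 h1 z0.swap hz0 y0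
        refine ⟨ρ, hρ, _, h, ?_⟩
        simp only [mul_one]
        exact Eventually.of_forall fun _ => le_rfl
    · have hc : 0 < |e z0| / 2 := by positivity
      have h3 : {z | |e z0| / 2 < |e z|} ∈ 𝓝 z0 :=
        (isOpen_lt continuous_const he.continuous.abs).mem_nhds (by simpa using hz0)
      refine ⟨_, inter_mem h3 (Metric.closedBall_mem_nhds z0 one_pos), np α (|e z0| / 2) * ENNReal.ofReal (4 * 1 ^ 2), ?_, Eventually.of_forall fun _ => ?_⟩
      · exact ENNReal.mul_lt_top (np_lt_top _ _ hc.ne') (by simp)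
      · rw [mul_one, ← volume_cb z0 1 (by norm_num)]
        refine le_trans (setLIntegral_mono' (g := fun _ => np α (|e z0| / 2)) ?_ ?_) ?_
        · exact ((isOpen_lt continuous_const he.continuous.abs).measurableSet).inter measurableSet_closedBall
        · intro z hz
          refine np_le _ _ _ h0.le ?_
          rw [abs_of_pos hc]
          exact hz.1.le
        · rw [setLIntegral_const]
          gcongr
          exact inter_subset_right
  obtain ⟨C, hC, h⟩ := key
  simp only [mul_one] at h
  have h := eventually_pure.1 h
  exact h.trans_lt hC

lemma JI_swap (e : ℝ × ℝ → ℝ) (he : Differentiable ℝ e) (γ β l : ℝ) (ω z : ℝ × ℝ) :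
    JI e γ β l ω z.swap ≤ JI (fun z : ℝ × ℝ => e (z.2, z.1)) γ β l ω.swap z := by
  unfold JI
  have h1 : z.swap - l • ω = ((z - l • ω.swap).2, (z - l • ω.swap).1) := by ext <;> simp
  rw [h1]
  have := norm_fderiv_swap he z
  have h2 : z.swap = (z.2, z.1) := rfl
  rw [h2] at this ⊢
  gcongr

lemma intI (n₀ r : ℕ) (hn₀ : 3 ≤ n₀) (hr : 2 * n₀ + 1 ≤ r)
    (e : ℝ × ℝ → ℝ) (he : ContDiff ℝ r e)
    (hH4 : ∀ k : ℝ × ℝ, e k = 0 → fderiv ℝ e k = 0 → HessCond e k)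
    (hH5 : NonFlatCond e r n₀) (hH6 : NoNestingCond e r n₀)
    (γ β : ℝ) (hγ : 0 < γ) (hγ1 : γ < 1) (hβ : 0 < β)
    (hβn : β * n₀ < 1) (hs1 : 1 ≤ γ + β) (hs2 : γ + β < 3 / 2) (R L : ℝ) :
    ∃ C < ∞, ∀ v : ℝ × ℝ, v ≠ 0 → ‖v‖ ≤ L →
      ∫⁻ z in Metric.closedBall (0 : ℝ × ℝ) R, ENNReal.ofReal ‖fderiv ℝ e z‖ * np γ (e z) *
        np β (max |e z| |e (z - v)|) ≤ C * (1 + np β ‖v‖) := by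
  have he' : ContDiff ℝ r (fun z : ℝ × ℝ => e (z.2, z.1)) := he.comp (contDiff_snd.prodMk contDiff_fst)
  have he1 : ContDiff ℝ 1 e := he.of_le (by exact_mod_cast (by omega : 1 ≤ r))
  have hd : Differentiable ℝ e := he1.differentiable (by norm_num)
  have hcd : Continuous (fderiv ℝ e) := he1.continuous_fderiv (by norm_num)
  have key : ∃ C < ∞, ∀ p ∈ (Icc 0 L ×ˢ Metric.sphere (0 : ℝ × ℝ) 1 : Set (ℝ × (ℝ × ℝ))),
      ∫⁻ z in Metric.closedBall (0 : ℝ × ℝ) R, JI e γ β p.1 p.2 z ≤ C * (1 + np β p.1) := by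
    refine glue_param (fun p : ℝ × (ℝ × ℝ) => ∫⁻ z in Metric.closedBall (0 : ℝ × ℝ) R, JI e γ β p.1 p.2 z)
      (fun p => 1 + np β p.1) _ (isCompact_Icc.prod (isCompact_sphere _ _)) ?_
    rintro ⟨l0, ω0⟩ ⟨-, hω⟩
    have hω0 : ω0 ≠ 0 := by
      rintro rfl
      simp at hω
    refine glue_pt (𝓝 (l0, ω0)) (fun p z => JI e γ β p.1 p.2 z) (fun p => 1 + np β p.1) _ (isCompact_closedBall _ _) fun z0 _ => ?_
    by_cases hz0 : e z0 = 0
    · refine glue_ball _ _ _ z0 (fun y0 => ?_) (fun y0 => ?_)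
      · exact locI_cone n₀ r hn₀ hr e he hH4 (NF1_of e r n₀ hH5) (NN1_of e r n₀ hH6) γ β hγ hγ1 hβ hβn hs1 hs2 z0 hz0 l0 ω0 hω0 y0
      · obtain ⟨ρ, hρ, C, hC, h⟩ := locI_cone n₀ r hn₀ hr (fun z : ℝ × ℝ => e (z.2, z.1)) he' (swap_H4 r (by omega) e he hH4)
          (NF1_swap_of e r n₀ hH5) (NN1_swap_of e r n₀ hH6) γ β hγ hγ1 hβ hβn hs1 hs2 z0.swap hz0 l0 ω0.swap
            (by intro h; apply hω0; rw [← Prod.swap_swap ω0, h]; rfl) y0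
        refine ⟨ρ, hρ, C, hC, ?_⟩
        have ht : Tendsto (fun p : ℝ × (ℝ × ℝ) => (p.1, p.2.swap)) (𝓝 (l0, ω0)) (𝓝 (l0, ω0.swap)) := by
          have : Continuous (fun p : ℝ × (ℝ × ℝ) => (p.1, p.2.swap)) := by fun_prop
          exact this.tendsto (l0, ω0)
        filter_upwards [ht.eventually h] with p hp
        refine le_trans (lintegral_mono fun z => ?_) hp
        exact JI_swap e hd γ β p.1 p.2 z
    · have hc : 0 < |e z0| / 2 := by positivity
      have h3 : IsOpen {z | |e z0| / 2 < |e z|} := isOpen_lt continuous_const he.continuous.abs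
      have h4 : IsOpen {z | ‖fderiv ℝ e z‖ < ‖fderiv ℝ e z0‖ + 1} := isOpen_lt hcd.norm continuous_const
      have m3 : {z | |e z0| / 2 < |e z|} ∈ 𝓝 z0 := h3.mem_nhds (by simpa using hz0)
      have m4 : {z | ‖fderiv ℝ e z‖ < ‖fderiv ℝ e z0‖ + 1} ∈ 𝓝 z0 := h4.mem_nhds (by simp)
      set D := ENNReal.ofReal (‖fderiv ℝ e z0‖ + 1) * np γ (|e z0| / 2) * np β (|e z0| / 2) with hD
      refine ⟨_, inter_mem (inter_mem m3 m4) (Metric.closedBall_mem_nhds z0 one_pos), D * ENNReal.ofReal (4 * 1 ^ 2), ?_, Eventually.of_forall fun p => ?_⟩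
      · exact ENNReal.mul_lt_top (ENNReal.mul_lt_top (ENNReal.mul_lt_top (by simp) (np_lt_top _ _ hc.ne')) (np_lt_top _ _ hc.ne')) (by simp)
      · rw [← volume_cb z0 1 (by norm_num)]
        refine le_trans ?_ (le_mul_of_one_le_right (zero_le) (le_self_add))
        refine le_trans (setLIntegral_mono' (g := fun _ => D) ?_ ?_) ?_
        · exact (h3.measurableSet.inter h4.measurableSet).inter measurableSet_closedBall
        · intro z hz
          rw [hD]
          unfold JI
          gcongr
          · exact hz.1.2.le
          · refine np_le _ _ _ hγ.le ?_
            rw [abs_of_pos hc]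
            exact hz.1.1.le
          · refine np_le _ _ _ hβ.le ?_
            rw [abs_of_pos hc]
            exact hz.1.1.le.trans ((le_max_left _ _).trans (le_abs_self _))
        · rw [setLIntegral_const]
          gcongr
          exact inter_subset_right
  obtain ⟨C, hC, h⟩ := key
  refine ⟨C, hC, fun v hv hvL => ?_⟩
  have hv' : ‖v‖ ≠ 0 := norm_ne_zero_iff.2 hv
  have := h (‖v‖, ‖v‖⁻¹ • v) ⟨⟨norm_nonneg _, hvL⟩, by simp [norm_smul, hv']⟩
  simp only [JI] at this
  have e1 : ‖v‖ • ‖v‖⁻¹ • v = v := by rw [smul_smul, mul_inv_cancel₀ hv', one_smul]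
  rw [e1] at this
  exact this

lemma np_add' (a b x : ℝ) (ha : 0 < a) (hb : 0 < b) : np (a + b) x = np a x * np b x := by
  by_cases hx : x = 0
  · rw [hx, np_zero _ ha, np_zero _ hb, np_zero _ (by linarith)]; simp
  · exact np_add a b x hx

lemma np_rpow (s t x : ℝ) : (np s x) ^ t = np (s * t) x := by
  unfold np
  rw [← ENNReal.rpow_mul]; congr 1; ring

lemma np_meas_comp {α : Type} [MeasurableSpace α] (s : ℝ) {f : α → ℝ} (hf : Measurable f) :
    Measurable fun a => np s (f a) := (np_measurable s).comp hf

/-- simple Young inequality -/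
lemma youngE (a b : ℝ≥0∞) (θ : ℝ) (h0 : 0 < θ) (h1 : θ < 1) :
    a * b ≤ a ^ (1 / θ) + b ^ (1 / (1 - θ)) := by
  have h : Real.HolderConjugate (1 / θ) (1 / (1 - θ)) := by
    rw [Real.holderConjugate_iff]
    refine ⟨by rw [lt_div_iff₀ h0]; linarith, ?_⟩
    simp
  refine (ENNReal.young_inequality a b h).trans (add_le_add ?_ ?_)
  · refine ENNReal.div_le_of_le_mul ?_
    refine le_mul_of_one_le_right (zero_le) ?_
    rw [ENNReal.one_le_ofReal, le_div_iff₀ h0]; linarith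
  · refine ENNReal.div_le_of_le_mul ?_
    refine le_mul_of_one_le_right (zero_le) ?_
    rw [ENNReal.one_le_ofReal, le_div_iff₀ (by linarith)]; linarith

lemma int_pole (τ R : ℝ) (h0 : 0 < τ) (h2 : τ < 2) (hR : 0 ≤ R) :
    ∃ B < ∞, ∀ q : ℝ × ℝ, ∫⁻ x in Metric.closedBall (0 : ℝ × ℝ) R, np τ ‖x - q‖ ≤ B := by
  obtain ⟨B, hB, h⟩ := lint_of_sublevel (4 * R ^ 2) 4 2 τ h0 h2
  refine ⟨B, hB, fun q => h (volume.restrict _) (fun x => ‖x - q‖) (by fun_prop) ?_ ?_⟩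
  · rw [Measure.restrict_apply_univ, volume_cb 0 R hR]
  · intro ε hε
    refine (Measure.restrict_apply_le _ _).trans ?_
    rw [Real.rpow_two, ← volume_cb q ε hε.le]
    refine measure_mono fun z hz => ?_
    simpa [dist_eq_norm] using hz

/-- spatial integrand -/
noncomputable def Ph (e : ℝ × ℝ → ℝ) (δ σ : ℝ) (q x y : ℝ × ℝ) : ℝ≥0∞ :=
  np (1 - 7 * δ) (e x) * (np δ (e y) * (ENNReal.ofReal ‖fderiv ℝ e (y + σ • (x - q))‖ *
    np (1 - 3 * δ) (e (y + σ • (x - q))) * np (11 * δ) (max |e (y + σ • (x - q))| |e y|)))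

lemma Ph_meas (e : ℝ × ℝ → ℝ) (he : ContDiff ℝ 1 e) (δ σ : ℝ) (q : ℝ × ℝ) :
    Measurable fun p : (ℝ × ℝ) × (ℝ × ℝ) => Ph e δ σ q p.1 p.2 := by
  have hcd : Continuous (fderiv ℝ e) := he.continuous_fderiv (by norm_num)
  have hc := he.continuous
  unfold Ph
  have m1 := np_meas_comp (1 - 7 * δ) (f := fun p : (ℝ × ℝ) × (ℝ × ℝ) => e p.1) (by fun_prop)
  have m2 := np_meas_comp δ (f := fun p : (ℝ × ℝ) × (ℝ × ℝ) => e p.2) (by fun_prop)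
  have m3 := np_meas_comp (1 - 3 * δ) (f := fun p : (ℝ × ℝ) × (ℝ × ℝ) => e (p.2 + σ • (p.1 - q))) (by fun_prop)
  have m4 := np_meas_comp (11 * δ) (f := fun p : (ℝ × ℝ) × (ℝ × ℝ) => max |e (p.2 + σ • (p.1 - q))| |e p.2|) (by fun_prop)
  have m5 : Measurable fun p : (ℝ × ℝ) × (ℝ × ℝ) => ENNReal.ofReal ‖fderiv ℝ e (p.2 + σ • (p.1 - q))‖ := by
    have : Continuous fun p : (ℝ × ℝ) × (ℝ × ℝ) => ‖fderiv ℝ e (p.2 + σ • (p.1 - q))‖ := by fun_prop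
    exact this.measurable.ennreal_ofReal
  exact m1.mul (m2.mul ((m5.mul m3).mul m4))

lemma spatial (n₀ r : ℕ) (hn₀ : 3 ≤ n₀) (hr : 2 * n₀ + 1 ≤ r)
    (e : ℝ × ℝ → ℝ) (he : ContDiff ℝ r e)
    (hH4 : ∀ k : ℝ × ℝ, e k = 0 → fderiv ℝ e k = 0 → HessCond e k)
    (hH5 : NonFlatCond e r n₀) (hH6 : NoNestingCond e r n₀)
    (δ : ℝ) (hδ : δ = 1 / (20 * n₀)) (σ : ℝ) (hσ : |σ| = 1) (R Q : ℝ) (hR : 0 ≤ R) (hQ : 0 ≤ Q) :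
    ∃ C < ∞, ∀ q : ℝ × ℝ, ‖q‖ ≤ Q →
      ∫⁻ x in Metric.closedBall (0 : ℝ × ℝ) R, ∫⁻ y in Metric.closedBall (0 : ℝ × ℝ) R, Ph e δ σ q x y ≤ C := by
  have hN : (3:ℝ) ≤ n₀ := by exact_mod_cast hn₀
  have hδ0 : 0 < δ := by rw [hδ]; positivity
  have hδN : δ * n₀ = 1 / 20 := by rw [hδ]; field_simp
  have hδ1 : δ ≤ 1 / 60 := by nlinarith
  have he1 : ContDiff ℝ 1 e := he.of_le (by exact_mod_cast (by omega : 1 ≤ r))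
  have hcd : Continuous (fderiv ℝ e) := he1.continuous_fderiv (by norm_num)
  have hec := he1.continuous
  set κ := 1 / (1 - 2 * δ) with hκ
  have hpos : 0 < 1 - 2 * δ := by linarith
  have hκ0 : 0 < κ := by positivity
  have hκ1 : κ * (1 - 2 * δ) = 1 := by rw [hκ]; field_simp
  have hκ2 : 1 ≤ κ := by nlinarith
  have hκ3 : κ ≤ 30 / 29 := by nlinarith
  set γ := (1 - 3 * δ) * κ with hγ
  set β := (11 * δ) * κ with hβ
  have hγ0 : 0 < γ := by apply mul_pos _ hκ0; linarith
  have hβ0 : 0 < β := by positivity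
  have hγ1 : γ < 1 := by nlinarith
  have hβn : β * n₀ < 1 := by
    have : β * n₀ = 11 * κ * (δ * n₀) := by rw [hβ]; ring
    rw [this, hδN]; linarith
  have hs : γ + β = 1 + 10 * δ * κ := by rw [hγ, hβ]; linarith [hκ1]
  have hs1 : 1 ≤ γ + β := by rw [hs]; have : 0 < δ * κ := by positivity
                             linarith
  have hs2 : γ + β < 3 / 2 := by rw [hs]; nlinarith
  set L := R + Q with hL
  obtain ⟨C2, hC2, hI⟩ := intI n₀ r hn₀ hr e he hH4 hH5 hH6 γ β hγ0 hγ1 hβ0 hβn hs1 hs2 (R + L) L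
  have hC1 := intA r (by omega) e he hH4 (1 / 2) (by norm_num) (by norm_num) R
  set C1 := ∫⁻ z in Metric.closedBall (0 : ℝ × ℝ) R, np (1 / 2) (e z)
  obtain ⟨K, hK⟩ := (isCompact_closedBall (0 : ℝ × ℝ) (R + L)).exists_bound_of_continuousOn hcd.continuousOn
  set K' : ℝ := max K 0
  have hK' : ∀ z ∈ Metric.closedBall (0 : ℝ × ℝ) (R + L), ‖fderiv ℝ e z‖ ≤ K' := fun z hz => (hK z hz).trans (le_max_left _ _)
  set D := (ENNReal.ofReal K') ^ (κ - 1) with hD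
  have hDt : D < ∞ := (ENNReal.rpow_ne_top_of_nonneg (by linarith) (by simp)).lt_top
  -- inner integral
  have inner : ∀ q : ℝ × ℝ, ‖q‖ ≤ Q → ∀ x ∈ Metric.closedBall (0 : ℝ × ℝ) R, x ≠ q →
      ∫⁻ y in Metric.closedBall (0 : ℝ × ℝ) R, Ph e δ σ q x y ≤
        np (1 - 7 * δ) (e x) * (C1 + D * (C2 * (1 + np β ‖x - q‖))) := by
    intro q hq x hx hxq
    set v := σ • (x - q) with hv
    have hvn : ‖v‖ = ‖x - q‖ := by rw [hv, norm_smul, Real.norm_eq_abs, hσ, one_mul]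
    have hxR : ‖x‖ ≤ R := by simpa using hx
    have hvL : ‖v‖ ≤ L := by rw [hvn]; exact (norm_sub_le _ _).trans (by linarith)
    have hv0 : v ≠ 0 := by
      rw [← norm_ne_zero_iff, hvn, norm_ne_zero_iff, sub_ne_zero]; exact hxq
    have h1 := hI v hv0 hvL
    rw [hvn] at h1
    have mm : Measurable fun y => Ph e δ σ q x y := (Ph_meas e he1 δ σ q).comp (measurable_const.prodMk measurable_id)
    calc ∫⁻ y in Metric.closedBall (0 : ℝ × ℝ) R, Ph e δ σ q x y
        ≤ ∫⁻ y in Metric.closedBall (0 : ℝ × ℝ) R, np (1 - 7 * δ) (e x) * (np (1 / 2) (e y) +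
            D * (ENNReal.ofReal ‖fderiv ℝ e (y + v)‖ * np γ (e (y + v)) * np β (max |e (y + v)| |e (y + v - v)|))) := by
          refine setLIntegral_mono' measurableSet_closedBall fun y hy => ?_
          unfold Ph
          rw [← hv]
          have hy' : ‖y‖ ≤ R := by simpa using hy
          gcongr
          refine (youngE _ _ (2 * δ) (by linarith) (by linarith)).trans (add_le_add (le_of_eq ?_) ?_)
          · rw [np_rpow]; congr 1; field_simp
          · rw [← hκ, ENNReal.mul_rpow_of_nonneg _ _ hκ0.le, ENNReal.mul_rpow_of_nonneg _ _ hκ0.le, np_rpow, np_rpow,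
              ← hγ, ← hβ, add_sub_cancel_right]
            rw [← mul_assoc, ← mul_assoc]
            gcongr
            have h5 : κ = (κ - 1) + 1 := by ring
            have h6 := hK' (y + v) (by
              rw [mem_closedBall_zero_iff]; exact (norm_add_le _ _).trans (by linarith))
            calc ENNReal.ofReal ‖fderiv ℝ e (y + v)‖ ^ κ
                = ENNReal.ofReal ‖fderiv ℝ e (y + v)‖ ^ (κ - 1) * ENNReal.ofReal ‖fderiv ℝ e (y + v)‖ := by
                  conv_lhs => rw [h5]
                  rw [ENNReal.rpow_add_of_nonneg _ _ (by linarith) (by norm_num), ENNReal.rpow_one]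
              _ ≤ _ := by
                  rw [hD]
                  gcongr
      _ = np (1 - 7 * δ) (e x) * (C1 + D * ∫⁻ y in Metric.closedBall (0 : ℝ × ℝ) R,
            (ENNReal.ofReal ‖fderiv ℝ e (y + v)‖ * np γ (e (y + v)) * np β (max |e (y + v)| |e (y + v - v)|))) := by
          have m1 := np_meas_comp (1 / 2) (f := fun y : ℝ × ℝ => e y) (by fun_prop)
          have m3 := np_meas_comp γ (f := fun y : ℝ × ℝ => e (y + v)) (by fun_prop)
          have m4 := np_meas_comp β (f := fun y : ℝ × ℝ => max |e (y + v)| |e (y + v - v)|) (by fun_prop)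
          have m5 : Measurable fun y : ℝ × ℝ => ENNReal.ofReal ‖fderiv ℝ e (y + v)‖ := by
            have : Continuous fun y : ℝ × ℝ => ‖fderiv ℝ e (y + v)‖ := by fun_prop
            exact this.measurable.ennreal_ofReal
          have m6 : Measurable fun y : ℝ × ℝ => ENNReal.ofReal ‖fderiv ℝ e (y + v)‖ * np γ (e (y + v)) *
              np β (max |e (y + v)| |e (y + v - v)|) := (m5.mul m3).mul m4
          have m7 : Measurable fun y : ℝ × ℝ => np (1 / 2) (e y) + D * (ENNReal.ofReal ‖fderiv ℝ e (y + v)‖ * np γ (e (y + v)) *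
              np β (max |e (y + v)| |e (y + v - v)|)) := m1.add (m6.const_mul D)
          rw [lintegral_const_mul _ m7, lintegral_add_left m1, lintegral_const_mul _ m6]
      _ ≤ _ := by
          gcongr
          refine le_trans ?_ h1
          have := (measurePreserving_add_right (volume : Measure (ℝ × ℝ)) v).setLIntegral_comp_preimage_emb
            (measurableEmbedding_addRight v) (fun z => ENNReal.ofReal ‖fderiv ℝ e z‖ * np γ (e z) * np β (max |e z| |e (z - v)|))
            (Metric.closedBall 0 (R + L))
          rw [← this]
          refine lintegral_mono_set fun y hy => ?_
          have hy' : ‖y‖ ≤ R := by simpa using hy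
          rw [mem_preimage, mem_closedBall_zero_iff]
          exact (norm_add_le _ _).trans (by linarith)
  -- outer integral
  have hA := intA r (by omega) e he hH4 (1 - 7 * δ) (by linarith) (by linarith) R
  set θ := (13 / 2) * δ with hθ
  have hθ0 : 0 < θ := by positivity
  have hθ1 : θ < 1 := by rw [hθ]; linarith
  have hA' := intA r (by omega) e he hH4 ((1 - 7 * δ) * (1 / (1 - θ))) (by
      apply mul_pos; linarith; apply one_div_pos.2; linarith) (by
      rw [mul_one_div, div_lt_one (by linarith)]; rw [hθ]; linarith) R
  obtain ⟨B, hB, hpole⟩ := int_pole (β * (1 / θ)) R (by positivity) (by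
      have : β * (1 / θ) = 22 / 13 * κ := by rw [hβ, hθ]; field_simp; ring
      rw [this]; linarith) hR
  set A1 := ∫⁻ z in Metric.closedBall (0 : ℝ × ℝ) R, np (1 - 7 * δ) (e z)
  set A2 := ∫⁻ z in Metric.closedBall (0 : ℝ × ℝ) R, np ((1 - 7 * δ) * (1 / (1 - θ))) (e z)
  refine ⟨(C1 + D * C2) * A1 + D * C2 * (B + A2), ?_, fun q hq => ?_⟩
  · simp only [ENNReal.add_lt_top, ENNReal.mul_lt_top_iff]
    refine ⟨Or.inl ⟨⟨hC1, Or.inl ⟨hDt, hC2⟩⟩, hA⟩, Or.inl ⟨Or.inl ⟨hDt, hC2⟩, hB, hA'⟩⟩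
  · have m1 := np_meas_comp (1 - 7 * δ) (f := fun y : ℝ × ℝ => e y) (by fun_prop)
    have m2 := np_meas_comp (β * (1 / θ)) (f := fun x : ℝ × ℝ => ‖x - q‖) (by fun_prop)
    have m3 := np_meas_comp ((1 - 7 * δ) * (1 / (1 - θ))) (f := fun y : ℝ × ℝ => e y) (by fun_prop)
    calc ∫⁻ x in Metric.closedBall (0 : ℝ × ℝ) R, ∫⁻ y in Metric.closedBall (0 : ℝ × ℝ) R, Ph e δ σ q x y
        ≤ ∫⁻ x in Metric.closedBall (0 : ℝ × ℝ) R, ((C1 + D * C2) * np (1 - 7 * δ) (e x) +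
            D * C2 * (np (β * (1 / θ)) ‖x - q‖ + np ((1 - 7 * δ) * (1 / (1 - θ))) (e x))) := by
          have hae : ∀ᵐ x ∂(volume.restrict (Metric.closedBall (0 : ℝ × ℝ) R)), x ≠ q := by
            refine ae_restrict_of_ae ?_
            simp [ae_iff]
          refine lintegral_mono_ae ?_
          filter_upwards [hae, ae_restrict_mem measurableSet_closedBall] with x hxq hx
          refine (inner q hq x hx hxq).trans ?_
          have hY := youngE (np β ‖x - q‖) (np (1 - 7 * δ) (e x)) θ hθ0 hθ1
          rw [np_rpow, np_rpow] at hY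
          calc np (1 - 7 * δ) (e x) * (C1 + D * (C2 * (1 + np β ‖x - q‖)))
              = (C1 + D * C2) * np (1 - 7 * δ) (e x) + D * C2 * (np β ‖x - q‖ * np (1 - 7 * δ) (e x)) := by ring
            _ ≤ _ := by gcongr
      _ = (C1 + D * C2) * A1 + D * C2 * ((∫⁻ x in Metric.closedBall (0 : ℝ × ℝ) R, np (β * (1 / θ)) ‖x - q‖) + A2) := by
          have m4 : Measurable fun x : ℝ × ℝ => np (β * (1 / θ)) ‖x - q‖ + np ((1 - 7 * δ) * (1 / (1 - θ))) (e x) := m2.add m3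
          rw [lintegral_add_left (m1.const_mul _), lintegral_const_mul _ m1, lintegral_const_mul _ m4,
            lintegral_add_left m2]
      _ ≤ _ := by gcongr; exact hpole q

lemma np_one (s d : ℝ) (hd : 0 < d) : np s d = ENNReal.ofReal (d ^ (-s)) := by
  unfold np
  rw [abs_of_pos hd, ENNReal.ofReal_rpow_of_pos hd]

lemma ptw (δ x0 y0 a b c gz d1 d2 s : ℝ) (hδ : 0 < δ) (hδ1 : δ ≤ 1 / 60) (hg : 0 ≤ gz)
    (h1 : 0 < d1) (h2 : 0 < d2) (hs : 0 < s) (hx0 : |x0| ≤ d1) (hy0 : |y0| ≤ d2) (ha : |a| ≤ d1) (hb : |b| ≤ d2)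
    (has : |a| ≤ s) (hbs : |b| ≤ s) (hcs : |c| ≤ s) :
    ENNReal.ofReal (1 / (d1 * d2) * (gz / s ^ 2 + 1 / s)) ≤
      np (1 - δ) x0 * np (1 - δ) y0 * (np (1 - 7 * δ) a * (np δ b * (ENNReal.ofReal gz * np (1 - 3 * δ) c *
        np (11 * δ) (max |c| |b|))) + np (1 / 2 + δ) a * np (1 / 2 + δ) b) := by
  have hle : ∀ (t u d : ℝ), 0 ≤ t → 0 < d → |u| ≤ d → np t d ≤ np t u := fun t u d ht hd hu =>
    np_le _ _ _ ht (by rwa [abs_of_pos hd])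
  have e1 : ENNReal.ofReal (1 / (d1 * d2) * (gz / s ^ 2 + 1 / s)) =
      np 1 d1 * np 1 d2 * (ENNReal.ofReal gz * np 2 s + np 1 s) := by
    rw [np_one _ _ h1, np_one _ _ h2, np_one _ _ hs, np_one _ _ hs, ← ENNReal.ofReal_mul (by positivity),
      ← ENNReal.ofReal_mul (by positivity), ← ENNReal.ofReal_add (by positivity) (by positivity),
      ← ENNReal.ofReal_mul (by positivity)]
    congr 1
    rw [Real.rpow_neg_one, Real.rpow_neg_one, Real.rpow_neg_one, Real.rpow_neg hs.le, Real.rpow_two]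
    field_simp
  have e2 : np 1 d1 = np (1 - δ) d1 * np δ d1 := by rw [← np_add' _ _ _ (by linarith) hδ]; congr 1; ring
  have e3 : np 1 d2 = np (1 - δ) d2 * np δ d2 := by rw [← np_add' _ _ _ (by linarith) hδ]; congr 1; ring
  have e4 : np 2 s = np (1 - 8 * δ) s * np (1 - 3 * δ) s * np (11 * δ) s := by
    rw [← np_add' _ _ _ (by linarith) (by linarith), ← np_add' _ _ _ (by linarith) (by linarith)]; congr 1; ring
  have e5 : np 1 s = np (1 / 2) s * np (1 / 2) s := by
    rw [← np_add' _ _ _ (by linarith) (by linarith)]; congr 1; ring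
  have e6 : np (1 - 7 * δ) a = np (1 - 8 * δ) a * np δ a := by
    rw [← np_add' _ _ _ (by linarith) hδ]; congr 1; ring
  rw [e1, e2, e3, e4, e5, e6, np_add' (1/2) δ a (by norm_num) hδ, np_add' (1/2) δ b (by norm_num) hδ]
  calc np (1 - δ) d1 * np δ d1 * (np (1 - δ) d2 * np δ d2) *
        (ENNReal.ofReal gz * (np (1 - 8 * δ) s * np (1 - 3 * δ) s * np (11 * δ) s) + np (1 / 2) s * np (1 / 2) s)
      ≤ np (1 - δ) x0 * np δ a * (np (1 - δ) y0 * np δ b) *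
        (ENNReal.ofReal gz * (np (1 - 8 * δ) a * np (1 - 3 * δ) c * np (11 * δ) (max |c| |b|)) + np (1 / 2) a * np (1 / 2) b) := by
        have hm : abs (max |c| |b|) ≤ s := by rw [abs_of_nonneg (le_max_of_le_left (abs_nonneg _))]; exact max_le hcs hbs
        gcongr
        · exact hle _ _ _ (by linarith) h1 hx0
        · exact hle _ _ _ (by linarith) h1 ha
        · exact hle _ _ _ (by linarith) h2 hy0
        · exact hle _ _ _ (by linarith) h2 hb
        · exact hle _ _ _ (by linarith) hs has
        · exact hle _ _ _ (by linarith) hs hcs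
        · exact hle _ _ _ (by linarith) hs hm
        · exact hle _ _ _ (by norm_num) hs has
        · exact hle _ _ _ (by norm_num) hs hbs
    _ = _ := by ring

abbrev E4 := ℝ × (ℝ × ℝ)

noncomputable def fR (δ R : ℝ) : ℝ → ℝ≥0∞ := (Icc (-R) R).indicator (np (1 - δ))

noncomputable def Ph2 (e : ℝ × ℝ → ℝ) (δ σ R : ℝ) (q : ℝ × ℝ) : (ℝ × ℝ) × (ℝ × ℝ) → ℝ≥0∞ :=
  (Metric.closedBall 0 R ×ˢ Metric.closedBall 0 R).indicator
    (fun p => Ph e δ σ q p.1 p.2 + np (1 / 2 + δ) (e p.1) * np (1 / 2 + δ) (e p.2))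

noncomputable def Gm (e : ℝ × ℝ → ℝ) (δ σ R : ℝ) (q : ℝ × ℝ) (a : E4 × E4) : ℝ≥0∞ :=
  fR δ R a.1.1 * fR δ R a.2.1 * Ph2 e δ σ R q (a.1.2, a.2.2)

def Tn (n : ℕ) : Set (E4 × E4) := {a | 1 / ((n : ℝ) + 1) < |a.1.1| ∧ 1 / ((n : ℝ) + 1) < |a.2.1|}

lemma Tn_meas (n : ℕ) : MeasurableSet (Tn n) := by
  have h1 : MeasurableSet {a : E4 × E4 | 1 / ((n : ℝ) + 1) < |a.1.1|} := measurableSet_lt (by fun_prop) (by fun_prop)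
  have h2 : MeasurableSet {a : E4 × E4 | 1 / ((n : ℝ) + 1) < |a.2.1|} := measurableSet_lt (by fun_prop) (by fun_prop)
  exact h1.inter h2

lemma prodint (f g : ℝ → ℝ≥0∞) (hf : Measurable f) (hg : Measurable g) (P : (ℝ × ℝ) × (ℝ × ℝ) → ℝ≥0∞) (hP : Measurable P) :
    ∫⁻ a : E4 × E4, f a.1.1 * g a.2.1 * P (a.1.2, a.2.2) = (∫⁻ t, f t) * (∫⁻ t, g t) * ∫⁻ x, ∫⁻ y, P (x, y) := by
  have hm : Measurable fun a : E4 × E4 => f a.1.1 * g a.2.1 * P (a.1.2, a.2.2) := by fun_prop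
  have hi : ∀ a : E4, ∫⁻ b : E4, f a.1 * g b.1 * P (a.2, b.2) = f a.1 * ((∫⁻ t, g t) * ∫⁻ y, P (a.2, y)) := by
    intro a
    have hP' : Measurable fun y => P (a.2, y) := by fun_prop
    have : ∀ b : E4, f a.1 * g b.1 * P (a.2, b.2) = f a.1 * (g b.1 * P (a.2, b.2)) := fun b => by ring
    simp only [this]
    rw [lintegral_const_mul _ (by fun_prop), Measure.volume_eq_prod ℝ (ℝ × ℝ)]
    congr 1
    exact lintegral_prod_mul hg.aemeasurable hP'.aemeasurable
  rw [Measure.volume_eq_prod E4 E4, lintegral_prod _ hm.aemeasurable]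
  simp only [hi]
  have hP2 : Measurable fun x => ∫⁻ y, P (x, y) := hP.lintegral_prod_right'
  rw [Measure.volume_eq_prod ℝ (ℝ × ℝ)]
  rw [lintegral_prod_mul (g := fun x => (∫⁻ t, g t) * ∫⁻ y, P (x, y)) hf.aemeasurable (hP2.const_mul _).aemeasurable,
    lintegral_const_mul _ hP2, mul_assoc]

lemma fR_meas (δ R : ℝ) : Measurable (fR δ R) := (np_measurable _).indicator measurableSet_Icc

lemma Ph2_meas (e : ℝ × ℝ → ℝ) (he : ContDiff ℝ 1 e) (δ σ R : ℝ) (q : ℝ × ℝ) : Measurable (Ph2 e δ σ R q) := by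
  have hc := he.continuous
  refine Measurable.indicator ?_ (measurableSet_closedBall.prod measurableSet_closedBall)
  have m1 := np_meas_comp (1 / 2 + δ) (f := fun p : (ℝ × ℝ) × (ℝ × ℝ) => e p.1) (by fun_prop)
  have m2 := np_meas_comp (1 / 2 + δ) (f := fun p : (ℝ × ℝ) × (ℝ × ℝ) => e p.2) (by fun_prop)
  exact (Ph_meas e he δ σ q).add (m1.mul m2)

lemma mass (n₀ r : ℕ) (hn₀ : 3 ≤ n₀) (hr : 2 * n₀ + 1 ≤ r)
    (e : ℝ × ℝ → ℝ) (he : ContDiff ℝ r e)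
    (hH4 : ∀ k : ℝ × ℝ, e k = 0 → fderiv ℝ e k = 0 → HessCond e k)
    (hH5 : NonFlatCond e r n₀) (hH6 : NoNestingCond e r n₀)
    (δ : ℝ) (hδ : δ = 1 / (20 * n₀)) (σ : ℝ) (hσ : |σ| = 1) (R Q : ℝ) (hR : 0 ≤ R) (hQ : 0 ≤ Q) :
    ∃ C < ∞, ∃ η : ℕ → ℝ≥0∞, Tendsto η atTop (𝓝 0) ∧ ∀ q : ℝ × ℝ, ‖q‖ ≤ Q →
      ∫⁻ a, Gm e δ σ R q a ≤ C ∧ ∀ n, ∫⁻ a in (Tn n)ᶜ, Gm e δ σ R q a ≤ η n := by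
  have hN : (3:ℝ) ≤ n₀ := by exact_mod_cast hn₀
  have hδ0 : 0 < δ := by rw [hδ]; positivity
  have hδN : δ * n₀ = 1 / 20 := by rw [hδ]; field_simp
  have hδ1 : δ ≤ 1 / 60 := by nlinarith
  have he1 : ContDiff ℝ 1 e := he.of_le (by exact_mod_cast (by omega : 1 ≤ r))
  have hec := he1.continuous
  obtain ⟨C1, hC1, h1⟩ := spatial n₀ r hn₀ hr e he hH4 hH5 hH6 δ hδ σ hσ R Q hR hQ
  have hA := intA r (by omega) e he hH4 (1 / 2 + δ) (by linarith) (by linarith) R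
  set A := ∫⁻ z in Metric.closedBall (0 : ℝ × ℝ) R, np (1 / 2 + δ) (e z)
  have hw : ∫⁻ t, fR δ R t < ∞ := by
    unfold fR
    rw [lintegral_indicator measurableSet_Icc]
    refine lt_of_le_of_lt (lintegral_mono_set ?_) (lint_1d (1 - δ) (R + 1) (by linarith) (by linarith))
    intro t ht; exact ⟨by linarith [ht.1], by linarith [ht.2]⟩
  set w := ∫⁻ t, fR δ R t
  have hsp : ∀ q : ℝ × ℝ, ‖q‖ ≤ Q → ∫⁻ x, ∫⁻ y, Ph2 e δ σ R q (x, y) ≤ C1 + A * A := by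
    intro q hq
    have m1 := np_meas_comp (1 / 2 + δ) (f := fun p : ℝ × ℝ => e p) (by fun_prop)
    have mP : ∀ x, Measurable fun y => Ph e δ σ q x y := fun x => (Ph_meas e he1 δ σ q).comp (measurable_const.prodMk measurable_id)
    calc ∫⁻ x, ∫⁻ y, Ph2 e δ σ R q (x, y)
        = ∫⁻ x in Metric.closedBall (0 : ℝ × ℝ) R, ∫⁻ y in Metric.closedBall (0 : ℝ × ℝ) R,
            (Ph e δ σ q x y + np (1 / 2 + δ) (e x) * np (1 / 2 + δ) (e y)) := by
          rw [← lintegral_indicator measurableSet_closedBall]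
          refine lintegral_congr fun x => ?_
          by_cases hx : x ∈ Metric.closedBall (0 : ℝ × ℝ) R
          · rw [indicator_of_mem hx, ← lintegral_indicator measurableSet_closedBall]
            refine lintegral_congr fun y => ?_
            by_cases hy : y ∈ Metric.closedBall (0 : ℝ × ℝ) R
            · rw [indicator_of_mem hy, Ph2, indicator_of_mem (mk_mem_prod hx hy)]
            · rw [indicator_of_notMem hy, Ph2, indicator_of_notMem (fun h => hy h.2)]
          · rw [indicator_of_notMem hx]
            simp only [Ph2]
            have : ∀ y, (x, y) ∉ (Metric.closedBall 0 R ×ˢ Metric.closedBall 0 R : Set ((ℝ × ℝ) × (ℝ × ℝ))) := fun y h => hx h.1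
            simp only [indicator_of_notMem (this _), lintegral_zero]
      _ = (∫⁻ x in Metric.closedBall (0 : ℝ × ℝ) R, ∫⁻ y in Metric.closedBall (0 : ℝ × ℝ) R, Ph e δ σ q x y) + A * A := by
          have : ∀ x, ∫⁻ y in Metric.closedBall (0 : ℝ × ℝ) R,
            (Ph e δ σ q x y + np (1 / 2 + δ) (e x) * np (1 / 2 + δ) (e y)) =
              (∫⁻ y in Metric.closedBall (0 : ℝ × ℝ) R, Ph e δ σ q x y) + np (1 / 2 + δ) (e x) * A := by
            intro x
            rw [lintegral_add_left (mP x), lintegral_const_mul _ m1]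
          simp only [this]
          rw [lintegral_add_right _ (m1.mul_const A), lintegral_mul_const _ m1]
      _ ≤ _ := by gcongr; exact h1 q hq
  let u : ℕ → Set ℝ := fun n => Icc (-(1 / ((n : ℝ) + 1))) (1 / ((n : ℝ) + 1))
  let wn : ℕ → ℝ≥0∞ := fun n => ∫⁻ t in u n, fR δ R t
  have hwn : Tendsto wn atTop (𝓝 0) := by
    refine tendsto_setLIntegral_zero hw.ne ?_
    have : (volume ∘ u) = fun n : ℕ => ENNReal.ofReal (2 * (1 / ((n:ℝ) + 1))) := by
      funext n
      simp only [Function.comp, u, Real.volume_Icc]; congr 1; ring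
    rw [this]
    have h0 : Tendsto (fun n : ℕ => ENNReal.ofReal (2 * (1 / ((n:ℝ) + 1)))) atTop (𝓝 (ENNReal.ofReal (2 * 0))) :=
      ENNReal.tendsto_ofReal (tendsto_one_div_add_atTop_nhds_zero_nat.const_mul 2)
    simpa using h0
  have hM : C1 + A * A < ∞ := ENNReal.add_lt_top.2 ⟨hC1, ENNReal.mul_lt_top hA hA⟩
  refine ⟨w * w * (C1 + A * A), ENNReal.mul_lt_top (ENNReal.mul_lt_top hw hw) hM,
    fun n => wn n * (2 * w * (C1 + A * A)), ?_, fun q hq => ⟨?_, fun n => ?_⟩⟩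
  · have := ENNReal.Tendsto.mul_const (b := 2 * w * (C1 + A * A)) hwn
      (Or.inr (ENNReal.mul_lt_top (ENNReal.mul_lt_top (by simp) hw) hM).ne)
    simpa using this
  · unfold Gm
    rw [prodint _ _ (fR_meas _ _) (fR_meas _ _) _ (Ph2_meas e he1 δ σ R q)]
    gcongr
    exact hsp q hq
  · have hPm := Ph2_meas e he1 δ σ R q
    have hfm := fR_meas δ R
    have hum : MeasurableSet (u n) := measurableSet_Icc
    have hfi : Measurable ((u n).indicator (fR δ R)) := hfm.indicator hum
    have hwi : ∫⁻ t, (u n).indicator (fR δ R) t = wn n := lintegral_indicator hum _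
    calc ∫⁻ a in (Tn n)ᶜ, Gm e δ σ R q a
        ≤ ∫⁻ a : E4 × E4, ((u n).indicator (fR δ R) a.1.1 * fR δ R a.2.1 * Ph2 e δ σ R q (a.1.2, a.2.2) +
            fR δ R a.1.1 * (u n).indicator (fR δ R) a.2.1 * Ph2 e δ σ R q (a.1.2, a.2.2)) := by
          rw [← lintegral_indicator (Tn_meas n).compl]
          refine lintegral_mono fun a => ?_
          by_cases ha : a ∈ (Tn n)ᶜ
          · rw [indicator_of_mem ha]
            have : a.1.1 ∈ u n ∨ a.2.1 ∈ u n := by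
              by_contra! h
              refine ha ⟨?_, ?_⟩
              · by_contra! h'
                exact h.1 (abs_le.1 h')
              · by_contra! h'
                exact h.2 (abs_le.1 h')
            rcases this with h | h
            · rw [indicator_of_mem h]; exact le_self_add
            · rw [indicator_of_mem h]; exact le_add_self
          · rw [indicator_of_notMem ha]; exact zero_le
      _ = wn n * w * (∫⁻ x, ∫⁻ y, Ph2 e δ σ R q (x, y)) + w * wn n * (∫⁻ x, ∫⁻ y, Ph2 e δ σ R q (x, y)) := by
          rw [lintegral_add_left (by fun_prop), prodint _ _ hfi hfm _ hPm, prodint _ _ hfm hfi _ hPm, hwi]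
      _ ≤ wn n * w * (C1 + A * A) + w * wn n * (C1 + A * A) := by
          have := hsp q hq
          gcongr
      _ = _ := by ring

lemma diff_int {α : Type} [MeasurableSpace α] (μ : Measure α) (W : ℝ × ℝ → α → ℂ)
    (W' : ℝ × ℝ → α → (ℝ × ℝ →L[ℝ] ℂ)) (T : ℕ → Set α) (hT : ∀ n, MeasurableSet (T n))
    (hWm : ∀ q, AEStronglyMeasurable (W q) μ) (hWm' : ∀ q, AEStronglyMeasurable (W' q) μ)
    (hG : ∀ Q : ℝ, 0 < Q → ∃ G : ℝ × ℝ → α → ℝ≥0∞, ∃ C < ∞, ∃ η : ℕ → ℝ≥0∞, Tendsto η atTop (𝓝 0) ∧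
      ∀ q, ‖q‖ ≤ Q → (∀ᵐ a ∂μ, ‖W q a‖ₑ ≤ G q a) ∧ (∀ᵐ a ∂μ, ‖W' q a‖ₑ ≤ G q a) ∧ ∫⁻ a, G q a ∂μ ≤ C ∧
        ∀ n, ∫⁻ a in (T n)ᶜ, G q a ∂μ ≤ η n)
    (hder : ∀ n, ∀ a ∈ T n, ∀ q, HasFDerivAt (fun q => W q a) (W' q a) q)
    (hcont : ∀ n, ∀ a ∈ T n, Continuous fun q => W' q a)
    (hb : ∀ Q : ℝ, 0 < Q → ∀ n, ∃ bound : α → ℝ, IntegrableOn bound (T n) μ ∧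
      ∀ q, ‖q‖ ≤ Q → ∀ a ∈ T n, ‖W' q a‖ ≤ bound a) :
    (∀ q, Integrable (W q) μ) ∧ ContDiff ℝ 1 (fun q => ∫ a, W q a ∂μ) := by
  have hIntg : ∀ q, Integrable (W q) μ ∧ Integrable (W' q) μ := by
    intro q
    obtain ⟨G, C, hC, η, hη, h⟩ := hG (‖q‖ + 1) (by positivity)
    obtain ⟨h1, h2, h3, -⟩ := h q (by linarith)
    exact ⟨⟨hWm q, ((lintegral_mono_ae h1).trans h3).trans_lt hC⟩, ⟨hWm' q, ((lintegral_mono_ae h2).trans h3).trans_lt hC⟩⟩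
  have hF : ∀ n q, HasFDerivAt (fun q => ∫ a in T n, W q a ∂μ) (∫ a in T n, W' q a ∂μ) q := by
    intro n q
    obtain ⟨bd, hbi, hbd⟩ := hb (‖q‖ + 1) (by positivity) n
    refine hasFDerivAt_integral_of_dominated_of_fderiv_le (bound := bd) (Metric.ball_mem_nhds q one_pos)
      (Eventually.of_forall fun q => (hWm q).restrict) (hIntg q).1.restrict (hWm' q).restrict ?_ hbi ?_
    · filter_upwards [ae_restrict_mem (hT n)] with a ha x hx
      refine hbd x ?_ a ha
      rw [Metric.mem_ball, dist_eq_norm] at hx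
      have := norm_sub_norm_le x q
      linarith
    · filter_upwards [ae_restrict_mem (hT n)] with a ha x hx
      exact hder n a ha x
  have hFc : ∀ n, Continuous fun q => ∫ a in T n, W' q a ∂μ := by
    intro n
    refine continuous_iff_continuousAt.2 fun q => ?_
    obtain ⟨bd, hbi, hbd⟩ := hb (‖q‖ + 1) (by positivity) n
    refine continuousAt_of_dominated (bound := bd) (Eventually.of_forall fun q => (hWm' q).restrict) ?_ hbi ?_
    · filter_upwards [Metric.ball_mem_nhds q one_pos] with x hx
      filter_upwards [ae_restrict_mem (hT n)] with a ha
      refine hbd x ?_ a ha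
      rw [Metric.mem_ball, dist_eq_norm] at hx
      have := norm_sub_norm_le x q
      linarith
    · filter_upwards [ae_restrict_mem (hT n)] with a ha
      exact (hcont n a ha).continuousAt
  have hU : ∀ Q : ℝ, 0 < Q → TendstoUniformlyOn (fun n q => ∫ a in T n, W' q a ∂μ) (fun q => ∫ a, W' q a ∂μ) atTop (Metric.ball 0 Q) ∧
      TendstoUniformlyOn (fun n q => ∫ a in T n, W q a ∂μ) (fun q => ∫ a, W q a ∂μ) atTop (Metric.ball 0 Q) := by
    intro Q hQ
    obtain ⟨G, C, hC, η, hη, h⟩ := hG Q hQ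
    constructor
    · rw [EMetric.tendstoUniformlyOn_iff]
      intro ε hε
      filter_upwards [hη.eventually (gt_mem_nhds hε)] with n hn q hq
      obtain ⟨h1, h2, h3, h4⟩ := h q (by simpa using (mem_ball_zero_iff.1 hq).le)
      refine lt_of_le_of_lt ?_ hn
      rw [← integral_add_compl (hT n) (hIntg q).2, edist_eq_enorm_sub, add_sub_cancel_left]
      refine (enorm_integral_le_lintegral_enorm _).trans (le_trans (lintegral_mono_ae (ae_restrict_of_ae h2)) (h4 n))
    · rw [EMetric.tendstoUniformlyOn_iff]
      intro ε hε
      filter_upwards [hη.eventually (gt_mem_nhds hε)] with n hn q hq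
      obtain ⟨h1, h2, h3, h4⟩ := h q (by simpa using (mem_ball_zero_iff.1 hq).le)
      refine lt_of_le_of_lt ?_ hn
      rw [← integral_add_compl (hT n) (hIntg q).1, edist_eq_enorm_sub, add_sub_cancel_left]
      refine (enorm_integral_le_lintegral_enorm _).trans (le_trans (lintegral_mono_ae (ae_restrict_of_ae h1)) (h4 n))
  refine ⟨fun q => (hIntg q).1, ?_⟩
  have hD : ∀ q, HasFDerivAt (fun q => ∫ a, W q a ∂μ) (∫ a, W' q a ∂μ) q := by
    intro q
    have hq : q ∈ Metric.ball (0 : ℝ × ℝ) (‖q‖ + 1) := by simp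
    obtain ⟨u1, u2⟩ := hU (‖q‖ + 1) (by positivity)
    exact hasFDerivAt_of_tendstoUniformlyOn Metric.isOpen_ball u1 (fun n x _ => hF n x)
      (fun x hx => u2.tendsto_at hx) hq
  rw [contDiff_one_iff_fderiv]
  refine ⟨fun q => (hD q).differentiableAt, ?_⟩
  have : fderiv ℝ (fun q => ∫ a, W q a ∂μ) = fun q => ∫ a, W' q a ∂μ := funext fun q => (hD q).fderiv
  rw [this]
  refine continuous_iff_continuousAt.2 fun q => ?_
  have hq : Metric.ball (0 : ℝ × ℝ) (‖q‖ + 1) ∈ 𝓝 q := Metric.isOpen_ball.mem_nhds (by simp)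
  obtain ⟨u1, -⟩ := hU (‖q‖ + 1) (by positivity)
  exact (u1.continuousOn (Eventually.of_forall fun n => (hFc n).continuousOn).frequently).continuousAt hq

noncomputable def Dk (e : ℝ × ℝ → ℝ) (k : E4) : ℂ := Complex.I * (k.1 : ℂ) - (e k.2 : ℂ)

noncomputable def nu (w s t : ℝ) : ℂ := (-(Complex.I * (w : ℂ)) - (t : ℂ)) / ((s + w ^ 2 + t ^ 2 : ℝ) : ℂ)

noncomputable def nud (w s t : ℝ) : ℂ :=
  ((-1) * ((s + w ^ 2 + t ^ 2 : ℝ) : ℂ) - (-(Complex.I * (w : ℂ)) - (t : ℂ)) * ((2 * t : ℝ) : ℂ)) /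
    ((s + w ^ 2 + t ^ 2 : ℝ) : ℂ) ^ 2

lemma nu_deriv (w s t : ℝ) (hs : 0 < s) : HasDerivAt (fun t : ℝ => nu w s t) (nud w s t) t := by
  have h1 : HasDerivAt (fun t : ℝ => -(Complex.I * (w : ℂ)) - (t : ℂ)) (-1) t := by
    simpa using (HasDerivAt.ofReal_comp (hasDerivAt_id t)).const_sub (-(Complex.I * (w : ℂ)))
  have h2 : HasDerivAt (fun t : ℝ => ((s + w ^ 2 + t ^ 2 : ℝ) : ℂ)) ((2 * t : ℝ) : ℂ) t := by
    refine HasDerivAt.ofReal_comp ?_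
    simpa using (hasDerivAt_pow 2 t).const_add (s + w ^ 2)
  exact h1.fun_div h2 (by
    have : (s + w ^ 2 + t ^ 2 : ℝ) ≠ 0 := by positivity
    exact_mod_cast this)

lemma nu_num (w t : ℝ) : ‖-(Complex.I * (w : ℂ)) - (t : ℂ)‖ = √(w ^ 2 + t ^ 2) := by
  rw [Complex.norm_def, Complex.normSq_apply]
  congr 1
  simp; ring

lemma Dk_norm (e : ℝ × ℝ → ℝ) (k : E4) : ‖Dk e k‖ = √(k.1 ^ 2 + e k.2 ^ 2) := by
  rw [Complex.norm_def, Complex.normSq_apply]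
  congr 1
  simp [Dk]; ring

lemma nu_bound (w s t : ℝ) (hs : 0 < s) : ‖nu w s t‖ ≤ 1 / √(s + w ^ 2 + t ^ 2) := by
  have hS : 0 < s + w ^ 2 + t ^ 2 := by positivity
  have hsq : 0 < √(s + w ^ 2 + t ^ 2) := Real.sqrt_pos.2 hS
  unfold nu
  rw [norm_div, nu_num, Complex.norm_real, Real.norm_of_nonneg hS.le, div_le_div_iff₀ hS hsq, one_mul]
  calc √(w ^ 2 + t ^ 2) * √(s + w ^ 2 + t ^ 2) ≤ √(s + w ^ 2 + t ^ 2) * √(s + w ^ 2 + t ^ 2) := by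
        gcongr; linarith
    _ = _ := Real.mul_self_sqrt hS.le

lemma nud_bound (w s t : ℝ) (hs : 0 < s) : ‖nud w s t‖ ≤ 3 / √(s + w ^ 2 + t ^ 2) ^ 2 := by
  have hS : 0 < s + w ^ 2 + t ^ 2 := by positivity
  rw [Real.sq_sqrt hS.le]
  have h1 : √(w ^ 2 + t ^ 2) ≤ √(s + w ^ 2 + t ^ 2) := by gcongr; linarith
  have h2 : |t| ≤ √(s + w ^ 2 + t ^ 2) := by
    rw [← Real.sqrt_sq_eq_abs]; gcongr; nlinarith [sq_nonneg w]
  have h3 := Real.mul_self_sqrt hS.le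
  unfold nud
  rw [norm_div, norm_pow, Complex.norm_real, Real.norm_of_nonneg hS.le, div_le_div_iff₀ (by positivity) hS]
  have : ‖(-1) * ((s + w ^ 2 + t ^ 2 : ℝ) : ℂ) - (-(Complex.I * (w : ℂ)) - (t : ℂ)) * ((2 * t : ℝ) : ℂ)‖ ≤
      3 * (s + w ^ 2 + t ^ 2) := by
    refine (norm_sub_le _ _).trans ?_
    rw [norm_mul, norm_mul, nu_num, Complex.norm_real, Complex.norm_real, Real.norm_of_nonneg hS.le, norm_neg, norm_one,
      Real.norm_eq_abs, abs_mul, abs_two]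
    have : √(w ^ 2 + t ^ 2) * |t| ≤ √(s + w ^ 2 + t ^ 2) * √(s + w ^ 2 + t ^ 2) := by gcongr
    linarith
  nlinarith

section core
variable (e : ℝ × ℝ → ℝ) (U : E4 → ℝ) (q₀ σ : ℝ) (A : (ℝ × ℝ) × (E4 × E4) → ℂ)

noncomputable def gW (a : E4 × E4) : ℂ := ((U a.1 : ℂ) * (U a.2 : ℂ)) / (Dk e a.1 * Dk e a.2)
noncomputable def sW (a : E4 × E4) : ℝ := (a.1.1 ^ 2 + e a.1.2 ^ 2) + (a.2.1 ^ 2 + e a.2.2 ^ 2)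
noncomputable def wW (a : E4 × E4) : ℝ := a.2.1 + σ * (a.1.1 - q₀)
noncomputable def zW (q : ℝ × ℝ) (a : E4 × E4) : ℝ × ℝ := a.2.2 + σ • (a.1.2 - q)

noncomputable def WW (q : ℝ × ℝ) (a : E4 × E4) : ℂ :=
  gW e U a * (A (q, a) * nu (wW q₀ σ a) (sW e a) (e (zW σ q a)))

noncomputable def LW (q : ℝ × ℝ) (a : E4 × E4) : ℝ × ℝ →L[ℝ] ℂ :=
  Complex.ofRealCLM.comp ((-σ) • fderiv ℝ e (zW σ q a))

noncomputable def AW (q : ℝ × ℝ) (a : E4 × E4) : ℝ × ℝ →L[ℝ] ℂ :=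
  (fderiv ℝ A (q, a)).comp (ContinuousLinearMap.inl ℝ (ℝ × ℝ) (E4 × E4))

noncomputable def WW' (q : ℝ × ℝ) (a : E4 × E4) : ℝ × ℝ →L[ℝ] ℂ :=
  gW e U a • (A (q, a) • (nud (wW q₀ σ a) (sW e a) (e (zW σ q a)) • LW e σ q a) +
    nu (wW q₀ σ a) (sW e a) (e (zW σ q a)) • AW A q a)

lemma WW_deriv (he : ContDiff ℝ 1 e) (hA : ContDiff ℝ 1 A) (a : E4 × E4) (ha : 0 < sW e a) (q : ℝ × ℝ) :
    HasFDerivAt (fun q => WW e U q₀ σ A q a) (WW' e U q₀ σ A q a) q := by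
  have hz : HasFDerivAt (fun q => zW σ q a) ((-σ) • ContinuousLinearMap.id ℝ (ℝ × ℝ)) q := by
    unfold zW
    have := (((hasFDerivAt_id (𝕜 := ℝ) q).const_sub a.1.2).const_smul σ).const_add a.2.2
    refine this.congr_fderiv ?_
    ext <;> simp
  have h1 : HasFDerivAt (fun q => e (zW σ q a)) ((-σ) • fderiv ℝ e (zW σ q a)) q := by
    have := ((he.differentiable (by norm_num)) (zW σ q a)).hasFDerivAt.comp q hz
    refine this.congr_fderiv ?_
    ext <;> simp
  have h2 : HasFDerivAt (fun q => nu (wW q₀ σ a) (sW e a) (e (zW σ q a)))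
      (nud (wW q₀ σ a) (sW e a) (e (zW σ q a)) • LW e σ q a) q := by
    have := (nu_deriv (wW q₀ σ a) (sW e a) (e (zW σ q a)) ha).hasFDerivAt.comp q h1
    refine this.congr_fderiv ?_
    ext <;> simp [LW] <;> ring
  have h3 : HasFDerivAt (fun q => A (q, a)) (AW A q a) q := by
    have h4 : HasFDerivAt (fun q : ℝ × ℝ => (q, a)) (ContinuousLinearMap.inl ℝ (ℝ × ℝ) (E4 × E4)) q :=
      hasFDerivAt_prodMk_left q a
    exact ((hA.differentiable (by norm_num)) (q, a)).hasFDerivAt.comp q h4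
  exact (h3.mul h2).const_mul (gW e U a)

lemma AW_cont (hA : ContDiff ℝ 1 A) : Continuous fun p : (ℝ × ℝ) × (E4 × E4) => AW A p.1 p.2 := by
  have hcd : Continuous (fderiv ℝ A) := hA.continuous_fderiv (by norm_num)
  unfold AW
  fun_prop

lemma LW_cont (he : ContDiff ℝ 1 e) : Continuous fun p : (ℝ × ℝ) × (E4 × E4) => LW e σ p.1 p.2 := by
  have hcd : Continuous (fderiv ℝ e) := he.continuous_fderiv (by norm_num)
  unfold LW zW
  fun_prop

lemma nu_meas (he : Continuous e) (q : ℝ × ℝ) : Measurable fun a => nu (wW q₀ σ a) (sW e a) (e (zW σ q a)) := by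
  unfold nu wW sW zW
  refine Measurable.div (Continuous.measurable (by fun_prop)) (Continuous.measurable (by fun_prop))

lemma nud_meas (he : Continuous e) (q : ℝ × ℝ) : Measurable fun a => nud (wW q₀ σ a) (sW e a) (e (zW σ q a)) := by
  unfold nud wW sW zW
  refine Measurable.div (Continuous.measurable (by fun_prop)) (Continuous.measurable (by fun_prop))

lemma gW_meas (he : Continuous e) (hU : Continuous U) : Measurable (gW e U) := by
  unfold gW Dk
  refine Measurable.div (Continuous.measurable (by fun_prop)) (Continuous.measurable (by fun_prop))

lemma WW_meas (he : ContDiff ℝ 1 e) (hU : Continuous U) (hA : ContDiff ℝ 1 A) (q : ℝ × ℝ) :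
    StronglyMeasurable (WW e U q₀ σ A q) := by
  have hAc := hA.continuous
  have h1 : Measurable fun a => A (q, a) := Continuous.measurable (by fun_prop)
  exact ((gW_meas e U he.continuous hU).mul (h1.mul (nu_meas e q₀ σ he.continuous q))).stronglyMeasurable

lemma WW'_meas (he : ContDiff ℝ 1 e) (hU : Continuous U) (hA : ContDiff ℝ 1 A) (q : ℝ × ℝ) :
    StronglyMeasurable (WW' e U q₀ σ A q) := by
  have hAc := hA.continuous
  have h1 : StronglyMeasurable fun a => A (q, a) := Continuous.stronglyMeasurable (by fun_prop)
  have h2 : StronglyMeasurable fun a => LW e σ q a :=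
    ((LW_cont e σ he).comp (continuous_const.prodMk continuous_id)).stronglyMeasurable
  have h3 : StronglyMeasurable fun a => AW A q a :=
    ((AW_cont A hA).comp (continuous_const.prodMk continuous_id)).stronglyMeasurable
  exact (gW_meas e U he.continuous hU).stronglyMeasurable.smul
    ((h1.smul ((nud_meas e q₀ σ he.continuous q).stronglyMeasurable.smul h2)).add
      ((nu_meas e q₀ σ he.continuous q).stronglyMeasurable.smul h3))

lemma WW'_cont (he : ContDiff ℝ 1 e) (hA : ContDiff ℝ 1 A) (a : E4 × E4) (ha : 0 < sW e a) :
    Continuous fun q => WW' e U q₀ σ A q a := by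
  have hAc := hA.continuous
  have hec := he.continuous
  have h2 : Continuous fun q => LW e σ q a := (LW_cont e σ he).comp (continuous_id.prodMk continuous_const)
  have h3 : Continuous fun q => AW A q a := (AW_cont A hA).comp (continuous_id.prodMk continuous_const)
  have hz : Continuous fun q => zW σ q a := by unfold zW; fun_prop
  have hne : ∀ q, ((sW e a + wW q₀ σ a ^ 2 + e (zW σ q a) ^ 2 : ℝ) : ℂ) ≠ 0 := by
    intro q
    have : (sW e a + wW q₀ σ a ^ 2 + e (zW σ q a) ^ 2 : ℝ) ≠ 0 := by positivity
    exact_mod_cast this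
  have h4 : Continuous fun q => nu (wW q₀ σ a) (sW e a) (e (zW σ q a)) := by
    unfold nu
    exact Continuous.div (by fun_prop) (by fun_prop) hne
  have h5 : Continuous fun q => nud (wW q₀ σ a) (sW e a) (e (zW σ q a)) := by
    unfold nud
    exact Continuous.div (by fun_prop) (by fun_prop) (fun q => pow_ne_zero 2 (hne q))
  unfold WW'
  fun_prop

/-- the size function -/
noncomputable def sqS (q : ℝ × ℝ) (a : E4 × E4) : ℝ := √(sW e a + wW q₀ σ a ^ 2 + e (zW σ q a) ^ 2)

noncomputable def Hb (q : ℝ × ℝ) (a : E4 × E4) : ℝ :=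
  1 / (‖Dk e a.1‖ * ‖Dk e a.2‖) * (‖fderiv ℝ e (zW σ q a)‖ / sqS e q₀ σ q a ^ 2 + 1 / sqS e q₀ σ q a)

lemma WW_bounds (CU CA : ℝ) (hσ : |σ| = 1) (hCA1 : 0 ≤ CA) (q : ℝ × ℝ) (a : E4 × E4) (ha : 0 < sW e a)
    (hU : ∀ x, |U x| ≤ CU) (hA : ‖A (q, a)‖ ≤ CA) (hA' : ‖AW A q a‖ ≤ CA) :
    ‖WW e U q₀ σ A q a‖ ≤ 3 * (CU * CU) * CA * Hb e q₀ σ q a ∧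
    ‖WW' e U q₀ σ A q a‖ ≤ 3 * (CU * CU) * CA * Hb e q₀ σ q a := by
  have hCU : 0 ≤ CU := (abs_nonneg _).trans (hU 0)
  have hs : 0 < sqS e q₀ σ q a := Real.sqrt_pos.2 (by positivity)
  have h1 : ‖nu (wW q₀ σ a) (sW e a) (e (zW σ q a))‖ ≤ 1 / sqS e q₀ σ q a := nu_bound _ _ _ ha
  have h2 : ‖nud (wW q₀ σ a) (sW e a) (e (zW σ q a))‖ ≤ 3 / sqS e q₀ σ q a ^ 2 := nud_bound _ _ _ ha
  have h3 : ‖gW e U a‖ ≤ (CU * CU) * (1 / (‖Dk e a.1‖ * ‖Dk e a.2‖)) := by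
    unfold gW
    rw [norm_div, norm_mul, norm_mul, Complex.norm_real, Complex.norm_real, div_eq_mul_one_div]
    gcongr
    · exact hU _
    · exact hU _
  have h4 : ‖LW e σ q a‖ ≤ ‖fderiv ℝ e (zW σ q a)‖ := by
    unfold LW
    refine (ContinuousLinearMap.opNorm_comp_le _ _).trans ?_
    rw [norm_smul, norm_neg, Real.norm_eq_abs, hσ, Complex.ofRealCLM_norm, one_mul, one_mul]
  set s := sqS e q₀ σ q a
  set gz := ‖fderiv ℝ e (zW σ q a)‖
  have hgz : 0 ≤ gz := norm_nonneg _
  unfold Hb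
  set dd := 1 / (‖Dk e a.1‖ * ‖Dk e a.2‖)
  have hdd : 0 ≤ dd := by positivity
  constructor
  · unfold WW
    rw [norm_mul, norm_mul]
    calc ‖gW e U a‖ * (‖A (q, a)‖ * ‖nu (wW q₀ σ a) (sW e a) (e (zW σ q a))‖)
        ≤ (CU * CU * dd) * (CA * (1 / s)) := by gcongr
      _ ≤ (CU * CU * dd) * (CA * (3 * (gz / s ^ 2 + 1 / s))) := by
          gcongr
          have : 0 ≤ gz / s ^ 2 := by positivity
          have : 0 ≤ 1 / s := by positivity
          linarith
      _ = _ := by ring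
  · unfold WW'
    rw [norm_smul]
    calc ‖gW e U a‖ * ‖A (q, a) • (nud (wW q₀ σ a) (sW e a) (e (zW σ q a)) • LW e σ q a) +
          nu (wW q₀ σ a) (sW e a) (e (zW σ q a)) • AW A q a‖
        ≤ (CU * CU * dd) * (CA * (3 / s ^ 2 * gz) + 1 / s * CA) := by
          gcongr
          refine (norm_add_le _ _).trans ?_
          rw [norm_smul, norm_smul, norm_smul]
          gcongr
      _ ≤ (CU * CU * dd) * (CA * (3 * (gz / s ^ 2 + 1 / s))) := by
          gcongr
          have : 0 ≤ CA * (1 / s) := by positivity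
          calc CA * (3 / s ^ 2 * gz) + 1 / s * CA ≤ CA * (3 / s ^ 2 * gz) + 1 / s * CA + 2 * (CA * (1 / s)) := by linarith
            _ = _ := by ring
      _ = _ := by ring

lemma WW_zero (q : ℝ × ℝ) (a : E4 × E4) (h : U a.1 = 0 ∨ U a.2 = 0) :
    WW e U q₀ σ A q a = 0 ∧ WW' e U q₀ σ A q a = 0 := by
  have : gW e U a = 0 := by
    unfold gW
    rcases h with h | h <;> simp [h]
  refine ⟨by simp [WW, this], ?_⟩
  unfold WW'
  rw [this]
  exact zero_smul ℂ (_ : ℝ × ℝ →L[ℝ] ℂ)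

end core

lemma ae_ne1 : ∀ᵐ a : E4 × E4, a.1.1 ≠ 0 := by
  have h1 : Measure.QuasiMeasurePreserving (fun a : E4 × E4 => a.1) volume volume :=
    Measure.quasiMeasurePreserving_fst
  have h2 : Measure.QuasiMeasurePreserving (fun a : E4 => a.1) volume volume :=
    Measure.quasiMeasurePreserving_fst
  exact (h2.comp h1).ae (Measure.ae_ne volume (0:ℝ))

lemma ae_ne2 : ∀ᵐ a : E4 × E4, a.2.1 ≠ 0 := by
  have h1 : Measure.QuasiMeasurePreserving (fun a : E4 × E4 => a.2) volume volume :=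
    Measure.quasiMeasurePreserving_snd
  have h2 : Measure.QuasiMeasurePreserving (fun a : E4 => a.1) volume volume :=
    Measure.quasiMeasurePreserving_fst
  exact (h2.comp h1).ae (Measure.ae_ne volume (0:ℝ))

lemma sqS_ge (e : ℝ × ℝ → ℝ) (q₀ σ : ℝ) (q : ℝ × ℝ) (a : E4 × E4) :
    |a.1.1| ≤ sqS e q₀ σ q a ∧ |e a.1.2| ≤ sqS e q₀ σ q a ∧ |e a.2.2| ≤ sqS e q₀ σ q a ∧
      |e (zW σ q a)| ≤ sqS e q₀ σ q a := by
  unfold sqS sW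
  have := sq_nonneg a.1.1
  have := sq_nonneg a.2.1
  have := sq_nonneg (e a.1.2)
  have := sq_nonneg (e a.2.2)
  have := sq_nonneg (e (zW σ q a))
  have := sq_nonneg (wW q₀ σ a)
  refine ⟨?_, ?_, ?_, ?_⟩ <;> refine Real.abs_le_sqrt ?_ <;> linarith

lemma Dk_ge (e : ℝ × ℝ → ℝ) (k : E4) : |k.1| ≤ ‖Dk e k‖ ∧ |e k.2| ≤ ‖Dk e k‖ := by
  rw [Dk_norm]
  constructor <;> refine Real.abs_le_sqrt ?_ <;> nlinarith [sq_nonneg k.1, sq_nonneg (e k.2)]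

lemma Hb_le (e : ℝ × ℝ → ℝ) (δ q₀ σ R : ℝ) (hδ : 0 < δ) (hδ1 : δ ≤ 1 / 60) (q : ℝ × ℝ) (a : E4 × E4)
    (h1 : a.1.1 ≠ 0) (h2 : a.2.1 ≠ 0) (hx : ‖a.1‖ ≤ R) (hy : ‖a.2‖ ≤ R) :
    ENNReal.ofReal (Hb e q₀ σ q a) ≤ Gm e δ σ R q a := by
  have hd1 : 0 < ‖Dk e a.1‖ := (abs_pos.2 h1).trans_le (Dk_ge e a.1).1
  have hd2 : 0 < ‖Dk e a.2‖ := (abs_pos.2 h2).trans_le (Dk_ge e a.2).1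
  obtain ⟨s1, s2, s3, s4⟩ := sqS_ge e q₀ σ q a
  have hs : 0 < sqS e q₀ σ q a := (abs_pos.2 h1).trans_le s1
  have hk : ∀ k : E4, ‖k‖ ≤ R → k.1 ∈ Icc (-R) R ∧ k.2 ∈ Metric.closedBall (0 : ℝ × ℝ) R := by
    intro k hk
    have h3 := (norm_fst_le k).trans hk
    have h4 := (norm_snd_le k).trans hk
    rw [Real.norm_eq_abs, abs_le] at h3
    exact ⟨h3, by simpa using h4⟩
  have := ptw δ a.1.1 a.2.1 (e a.1.2) (e a.2.2) (e (zW σ q a)) ‖fderiv ℝ e (zW σ q a)‖ ‖Dk e a.1‖ ‖Dk e a.2‖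
    (sqS e q₀ σ q a) hδ hδ1 (norm_nonneg _) hd1 hd2 hs (Dk_ge e a.1).1 (Dk_ge e a.2).1 (Dk_ge e a.1).2
    (Dk_ge e a.2).2 s2 s3 s4
  unfold Hb
  refine this.trans (le_of_eq ?_)
  unfold Gm fR Ph2
  rw [indicator_of_mem (hk _ hx).1, indicator_of_mem (hk _ hy).1,
    indicator_of_mem (show (a.1.2, a.2.2) ∈ Metric.closedBall (0 : ℝ × ℝ) R ×ˢ Metric.closedBall (0 : ℝ × ℝ) R from
      ⟨(hk _ hx).2, (hk _ hy).2⟩)]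
  rfl

lemma core_C1 (n₀ r : ℕ) (hn₀ : 3 ≤ n₀) (hr : 2 * n₀ + 1 ≤ r)
    (e : ℝ × ℝ → ℝ) (he : ContDiff ℝ r e)
    (hH4 : ∀ k : ℝ × ℝ, e k = 0 → fderiv ℝ e k = 0 → HessCond e k)
    (hH5 : NonFlatCond e r n₀) (hH6 : NoNestingCond e r n₀)
    (U : E4 → ℝ) (hU : Continuous U) (hUc : HasCompactSupport U) (q₀ σ : ℝ) (hσ : |σ| = 1)
    (A : (ℝ × ℝ) × (E4 × E4) → ℂ) (hA : ContDiff ℝ 1 A) :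
    (∀ q, Integrable (WW e U q₀ σ A q)) ∧ ContDiff ℝ 1 (fun q => ∫ a, WW e U q₀ σ A q a) := by
  have hN : (3:ℝ) ≤ n₀ := by exact_mod_cast hn₀
  obtain ⟨δ, hδ⟩ : ∃ δ : ℝ, δ = 1 / (20 * n₀) := ⟨_, rfl⟩
  have hδ0 : 0 < δ := by rw [hδ]; positivity
  have hδN : δ * n₀ = 1 / 20 := by rw [hδ]; field_simp
  have hδ1 : δ ≤ 1 / 60 := by nlinarith
  have he1 : ContDiff ℝ 1 e := he.of_le (by exact_mod_cast (by omega : 1 ≤ r))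
  obtain ⟨CU, hCU⟩ : ∃ CU, ∀ x, ‖U x‖ ≤ CU := hU.bounded_above_of_compact_support hUc
  obtain ⟨R0, hR0⟩ := hUc.isCompact.isBounded.subset_closedBall (0 : E4)
  set R := max R0 0
  have hR : 0 ≤ R := le_max_right _ _
  have hUR : ∀ x, R < ‖x‖ → U x = 0 := by
    intro x hx
    by_contra hne
    have := hR0 (subset_tsupport U hne)
    rw [mem_closedBall_zero_iff] at this
    have : R0 ≤ R := le_max_left _ _
    linarith
  have hCU0 : 0 ≤ CU := (norm_nonneg _).trans (hCU 0)
  set BB : Set (E4 × E4) := Metric.closedBall 0 R ×ˢ Metric.closedBall 0 R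
  have hBB : IsCompact BB := (isCompact_closedBall _ _).prod (isCompact_closedBall _ _)
  have hbd : ∀ Q : ℝ, ∃ CA : ℝ, 0 ≤ CA ∧ ∀ q : ℝ × ℝ, ‖q‖ ≤ Q → ∀ a ∈ BB, ‖A (q, a)‖ ≤ CA ∧ ‖AW A q a‖ ≤ CA ∧
      ‖fderiv ℝ e (zW σ q a)‖ ≤ CA := by
    intro Q
    have hK : IsCompact (Metric.closedBall (0 : ℝ × ℝ) Q ×ˢ BB) := (isCompact_closedBall _ _).prod hBB
    have hz : Continuous fun p : (ℝ × ℝ) × (E4 × E4) => fderiv ℝ e (zW σ p.1 p.2) := by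
      have hcd : Continuous (fderiv ℝ e) := he1.continuous_fderiv (by norm_num)
      unfold zW
      fun_prop
    obtain ⟨c1, h1⟩ := hK.exists_bound_of_continuousOn hA.continuous.continuousOn
    obtain ⟨c2, h2⟩ := hK.exists_bound_of_continuousOn (AW_cont A hA).continuousOn
    obtain ⟨c3, h3⟩ := hK.exists_bound_of_continuousOn hz.continuousOn
    refine ⟨max (max (max c1 c2) c3) 0, le_max_right _ _, fun q hq a ha => ?_⟩
    have hm : (q, a) ∈ Metric.closedBall (0 : ℝ × ℝ) Q ×ˢ BB := ⟨by simpa using hq, ha⟩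
    exact ⟨(h1 _ hm).trans (by simp), (h2 _ hm).trans (by simp), (h3 _ hm).trans (by simp)⟩
  have hsW : ∀ a : E4 × E4, a.1.1 ≠ 0 → 0 < sW e a := by
    intro a ha; unfold sW; positivity
  have hout : ∀ q a, a ∉ BB → WW e U q₀ σ A q a = 0 ∧ WW' e U q₀ σ A q a = 0 := by
    intro q a ha
    refine WW_zero e U q₀ σ A q a ?_
    by_contra! hcon
    refine ha ⟨?_, ?_⟩
    · rw [mem_closedBall_zero_iff]; by_contra! hh; exact hcon.1 (hUR _ hh)
    · rw [mem_closedBall_zero_iff]; by_contra! hh; exact hcon.2 (hUR _ hh)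
  have hTpos : ∀ n : ℕ, (0:ℝ) < 1 / ((n : ℝ) + 1) := fun n => by positivity
  have hTne : ∀ n, ∀ a ∈ Tn n, a.1.1 ≠ 0 := fun n a ha => abs_pos.1 ((hTpos n).trans ha.1)
  refine diff_int volume (WW e U q₀ σ A) (WW' e U q₀ σ A) Tn Tn_meas
    (fun q => (WW_meas e U q₀ σ A he1 hU hA q).aestronglyMeasurable)
    (fun q => (WW'_meas e U q₀ σ A he1 hU hA q).aestronglyMeasurable) ?_ ?_ ?_ ?_
  · intro Q hQ
    obtain ⟨CA, hCA, hb⟩ := hbd Q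
    obtain ⟨C, hC, η, hη, hm⟩ := mass n₀ r hn₀ hr e he hH4 hH5 hH6 δ hδ σ hσ R Q hR hQ.le
    set M := 3 * (CU * CU) * CA
    have hM : 0 ≤ M := by positivity
    have hpt : ∀ q : ℝ × ℝ, ‖q‖ ≤ Q → ∀ a : E4 × E4, a.1.1 ≠ 0 → a.2.1 ≠ 0 →
        ‖WW e U q₀ σ A q a‖ₑ ≤ ENNReal.ofReal M * Gm e δ σ R q a ∧
        ‖WW' e U q₀ σ A q a‖ₑ ≤ ENNReal.ofReal M * Gm e δ σ R q a := by
      intro q hq a h1 h2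
      by_cases ha : a ∈ BB
      · obtain ⟨b1, b2, b3⟩ := hb q hq a ha
        obtain ⟨w1, w2⟩ := WW_bounds e U q₀ σ A CU CA hσ hCA q a (hsW a h1) hCU b1 b2
        have hH := Hb_le e δ q₀ σ R hδ0 hδ1 q a h1 h2 (by simpa using ha.1) (by simpa using ha.2)
        constructor
        · rw [← ofReal_norm]
          refine (ENNReal.ofReal_le_ofReal w1).trans ?_
          rw [ENNReal.ofReal_mul hM]
          gcongr
        · rw [← ofReal_norm]
          refine (ENNReal.ofReal_le_ofReal w2).trans ?_
          rw [ENNReal.ofReal_mul hM]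
          gcongr
      · rw [← ofReal_norm, ← ofReal_norm, (hout q a ha).1, (hout q a ha).2, norm_zero, norm_zero, ENNReal.ofReal_zero]
        exact ⟨zero_le, zero_le⟩
    refine ⟨fun q a => ENNReal.ofReal M * Gm e δ σ R q a, ENNReal.ofReal M * C,
      ENNReal.mul_lt_top ENNReal.ofReal_lt_top hC, fun n => ENNReal.ofReal M * η n, ?_, fun q hq => ⟨?_, ?_, ?_, ?_⟩⟩
    · simpa using ENNReal.Tendsto.const_mul hη (Or.inr ENNReal.ofReal_ne_top)
    · filter_upwards [ae_ne1, ae_ne2] with a h1 h2 using (hpt q hq a h1 h2).1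
    · filter_upwards [ae_ne1, ae_ne2] with a h1 h2 using (hpt q hq a h1 h2).2
    · rw [lintegral_const_mul' _ _ ENNReal.ofReal_ne_top]
      exact mul_le_mul_right (hm q hq).1 _
    · intro n
      rw [lintegral_const_mul' _ _ ENNReal.ofReal_ne_top]
      exact mul_le_mul_right ((hm q hq).2 n) _
  · intro n a ha q
    exact WW_deriv e U q₀ σ A he1 hA a (hsW a (hTne n a ha)) q
  · intro n a ha
    exact WW'_cont e U q₀ σ A he1 hA a (hsW a (hTne n a ha))
  · intro Q hQ n
    obtain ⟨CA, hCA, hb⟩ := hbd Q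
    set τ := 1 / ((n : ℝ) + 1) with hτ
    have hτ0 : 0 < τ := hTpos n
    refine ⟨BB.indicator fun _ => 3 * (CU * CU) * CA * (1 / (τ * τ) * (CA / τ ^ 2 + 1 / τ)), ?_, ?_⟩
    · refine Integrable.integrableOn ?_
      rw [integrable_indicator_iff hBB.measurableSet]
      exact integrableOn_const hBB.measure_lt_top.ne
    · intro q hq a haT
      by_cases ha : a ∈ BB
      · rw [indicator_of_mem ha]
        obtain ⟨b1, b2, b3⟩ := hb q hq a ha
        obtain ⟨w1, w2⟩ := WW_bounds e U q₀ σ A CU CA hσ hCA q a (hsW a (hTne n a haT)) hCU b1 b2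
        refine w2.trans ?_
        have d1 : τ ≤ ‖Dk e a.1‖ := haT.1.le.trans (Dk_ge e a.1).1
        have d2 : τ ≤ ‖Dk e a.2‖ := haT.2.le.trans (Dk_ge e a.2).1
        have d3 : τ ≤ sqS e q₀ σ q a := haT.1.le.trans (sqS_ge e q₀ σ q a).1
        have hs0 : 0 < sqS e q₀ σ q a := hτ0.trans_le d3
        unfold Hb
        gcongr
      · rw [indicator_of_notMem ha, (hout q a ha).2, norm_zero]

lemma tri (D1 D2 D3 c1 c2 c3 S : ℂ) (hS : D1 * c1 + D2 * c2 + D3 * c3 = S) (h1 : D1 = 0 → c1 = 0)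
    (h2 : D2 = 0 → c2 = 0) (h3 : D3 = 0 → c3 = 0) (h0 : D1 ≠ 0 → S ≠ 0) :
    1 / (D1 * D2 * D3) = 1 / (D1 * D2) * (c3 / S) + 1 / (D2 * D3) * (c1 / S) + 1 / (D1 * D3) * (c2 / S) := by
  by_cases d1 : D1 = 0
  · simp [d1, h1 d1]
  by_cases d2 : D2 = 0
  · simp [d2, h2 d2]
  by_cases d3 : D3 = 0
  · simp [d3, h3 d3]
  have := h0 d1
  field_simp
  rw [← hS]; ring

lemma Dk_conj (w t : ℝ) : (Complex.I * (w : ℂ) - (t : ℂ)) * (-(Complex.I * (w : ℂ)) - (t : ℂ)) = ((w ^ 2 + t ^ 2 : ℝ) : ℂ) := by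
  push_cast
  linear_combination (-(w:ℂ) ^ 2) * Complex.I_sq

lemma Dk_zero (w t : ℝ) (h : Complex.I * (w : ℂ) - (t : ℂ) = 0) : w = 0 ∧ t = 0 := by
  have h1 := congrArg Complex.re h
  have h2 := congrArg Complex.im h
  simp at h1 h2
  exact ⟨h2, h1⟩

lemma tri' (w1 t1 w2 t2 w3 t3 : ℝ) :
    1 / ((Complex.I * (w1 : ℂ) - (t1 : ℂ)) * (Complex.I * (w2 : ℂ) - (t2 : ℂ)) * (Complex.I * (w3 : ℂ) - (t3 : ℂ))) =
    1 / ((Complex.I * (w1 : ℂ) - (t1 : ℂ)) * (Complex.I * (w2 : ℂ) - (t2 : ℂ))) *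
        nu w3 ((w1 ^ 2 + t1 ^ 2) + (w2 ^ 2 + t2 ^ 2)) t3 +
    1 / ((Complex.I * (w2 : ℂ) - (t2 : ℂ)) * (Complex.I * (w3 : ℂ) - (t3 : ℂ))) *
        nu w1 ((w2 ^ 2 + t2 ^ 2) + (w3 ^ 2 + t3 ^ 2)) t1 +
    1 / ((Complex.I * (w1 : ℂ) - (t1 : ℂ)) * (Complex.I * (w3 : ℂ) - (t3 : ℂ))) *
        nu w2 ((w1 ^ 2 + t1 ^ 2) + (w3 ^ 2 + t3 ^ 2)) t2 := by
  have hz : ∀ w t : ℝ, Complex.I * (w : ℂ) - (t : ℂ) = 0 → -(Complex.I * (w : ℂ)) - (t : ℂ) = 0 := by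
    intro w t h
    obtain ⟨rfl, rfl⟩ := Dk_zero w t h
    simp
  have := tri _ _ _ (-(Complex.I * (w1 : ℂ)) - (t1 : ℂ)) (-(Complex.I * (w2 : ℂ)) - (t2 : ℂ))
    (-(Complex.I * (w3 : ℂ)) - (t3 : ℂ)) (((w1 ^ 2 + t1 ^ 2) + (w2 ^ 2 + t2 ^ 2) + (w3 ^ 2 + t3 ^ 2) : ℝ) : ℂ)
    (by rw [Dk_conj w1 t1, Dk_conj w2 t2, Dk_conj w3 t3]; push_cast; ring) (hz w1 t1) (hz w2 t2) (hz w3 t3) (by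
      intro h h'
      apply h
      have h'' : (w1 ^ 2 + t1 ^ 2) + (w2 ^ 2 + t2 ^ 2) + (w3 ^ 2 + t3 ^ 2) = (0:ℝ) := by exact_mod_cast h'
      have hw : w1 = 0 := by
        apply pow_eq_zero_iff (two_ne_zero) |>.1
        nlinarith [sq_nonneg w1, sq_nonneg w2, sq_nonneg w3, sq_nonneg t1, sq_nonneg t2, sq_nonneg t3]
      have ht : t1 = 0 := by
        apply pow_eq_zero_iff (two_ne_zero) |>.1
        nlinarith [sq_nonneg w1, sq_nonneg w2, sq_nonneg w3, sq_nonneg t1, sq_nonneg t2, sq_nonneg t3]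
      simp [hw, ht])
  rw [this]
  have a1 : w2 ^ 2 + t2 ^ 2 + (w3 ^ 2 + t3 ^ 2) + w1 ^ 2 + t1 ^ 2 = (w1 ^ 2 + t1 ^ 2) + (w2 ^ 2 + t2 ^ 2) + (w3 ^ 2 + t3 ^ 2) := by ring
  have a2 : w1 ^ 2 + t1 ^ 2 + (w3 ^ 2 + t3 ^ 2) + w2 ^ 2 + t2 ^ 2 = (w1 ^ 2 + t1 ^ 2) + (w2 ^ 2 + t2 ^ 2) + (w3 ^ 2 + t3 ^ 2) := by ring
  have a3 : w1 ^ 2 + t1 ^ 2 + (w2 ^ 2 + t2 ^ 2) + w3 ^ 2 + t3 ^ 2 = (w1 ^ 2 + t1 ^ 2) + (w2 ^ 2 + t2 ^ 2) + (w3 ^ 2 + t3 ^ 2) := by ring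
  unfold nu
  rw [a1, a2, a3]

section fin
variable (V : E4 × E4 × E4 × E4 → ℂ) (U : E4 → ℝ) (q₀ : ℝ)

noncomputable def A3 (P : (ℝ × ℝ) × (E4 × E4)) : ℂ :=
  V (P.2.1, P.2.2, P.2.1 + P.2.2 - (q₀, P.1), (q₀, P.1)) * (U (P.2.1 + P.2.2 - (q₀, P.1)) : ℂ)
noncomputable def A1 (P : (ℝ × ℝ) × (E4 × E4)) : ℂ :=
  V (P.2.2 - P.2.1 + (q₀, P.1), P.2.1, P.2.2, (q₀, P.1)) * (U (P.2.2 - P.2.1 + (q₀, P.1)) : ℂ)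
noncomputable def A2 (P : (ℝ × ℝ) × (E4 × E4)) : ℂ :=
  V (P.2.1, P.2.2 - P.2.1 + (q₀, P.1), P.2.2, (q₀, P.1)) * (U (P.2.2 - P.2.1 + (q₀, P.1)) : ℂ)

lemma A_cd (hV : ContDiff ℝ 1 V) (hU : ContDiff ℝ 1 U) :
    ContDiff ℝ 1 (A3 V U q₀) ∧ ContDiff ℝ 1 (A1 V U q₀) ∧ ContDiff ℝ 1 (A2 V U q₀) := by
  have hUC : ContDiff ℝ 1 (fun x => (U x : ℂ)) := Complex.ofRealCLM.contDiff.comp hU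
  have hq : ContDiff ℝ 1 (fun P : (ℝ × ℝ) × (E4 × E4) => ((q₀, P.1) : E4)) := contDiff_const.prodMk contDiff_fst
  have h1 : ContDiff ℝ 1 (fun P : (ℝ × ℝ) × (E4 × E4) => P.2.1) := contDiff_fst.comp contDiff_snd
  have h2 : ContDiff ℝ 1 (fun P : (ℝ × ℝ) × (E4 × E4) => P.2.2) := contDiff_snd.comp contDiff_snd
  refine ⟨?_, ?_, ?_⟩
  · exact (hV.comp (h1.prodMk (h2.prodMk (((h1.add h2).sub hq).prodMk hq)))).mul (hUC.comp ((h1.add h2).sub hq))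
  · exact (hV.comp (((h2.sub h1).add hq).prodMk (h1.prodMk (h2.prodMk hq)))).mul (hUC.comp ((h2.sub h1).add hq))
  · exact (hV.comp (h1.prodMk (((h2.sub h1).add hq).prodMk (h2.prodMk hq)))).mul (hUC.comp ((h2.sub h1).add hq))

lemma decomp (e : ℝ × ℝ → ℝ) (q : ℝ × ℝ) (kp : E4 × E4) :
    V (kp.1, kp.2, kp.1 + kp.2 - (q₀, q), (q₀, q)) * Cprop e U kp.1 * Cprop e U kp.2 * Cprop e U (kp.1 + kp.2 - (q₀, q)) =
      WW e U q₀ 1 (A3 V U q₀) q kp + WW e U q₀ (-1) (A1 V U q₀) q (kp.2, kp.1 + kp.2 - (q₀, q)) +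
      WW e U q₀ (-1) (A2 V U q₀) q (kp.1, kp.1 + kp.2 - (q₀, q)) := by
  obtain ⟨k, p⟩ := kp
  set l : E4 := k + p - (q₀, q) with hl
  have w3 : wW q₀ 1 (k, p) = l.1 := by simp [wW, hl]; ring
  have z3 : zW 1 q (k, p) = l.2 := by simp [zW, hl]; abel
  have w1 : wW q₀ (-1) (p, l) = k.1 := by simp [wW, hl]
  have z1 : zW (-1) q (p, l) = k.2 := by simp [zW, hl]
  have w2 : wW q₀ (-1) (k, l) = p.1 := by simp [wW, hl]
  have z2 : zW (-1) q (k, l) = p.2 := by simp [zW, hl]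
  have lk : l - p + (q₀, q) = k := by rw [hl]; abel
  have lp : l - k + (q₀, q) = p := by rw [hl]; abel
  have ht := tri' k.1 (e k.2) p.1 (e p.2) l.1 (e l.2)
  unfold WW gW
  simp only [w3, z3, w1, z1, w2, z2, A3, A1, A2, lk, lp, ← hl, Cprop, Dk, sW]
  generalize Complex.I * (k.1 : ℂ) - (e k.2 : ℂ) = D1 at ht ⊢
  generalize Complex.I * (p.1 : ℂ) - (e p.2 : ℂ) = D2 at ht ⊢
  generalize Complex.I * (l.1 : ℂ) - (e l.2 : ℂ) = D3 at ht ⊢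
  linear_combination (V (k, p, l, (q₀, q)) * (U k : ℂ) * (U p : ℂ) * (U l : ℂ)) * ht

lemma inv2 : (volume : Measure (ℝ × ℝ)).IsAddLeftInvariant := by
  rw [Measure.volume_eq_prod]; infer_instance

lemma inv4 : (volume : Measure E4).IsAddLeftInvariant := by
  have := inv2
  rw [Measure.volume_eq_prod]; infer_instance

lemma mp2 (q : E4) : MeasurePreserving (fun kp : E4 × E4 => (kp.1, kp.1 + kp.2 - q)) := by
  have := inv4
  have h1 : MeasurePreserving (fun z : E4 × E4 => (z.1, z.1 + z.2)) :=
    measurePreserving_prod_add (volume : Measure E4) (volume : Measure E4)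
  have h2 : MeasurePreserving (fun z : E4 × E4 => (z.1, z.2 - q)) :=
    (MeasurePreserving.id (volume : Measure E4)).prod (measurePreserving_sub_right (volume : Measure E4) q)
  exact h2.comp h1

lemma mp1 (q : E4) : MeasurePreserving (fun kp : E4 × E4 => (kp.2, kp.1 + kp.2 - q)) := by
  have h1 : MeasurePreserving (Prod.swap : E4 × E4 → E4 × E4) := Measure.measurePreserving_swap
  have := (mp2 q).comp h1
  convert this using 2 with kp
  simp [add_comm]

end fin

lemma final_thm (n₀ r : ℕ) (hn₀ : 3 ≤ n₀) (hr : 2 * n₀ + 1 ≤ r)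
    (e : ℝ × ℝ → ℝ) (he : ContDiff ℝ r e)
    (hH4 : ∀ k : ℝ × ℝ, e k = 0 → fderiv ℝ e k = 0 → HessCond e k)
    (hH5 : NonFlatCond e r n₀) (hH6 : NoNestingCond e r n₀)
    (U : E4 → ℝ) (hU : ContDiff ℝ 1 U) (hUc : HasCompactSupport U)
    (V : E4 × E4 × E4 × E4 → ℂ) (hV : ContDiff ℝ 1 V) (q₀ : ℝ) :
    (∀ q : ℝ × ℝ, Integrable (fun kp : E4 × E4 =>
        V (kp.1, kp.2, kp.1 + kp.2 - (q₀, q), (q₀, q)) * Cprop e U kp.1 * Cprop e U kp.2 *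
          Cprop e U (kp.1 + kp.2 - (q₀, q)))) ∧
    ContDiff ℝ 1 (fun qv : ℝ × ℝ => Fval e U V (q₀, qv)) := by
  have he1 : ContDiff ℝ 1 e := he.of_le (by exact_mod_cast (by omega : 1 ≤ r))
  obtain ⟨c3, c1, c2⟩ := A_cd V U q₀ hV hU
  have core := fun σ hσ A hA => core_C1 n₀ r hn₀ hr e he hH4 hH5 hH6 U hU.continuous hUc q₀ σ hσ A hA
  obtain ⟨i3, d3⟩ := core 1 (by simp) _ c3
  obtain ⟨i1, d1⟩ := core (-1) (by simp) _ c1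
  obtain ⟨i2, d2⟩ := core (-1) (by simp) _ c2
  have j1 : ∀ q, Integrable fun kp : E4 × E4 => WW e U q₀ (-1) (A1 V U q₀) q (kp.2, kp.1 + kp.2 - (q₀, q)) :=
    fun q => (mp1 (q₀, q)).integrable_comp_of_integrable (i1 q)
  have j2 : ∀ q, Integrable fun kp : E4 × E4 => WW e U q₀ (-1) (A2 V U q₀) q (kp.1, kp.1 + kp.2 - (q₀, q)) :=
    fun q => (mp2 (q₀, q)).integrable_comp_of_integrable (i2 q)
  constructor
  · intro q
    simp only [decomp V U q₀ e q]
    exact ((i3 q).add (j1 q)).add (j2 q)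
  · have hF : (fun qv : ℝ × ℝ => Fval e U V (q₀, qv)) = fun q => (∫ a, WW e U q₀ 1 (A3 V U q₀) q a) +
        (∫ a, WW e U q₀ (-1) (A1 V U q₀) q a) + ∫ a, WW e U q₀ (-1) (A2 V U q₀) q a := by
      funext q
      unfold Fval
      simp only [decomp V U q₀ e q]
      have j3 : Integrable fun kp : E4 × E4 => WW e U q₀ 1 (A3 V U q₀) q kp +
          WW e U q₀ (-1) (A1 V U q₀) q (kp.2, kp.1 + kp.2 - (q₀, q)) := (i3 q).add (j1 q)
      rw [integral_add j3 (j2 q), integral_add (i3 q) (j1 q)]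
      congr 1
      · congr 1
        rw [← (mp1 (q₀, q)).map_eq, integral_map (mp1 (q₀, q)).measurable.aemeasurable
          (WW_meas e U q₀ _ _ he1 hU.continuous c1 q).aestronglyMeasurable]
        simp only [(mp1 (q₀, q)).map_eq]
      · rw [← (mp2 (q₀, q)).map_eq, integral_map (mp2 (q₀, q)).measurable.aemeasurable
          (WW_meas e U q₀ _ _ he1 hU.continuous c2 q).aestronglyMeasurable]
        simp only [(mp2 (q₀, q)).map_eq]
    rw [hF]
    exact (d3.add d1).add d2

end aux

/-- **The second order self-energy is `C¹` in the spatial momentum.** Under (H1)–(H6),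
with `U` smooth and compactly supported and `V` of class `C¹`, the two-loop integral
`F q` converges absolutely for every `q`, and for each fixed frequency `q₀` the map
`q⃗ ↦ F (q₀, q⃗)` is continuously differentiable on `ℝ²`. -/
theorem stmt_5 (n₀ r : ℕ) (hn₀ : 3 ≤ n₀) (hr : 2 * n₀ + 1 ≤ r)
    (e : ℝ × ℝ → ℝ) (he : ContDiff ℝ r e)
    (hH1 : IsCompact {k : ℝ × ℝ | |e k| ≤ 1})
    (hH3 : {k : ℝ × ℝ | e k = 0 ∧ fderiv ℝ e k = 0}.Finite)
    (hH4 : ∀ k : ℝ × ℝ, e k = 0 → fderiv ℝ e k = 0 → HessCond e k)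
    (hH5 : NonFlatCond e r n₀) (hH6 : NoNestingCond e r n₀)
    (U : ℝ × (ℝ × ℝ) → ℝ) (hU : ContDiff ℝ (⊤ : ℕ∞) U) (hUc : HasCompactSupport U)
    (V : (ℝ × (ℝ × ℝ)) × (ℝ × (ℝ × ℝ)) × (ℝ × (ℝ × ℝ)) × (ℝ × (ℝ × ℝ)) → ℂ)
    (hV : ContDiff ℝ 1 V) :
    (∀ q : ℝ × (ℝ × ℝ),
      Integrable (fun kp : (ℝ × (ℝ × ℝ)) × (ℝ × (ℝ × ℝ)) =>
        V (kp.1, kp.2, kp.1 + kp.2 - q, q) * Cprop e U kp.1 * Cprop e U kp.2 *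
          Cprop e U (kp.1 + kp.2 - q))) ∧
    ∀ q₀ : ℝ, ContDiff ℝ 1 (fun qv : ℝ × ℝ => Fval e U V (q₀, qv)) := by
  have hU1 : ContDiff ℝ 1 U := hU.of_le (by exact_mod_cast le_top)
  have key := fun q₀ => final_thm n₀ r hn₀ hr e he hH4 hH5 hH6 U hU1 hUc V hV q₀
  exact ⟨fun q => (key q.1).1 q.2, fun q₀ => (key q₀).2⟩
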